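/- arXiv:2503.17228 — 4 statements merged into one kernel-verified Lean document; each statement's English description precedes it below -/
import Mathlib

section
/- Let q ≡ 2 (mod 3) be an odd prime power, and let N be a monic polynomial in F_q[T]. If N is not a cube in F_q[T], then the Hecke character χ^{(N)} on monic polynomials of F_{q^2}[T] defined by χ^{(N)}(F) = χ_F(N) is a nontrivial character; its L-function L_{q^2}(u, χ^{(N)}) = Σ_{F ∈ F_{q^2}[T] monic} χ_F(N) u^{deg F} is a polynomial in u (of degree at most deg N − 1 in the appropriate normalization), hence entire. -/
open scoped Classical
/-- `IsCubicSymbol q Ω χ` says that χ f a = χ_f(a) is the cubic residue symbol of F_q[T]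
(q ≡ 1 mod 6): it vanishes when f, a are not coprime, is multiplicative in the (monic)
modulus f, and on a monic irreducible P it is the unique cube root of unity α ∈ ℂ with
a^{(|P|−1)/3} ≡ Ω(α) (mod P), where Ω identifies the cube roots of unity of ℂ with those
of F_q. -/
def IsCubicSymbol {Fq : Type*} [Field Fq] [Fintype Fq] (q : ℕ)
    (Ω : rootsOfUnity 3 ℂ ≃* rootsOfUnity 3 Fq)
    (χ : Polynomial Fq → Polynomial Fq → ℂ) : Prop :=
  (∀ f a : Polynomial Fq, ¬ IsCoprime f a → χ f a = 0) ∧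
  (∀ a : Polynomial Fq, χ 1 a = 1) ∧
  (∀ f g a : Polynomial Fq, f.Monic → g.Monic → χ (f * g) a = χ f a * χ g a) ∧
  (∀ (P a : Polynomial Fq) (α : rootsOfUnity 3 ℂ), P.Monic → Irreducible P → ¬ P ∣ a →
    P ∣ a ^ ((q ^ P.natDegree - 1) / 3) - Polynomial.C ((Ω α : Fqˣ) : Fq) →
    χ P a = ((α : ℂˣ) : ℂ))

namespace Polynomial

/-- The resultant with a monic polynomial does not depend on the formal degree of the right
argument. -/
lemma Monic.resultant_eq_of_natDegree_le {R : Type*} [CommRing R] {f g : R[X]} (hf : f.Monic)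
    {n : ℕ} (hn : g.natDegree ≤ n) :
    resultant f g f.natDegree n = resultant f g := by
  obtain ⟨k, rfl⟩ := Nat.exists_eq_add_of_le hn
  rw [resultant_add_right_deg _ _ _ _ _ le_rfl]
  simp [hf.leadingCoeff]

lemma Monic.resultant_mul_right {R : Type*} [CommRing R] {f : R[X]} (hf : f.Monic)
    (g h : R[X]) : resultant f (g * h) = resultant f g * resultant f h := by
  rw [← hf.resultant_eq_of_natDegree_le natDegree_mul_le,
    Polynomial.resultant_mul_right _ _ _ _ le_rfl]

lemma Monic.resultant_mul_left {R : Type*} [CommRing R] {f g : R[X]} (hf : f.Monic)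
    (hg : g.Monic) (h : R[X]) : resultant (f * g) h = resultant f h * resultant g h := by
  rw [hf.natDegree_mul hg, Polynomial.resultant_mul_left _ _ _ _ le_rfl]

lemma Monic.resultant_pow_left {R : Type*} [CommRing R] {f : R[X]} (hf : f.Monic) (h : R[X])
    (n : ℕ) : resultant (f ^ n) h = resultant f h ^ n := by
  induction n with
  | zero => simp
  | succ n ih => rw [pow_succ, (hf.pow n).resultant_mul_left hf, ih, pow_succ]

lemma Monic.resultant_congr_right {R : Type*} [CommRing R] {f g h : R[X]} (hf : f.Monic)
    (hgh : f ∣ g - h) : resultant f g = resultant f h := by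
  obtain ⟨p, hp⟩ := hgh
  obtain rfl : g = h + f * p := by rw [← hp]; ring
  set n := max (max (h + f * p).natDegree h.natDegree) (p.natDegree + f.natDegree)
  rw [← hf.resultant_eq_of_natDegree_le (n := n) (by simp [n]),
    ← hf.resultant_eq_of_natDegree_le (n := n) (g := h) (by simp [n])]
  exact resultant_add_mul_right _ _ _ _ _ (by simp [n]) le_rfl

/-- The norm of a residue class modulo a monic irreducible `P` is a resultant. -/
lemma norm_adjoinRoot_mk_eq_resultant {K : Type*} [Field K] [PerfectField K] {P : K[X]}
    (hP : P.Monic) [Fact (Irreducible P)] (a : K[X]) :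
    Algebra.norm K (AdjoinRoot.mk P a) = resultant P a := by
  have hirr : Irreducible P := Fact.out
  let E := AlgebraicClosure K
  have : FiniteDimensional K (AdjoinRoot P) := (AdjoinRoot.powerBasis hirr.ne_zero).finite
  have hnodup : (P.aroots E).Nodup := nodup_roots (PerfectField.separable_of_irreducible hirr).map
  apply (algebraMap K E).injective
  have key := resultant_eq_prod_eval (P.map (algebraMap K E)) (a.map (algebraMap K E)) a.natDegree
    (by simp) (IsAlgClosed.splits _)
  rw [natDegree_map, resultant_map_map, (hP.map _).leadingCoeff, one_pow, one_mul] at key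
  have hprod : (((P.aroots E).toFinset.val).map
      fun x => (a.map (algebraMap K E)).eval x).prod =
        ∏ x : {x // x ∈ P.aroots E}, (a.map (algebraMap K E)).eval x.1 :=
    (Finset.prod_subtype _ (by simp [hirr.ne_zero]) _)
  rw [Multiset.toFinset_val, hnodup.dedup] at hprod
  rw [Algebra.norm_eq_prod_embeddings, key, hprod]
  refine Fintype.prod_equiv (AdjoinRoot.equiv E K P hirr.ne_zero) _ _ fun σ => ?_
  have hσ : ((AdjoinRoot.equiv E K P hirr.ne_zero) σ).1 = σ (AdjoinRoot.root P) := rfl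
  rw [hσ, eval_map_algebraMap, aeval_algHom_apply, AdjoinRoot.aeval_eq]

/-- `resultant P a` modulo a monic irreducible `P` over a finite field. -/
lemma dvd_pow_sub_C_resultant {K : Type*} [Field K] [Finite K] {P : K[X]}
    (hP : P.Monic) (hirr : Irreducible P) (a : K[X]) :
    P ∣ a ^ ((Nat.card K ^ P.natDegree - 1) / (Nat.card K - 1)) - C (resultant P a) := by
  have : Fact (Irreducible P) := ⟨hirr⟩
  have : FiniteDimensional K (AdjoinRoot P) := (AdjoinRoot.powerBasis hirr.ne_zero).finite
  have : Finite (AdjoinRoot P) := Module.finite_of_finite K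
  have h := FiniteField.algebraMap_norm_eq_pow (K := K) (K' := AdjoinRoot P)
    (x := AdjoinRoot.mk P a)
  rw [norm_adjoinRoot_mk_eq_resultant hP,
    Module.natCard_eq_pow_finrank (K := K) (V := AdjoinRoot P),
    (AdjoinRoot.powerBasis hirr.ne_zero).finrank, AdjoinRoot.powerBasis_dim] at h
  rw [← AdjoinRoot.mk_eq_zero, map_sub, map_pow, sub_eq_zero, AdjoinRoot.mk_C, ← h]
  rfl

lemma exists_resultant_eq {K : Type*} [Field K] [Finite K] {P : K[X]}
    (hP : P.Monic) (hirr : Irreducible P) (c : K) : ∃ a : K[X], resultant P a = c := by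
  have : Fact (Irreducible P) := ⟨hirr⟩
  have : FiniteDimensional K (AdjoinRoot P) := (AdjoinRoot.powerBasis hirr.ne_zero).finite
  have : Finite (AdjoinRoot P) := Module.finite_of_finite K
  obtain ⟨x, hx⟩ := FiniteField.norm_surjective K (AdjoinRoot P) c
  obtain ⟨a, rfl⟩ := AdjoinRoot.mk_surjective x
  exact ⟨a, by rw [← norm_adjoinRoot_mk_eq_resultant hP, hx]⟩

/-- A monic polynomial that is not a `k`-th power has an irreducible factor whose multiplicity is
not divisible by `k`. -/
lemma Monic.exists_eq_pow_mul_of_not_pow {K : Type*} [Field K] {N : K[X]} (hN : N.Monic) {k : ℕ}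
    (h : ¬ ∃ M : K[X], N = M ^ k) :
    ∃ (p r : K[X]) (e : ℕ), p.Monic ∧ Irreducible p ∧ ¬ k ∣ e ∧ ¬ p ∣ r ∧ N = p ^ e * r := by
  by_contra! H
  apply h
  set s := UniqueFactorizationMonoid.normalizedFactors N
  have hs : s.prod = N := by
    rw [UniqueFactorizationMonoid.prod_normalizedFactors_eq hN.ne_zero, hN.normalize_eq_self]
  have hc : ∀ p ∈ s.toFinset, k ∣ s.count p := by
    intro p hp
    rw [Multiset.mem_toFinset] at hp
    have hirr := UniqueFactorizationMonoid.irreducible_of_normalized_factor p hp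
    have hnorm := UniqueFactorizationMonoid.normalize_normalized_factor p hp
    have hpm : p.Monic := by rw [← hnorm]; exact monic_normalize hirr.ne_zero
    have hmul := UniqueFactorizationMonoid.emultiplicity_eq_count_normalizedFactors hirr hN.ne_zero
    rw [hnorm] at hmul
    obtain ⟨⟨r, hr⟩, hnd⟩ := emultiplicity_eq_coe.mp hmul
    by_contra hk
    refine H p r _ hpm hirr hk (fun ⟨t, ht⟩ => hnd ⟨t, ?_⟩) hr
    rw [pow_succ, mul_assoc, ← ht, ← hr]
  choose! m hm using hc
  refine ⟨∏ p ∈ s.toFinset, p ^ m p, ?_⟩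
  rw [← hs, Finset.prod_multiset_count, ← Finset.prod_pow]
  refine Finset.prod_congr rfl fun p hp => ?_
  rw [hm p hp, mul_comm, pow_mul]

/-- A monic polynomial over a perfect field that is not a `k`-th power has, over any extension
field, an irreducible factor whose multiplicity is not divisible by `k`. -/
lemma Monic.exists_map_eq_pow_mul_of_not_pow {K L : Type*} [Field K] [PerfectField K] [Field L]
    [Algebra K L] {N : K[X]} (hN : N.Monic) {k : ℕ} (h : ¬ ∃ M : K[X], N = M ^ k) :
    ∃ (p r : L[X]) (e : ℕ), p.Monic ∧ Irreducible p ∧ ¬ k ∣ e ∧ ¬ p ∣ r ∧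
      N.map (algebraMap K L) = p ^ e * r := by
  obtain ⟨p, r, e, hpm, hirr, hk, hpr, rfl⟩ := hN.exists_eq_pow_mul_of_not_pow h
  obtain ⟨P, hPm, hPirr, s, hs⟩ := exists_monic_irreducible_factor (p.map (algebraMap K L))
    (by
      rw [isUnit_map]
      exact hirr.not_isUnit)
  refine ⟨P, s ^ e * r.map (algebraMap K L), e, hPm, hPirr, hk, fun hd => ?_, ?_⟩
  · rcases hPirr.prime.dvd_or_dvd hd with hd | hd
    · obtain ⟨t, rfl⟩ := hPirr.prime.dvd_of_dvd_pow hd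
      have hsq := (PerfectField.separable_of_irreducible hirr).map (f := algebraMap K L)
        |>.squarefree
      exact hPirr.not_isUnit (hsq P ⟨t, by rw [hs]; ring⟩)
    · have hco := ((hirr.coprime_iff_not_dvd).mpr hpr).map (mapRingHom (algebraMap K L))
      exact hPirr.not_isUnit (hco.isUnit_of_dvd' ⟨s, hs⟩ hd)
  · rw [Polynomial.map_mul, Polynomial.map_pow, hs]; ring

/-- Multiplying the remainder modulo a monic polynomial by a unit, keeping the quotient. -/
noncomputable def remainderMul {R : Type*} [CommRing R] (N u F : R[X]) : R[X] :=
  (u * F) %ₘ N + N * (F /ₘ N)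

lemma remainderMul_divByMonic {R : Type*} [CommRing R] [Nontrivial R] {N : R[X]} (hN : N.Monic)
    (u F : R[X]) : remainderMul N u F /ₘ N = F /ₘ N :=
  (div_modByMonic_unique _ _ hN ⟨rfl, degree_modByMonic_lt _ hN⟩).1

lemma dvd_remainderMul_sub {R : Type*} [CommRing R] (N u F : R[X]) :
    N ∣ remainderMul N u F - u * F := by
  refine ⟨F /ₘ N - (u * F) /ₘ N, ?_⟩
  rw [remainderMul]
  linear_combination modByMonic_add_div (u * F) N

lemma remainderMul_remainderMul {R : Type*} [CommRing R] [Nontrivial R] {N u v : R[X]}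
    (hN : N.Monic) (huv : N ∣ u * v - 1) (F : R[X]) :
    remainderMul N u (remainderMul N v F) = F := by
  have h : (u * remainderMul N v F) %ₘ N = F %ₘ N := by
    rw [← sub_eq_zero, ← sub_modByMonic, modByMonic_eq_zero_iff_dvd hN]
    have := dvd_add ((dvd_remainderMul_sub N v F).mul_left u) (huv.mul_right F)
    convert this using 1
    ring
  rw [remainderMul, h, remainderMul_divByMonic hN, modByMonic_add_div]

lemma degree_remainderMul_sub_lt {R : Type*} [CommRing R] [Nontrivial R] {N : R[X]}
    (hN : N.Monic) (u F : R[X]) : (remainderMul N u F - F).degree < N.degree := by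
  have : remainderMul N u F - F = (u * F) %ₘ N - F %ₘ N := by
    rw [remainderMul]
    linear_combination modByMonic_add_div F N
  rw [this]
  exact (degree_sub_le _ _).trans_lt
    (max_lt (degree_modByMonic_lt _ hN) (degree_modByMonic_lt _ hN))

lemma monic_and_natDegree_remainderMul {R : Type*} [CommRing R] [Nontrivial R] {N : R[X]}
    (hN : N.Monic) (u : R[X]) {F : R[X]} {n : ℕ} (hn : N.natDegree ≤ n)
    (hF : F.Monic ∧ F.natDegree = n) :
    (remainderMul N u F).Monic ∧ (remainderMul N u F).natDegree = n := by
  have hlt : (remainderMul N u F - F).degree < F.degree := by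
    refine (degree_remainderMul_sub_lt hN u F).trans_le ?_
    rw [degree_eq_natDegree hN.ne_zero, degree_eq_natDegree hF.1.ne_zero, hF.2]
    exact_mod_cast hn
  have heq : remainderMul N u F = F + (remainderMul N u F - F) := by ring
  rw [heq]
  refine ⟨hF.1.add_of_left hlt, ?_⟩
  rw [natDegree_add_eq_left_of_degree_lt hlt, hF.2]

/-- A function on polynomials over a ring that is periodic modulo `N` and multiplicative, but not
identically `1` on units modulo `N`, sums to zero over the monic polynomials of degree
`n ≥ natDegree N`. -/
lemma finsum_monic_natDegree_eq_zero {R A : Type*} [CommRing R] [Nontrivial R] [Field A]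
    {N : R[X]} (hN : N.Monic) {h : R[X] → A} (hmod : ∀ F G, N ∣ F - G → h F = h G)
    (hmul : ∀ F G, h (F * G) = h F * h G) {u v : R[X]} (huv : N ∣ u * v - 1) (hu : h u ≠ 1)
    {n : ℕ} (hn : N.natDegree ≤ n) :
    ∑ᶠ F : R[X], (if F.Monic ∧ F.natDegree = n then h F else 0) = 0 := by
  have hvu : N ∣ v * u - 1 := by rwa [mul_comm]
  let σ : R[X] ≃ R[X] :=
    ⟨remainderMul N u, remainderMul N v, remainderMul_remainderMul hN hvu,
      remainderMul_remainderMul hN huv⟩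
  set g : R[X] → A := fun F => if F.Monic ∧ F.natDegree = n then h F else 0
  have hσ : ∀ F, g (σ F) = h u • g F := by
    intro F
    have hiff : ((σ F).Monic ∧ (σ F).natDegree = n) ↔ (F.Monic ∧ F.natDegree = n) := by
      refine ⟨fun H => ?_, monic_and_natDegree_remainderMul hN u hn⟩
      have := monic_and_natDegree_remainderMul hN v hn H
      rwa [show remainderMul N v (σ F) = F from σ.left_inv F] at this
    simp only [g, hiff]
    split_ifs
    · rw [smul_eq_mul, ← hmul]
      exact hmod _ _ (dvd_remainderMul_sub N u F)
    · simp
  have hsum : ∑ᶠ F, g F = h u * ∑ᶠ F, g F := by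
    conv_lhs => rw [← finsum_comp_equiv σ]
    simp_rw [hσ]
    rw [← smul_finsum, smul_eq_mul]
  have : (h u - 1) * ∑ᶠ F, g F = 0 := by linear_combination -hsum
  exact (mul_eq_zero.mp this).resolve_left (sub_ne_zero.mpr hu)

lemma exists_monic_dvd_sub {R : Type*} [CommRing R] {N : R[X]} (hN : N.Monic)
    (F : R[X]) : ∃ G : R[X], G.Monic ∧ N ∣ G - F := by
  nontriviality R
  refine ⟨F + N * X ^ (F.natDegree + 1), ?_, ⟨X ^ (F.natDegree + 1), by ring⟩⟩
  have hm : (N * X ^ (F.natDegree + 1)).Monic := hN.mul (monic_X_pow _)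
  refine hm.add_of_right ?_
  refine degree_le_natDegree.trans_lt ?_
  rw [degree_eq_natDegree hm.ne_zero, hN.natDegree_mul (monic_X_pow _), natDegree_X_pow]
  exact_mod_cast (by lia)

lemma exists_resultant_eq_pow {K : Type*} [Field K] [Finite K] {P R : K[X]} {e : ℕ}
    (hP : P.Monic) (hR : R.Monic) (hirr : Irreducible P) (hPR : ¬ P ∣ R) (c : K) :
    ∃ F : K[X], resultant (P ^ e * R) F = c ^ e := by
  obtain ⟨g, hg⟩ := exists_resultant_eq hP hirr c
  obtain ⟨a, b, hab⟩ := hirr.coprime_iff_not_dvd.mpr hPR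
  refine ⟨g + (1 - g) * (a * P), ?_⟩
  rw [(hP.pow e).resultant_mul_left hR, hP.resultant_pow_left,
    hP.resultant_congr_right (h := g) ⟨(1 - g) * a, by ring⟩,
    hR.resultant_congr_right (h := 1) ⟨(g - 1) * b, by linear_combination (1 - g) * hab⟩, hg]
  simp

end Polynomial

open Polynomial

/-- The cubic character of a finite field attached to an identification of cube roots of unity. -/
lemma exists_cubic_character {K : Type*} [Field K] [Fintype K] (h3 : 3 ∣ Fintype.card K - 1)
    (Ω : rootsOfUnity 3 ℂ ≃* rootsOfUnity 3 K) :
    ∃ ψ : MulChar K ℂ, (∃ c : Kˣ, ψ c ≠ 1) ∧ ∀ c : Kˣ, ∃ α : rootsOfUnity 3 ℂ,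
      ((Ω α : Kˣ) : K) = (c : K) ^ ((Fintype.card K - 1) / 3) ∧ ψ c = ((α : ℂˣ) : ℂ) := by
  set m := (Fintype.card K - 1) / 3 with hm
  have hm3 : m * 3 = Fintype.card K - 1 := Nat.div_mul_cancel h3
  have hcard : Fintype.card Kˣ = Fintype.card K - 1 := by
    rw [← Nat.card_eq_fintype_card, Nat.card_units, Nat.card_eq_fintype_card]
  have hpos : 0 < Fintype.card Kˣ := Fintype.card_pos
  let φ : Kˣ →* rootsOfUnity 3 K := (powMonoidHom m).codRestrict _ fun c => by
    rw [mem_rootsOfUnity, powMonoidHom_apply, ← pow_mul, hm3, ← hcard, pow_card_eq_one]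
  let τ : Kˣ →* ℂˣ := (rootsOfUnity 3 ℂ).subtype.comp (Ω.symm.toMonoidHom.comp φ)
  refine ⟨MulChar.ofUnitHom τ, ?_, fun c => ⟨Ω.symm (φ c), ?_, ?_⟩⟩
  · obtain ⟨c, hc⟩ := IsCyclic.exists_generator (α := Kˣ)
    refine ⟨c, fun h => ?_⟩
    rw [MulChar.ofUnitHom_coe, Units.val_eq_one] at h
    have h1 : Ω.symm (φ c) = 1 := Subtype.ext h
    rw [map_eq_one_iff _ Ω.symm.injective] at h1
    have h2 : c ^ m = 1 := congrArg Subtype.val h1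
    have h3 := orderOf_dvd_of_pow_eq_one h2
    rw [orderOf_eq_card_of_forall_mem_zpowers hc, Nat.card_eq_fintype_card] at h3
    have := Nat.le_of_dvd (by lia) h3
    lia
  · rw [MulEquiv.apply_symm_apply]
    simp [φ]
  · rw [MulChar.ofUnitHom_coe]
    rfl

/-- The cubic residue symbol as a cubic character evaluated at a resultant. -/
lemma IsCubicSymbol.eq_resultant {K : Type*} [Field K] [Fintype K]
    (h3 : 3 ∣ Fintype.card K - 1) {Ω : rootsOfUnity 3 ℂ ≃* rootsOfUnity 3 K}
    {χ : K[X] → K[X] → ℂ} (hχ : IsCubicSymbol (Fintype.card K) Ω χ) {ψ : MulChar K ℂ}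
    (hψ : ∀ c : Kˣ, ∃ α : rootsOfUnity 3 ℂ,
      ((Ω α : Kˣ) : K) = (c : K) ^ ((Fintype.card K - 1) / 3) ∧ ψ c = ((α : ℂˣ) : ℂ))
    {F : K[X]} (hF : F.Monic) (a : K[X]) : χ F a = ψ (resultant F a) := by
  obtain ⟨hzero, hone, hmul, hprime⟩ := hχ
  have hirr : ∀ P : K[X], P.Monic → Irreducible P → χ P a = ψ (resultant P a) := by
    intro P hP hPirr
    by_cases hco : IsCoprime P a
    · have hne : resultant P a ≠ 0 := fun h => (resultant_eq_zero_iff.mp h).2 hco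
      obtain ⟨α, hα, hα'⟩ := hψ (Units.mk0 _ hne)
      rw [Units.val_mk0] at hα hα'
      rw [hα']
      refine hprime P a α hP hPirr (hPirr.coprime_iff_not_dvd.mp hco) ?_
      obtain ⟨m, hm⟩ := h3
      have hd := dvd_pow_sub_C_resultant hP hPirr a
      rw [Nat.card_eq_fintype_card] at hd
      obtain ⟨t, ht⟩ : Fintype.card K - 1 ∣ Fintype.card K ^ P.natDegree - 1 := by
        simpa using Nat.sub_dvd_pow_sub_pow (Fintype.card K) 1 P.natDegree
      have hpos : 0 < Fintype.card K - 1 := by have := Fintype.one_lt_card (α := K); lia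
      rw [ht, Nat.mul_div_cancel_left _ hpos] at hd
      have hm' : (Fintype.card K - 1) / 3 = m := by lia
      rw [hα, hm', ht, hm, mul_assoc, Nat.mul_div_cancel_left _ (by norm_num), mul_comm m t,
        pow_mul, C_pow]
      exact hd.trans (sub_dvd_pow_sub_pow _ _ m)
    · rw [hzero _ _ hco, resultant_eq_zero_iff.mpr ⟨Or.inl hP.ne_zero, hco⟩]
      exact (ψ.map_nonunit not_isUnit_zero).symm
  obtain ⟨n, hd⟩ : ∃ n, F.natDegree = n := ⟨_, rfl⟩
  induction n using Nat.strong_induction_on generalizing F with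
  | _ n ih =>
    by_cases hu : IsUnit F
    · rw [hF.eq_one_of_isUnit hu, hone]
      simp
    · obtain ⟨P, hP, hPirr, G, rfl⟩ := exists_monic_irreducible_factor F hu
      have hG : G.Monic := hP.of_mul_monic_left hF
      have hdeg := hP.natDegree_mul hG
      have hPpos := hPirr.natDegree_pos
      rw [hmul _ _ _ hP hG, hirr P hP hPirr, ih G.natDegree (by lia) hG rfl,
        hP.resultant_mul_left hG, map_mul]

/-- Let q ≡ 2 (mod 3) be an odd prime power and N ∈ F_q[T] monic, not a cube
in F_q[T]. The Hecke character χ^{(N)} : F ↦ χ_F(N) on monic polynomials of F_{q²}[T]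
(given by the cubic residue symbol of F_{q²}[T]) is nontrivial, and its L-function
L_{q²}(u, χ^{(N)}) = Σ_F χ_F(N) u^{deg F} is a polynomial in u of degree at most
deg N − 1, hence entire: the coefficient sums Σ_{deg F = n} χ_F(N) vanish for
n ≥ deg N. -/
theorem hecke_character_L_function_polynomial {Fq Fq2 : Type*} [Field Fq] [Field Fq2]
    [Fintype Fq] [Fintype Fq2] [Algebra Fq Fq2]
    (q : ℕ) (hq : Fintype.card Fq = q) (hq2 : Fintype.card Fq2 = q ^ 2)
    (hodd : Odd q) (h3 : q % 3 = 2)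
    (Ω : rootsOfUnity 3 ℂ ≃* rootsOfUnity 3 Fq2)
    (χ : Polynomial Fq2 → Polynomial Fq2 → ℂ) (hχ : IsCubicSymbol (q ^ 2) Ω χ)
    (N : Polynomial Fq) (hNm : N.Monic) (hN : ¬ ∃ M : Polynomial Fq, N = M ^ 3) :
    (∃ F : Polynomial Fq2, F.Monic ∧ χ F (N.map (algebraMap Fq Fq2)) ≠ 0 ∧
        χ F (N.map (algebraMap Fq Fq2)) ≠ 1) ∧
    (∀ n : ℕ, N.natDegree ≤ n →
      (∑ᶠ F : Polynomial Fq2,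
          if F.Monic ∧ F.natDegree = n then χ F (N.map (algebraMap Fq Fq2)) else 0) = 0) := by
  have h3K : 3 ∣ Fintype.card Fq2 - 1 := by
    rw [hq2]
    have : q ^ 2 % 3 = 1 := by rw [Nat.pow_mod, h3]
    lia
  rw [← hq2] at hχ
  obtain ⟨ψ, ⟨c, hc⟩, hψ⟩ := exists_cubic_character h3K Ω
  have hψ3 : ∀ x : Fq2ˣ, ψ x ^ 3 = 1 := by
    intro x
    obtain ⟨α, -, hα⟩ := hψ x
    have := (mem_rootsOfUnity _ _).mp α.2
    rw [hα, ← Units.val_pow_eq_pow_val, this, Units.val_one]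
  have hψneg : ψ (-1) = 1 := by
    have h1 := hψ3 (-1)
    have h2 : ψ (-1) * ψ (-1) = 1 := by rw [← map_mul]; simp
    rw [Units.val_neg, Units.val_one] at h1
    linear_combination h1 - ψ (-1) * h2
  set N' := N.map (algebraMap Fq Fq2) with hN'
  have hN'm : N'.Monic := hNm.map _
  have hsymm : ∀ F : Fq2[X], F.Monic → χ F N' = ψ (resultant N' F) := by
    intro F hF
    rw [hχ.eq_resultant h3K hψ hF, resultant_comm, map_mul, map_pow, hψneg, one_pow, one_mul]
  obtain ⟨P, R, e, hP, hPirr, he, hPR, hNPR⟩ :=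
    hNm.exists_map_eq_pow_mul_of_not_pow (L := Fq2) (k := 3) hN
  have hR : R.Monic := (hP.pow e).of_mul_monic_left (hNPR ▸ hN'm)
  obtain ⟨F₀, hF₀⟩ := exists_resultant_eq_pow (e := e) hP hR hPirr hPR (c : Fq2)
  obtain ⟨F, hF, hFF₀⟩ := exists_monic_dvd_sub hN'm F₀
  have hres : resultant N' F = (c : Fq2) ^ e := by
    rw [hN'm.resultant_congr_right hFF₀, hN', hNPR, hF₀]
  have hval : ψ (resultant N' F) ≠ 1 := by
    rw [hres, map_pow]
    intro h
    have h1 := orderOf_dvd_of_pow_eq_one h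
    rw [orderOf_eq_prime (hψ3 c) hc] at h1
    exact he h1
  have hne : resultant N' F ≠ 0 := by
    rw [hres]
    exact pow_ne_zero _ c.ne_zero
  refine ⟨⟨F, hF, ?_, ?_⟩, fun n hn => ?_⟩
  · rw [hsymm F hF]
    exact ((isUnit_iff_ne_zero.mpr hne).map ψ).ne_zero
  · rwa [hsymm F hF]
  · have hco : IsCoprime N' F := by
      by_contra h
      exact hne (resultant_eq_zero_iff.mpr ⟨Or.inl hN'm.ne_zero, h⟩)
    obtain ⟨s, v, hsv⟩ := hco
    have key := finsum_monic_natDegree_eq_zero hN'm (h := fun G => ψ (resultant N' G))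
      (fun G H hGH => by rw [hN'm.resultant_congr_right hGH])
      (fun G H => by rw [hN'm.resultant_mul_right, map_mul])
      (u := F) (v := v) ⟨-s, by linear_combination hsv⟩ hval (n := n)
      (by rwa [hN', natDegree_map])
    refine (finsum_congr fun G => ?_).trans key
    split_ifs with hG
    · exact hsymm G hG.1
    · rfl
end

section
/- Let U ⊆ R^n be a connected open set and let f be a holomorphic function on the tube T(U) = U + iR^n ⊆ C^n. Then f extends to a holomorphic function on the tube over the convex hull of U (Bochner's tube theorem). -/
/-- The tube over a set U ⊆ ℝⁿ: all z ∈ ℂⁿ with Re(z) ∈ U. -/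
def tube (n : ℕ) (U : Set (Fin n → ℝ)) : Set (Fin n → ℂ) :=
  {z | (fun i => (z i).re) ∈ U}

section BochnerTube

open Set Filter Topology Metric MeasureTheory

theorem norm_fderiv_le_of_norm_le_on_ball {E : Type*} [NormedAddCommGroup E] [NormedSpace ℂ E]
    {f : E → ℂ} {c : E} {r ε : ℝ} (hr : 0 < r) (hf : DifferentiableOn ℂ f (ball c r))
    (hε : ∀ z ∈ ball c r, ‖f z‖ ≤ ε) : ‖fderiv ℂ f c‖ ≤ (ε + ε) / r := by
  refine Complex.norm_fderiv_le_div_of_mapsTo_ball hf (fun z hz => ?_) hr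
  rw [mem_closedBall, dist_eq_norm]
  exact (norm_sub_le _ _).trans (add_le_add (hε z hz) (hε c (mem_ball_self hr)))

/-- A holomorphic function on an open subset of a finite-dimensional space is `C¹`. -/
theorem DifferentiableOn.continuousOn_fderiv_complex {E : Type*} [NormedAddCommGroup E]
    [NormedSpace ℂ E] [ProperSpace E] {Ω : Set E} (hΩ : IsOpen Ω) {f : E → ℂ}
    (hf : DifferentiableOn ℂ f Ω) : ContinuousOn (fderiv ℂ f) Ω := by
  intro w₀ hw₀
  refine ContinuousAt.continuousWithinAt ?_
  obtain ⟨ρ, hρ, hρΩ⟩ := Metric.isOpen_iff.1 hΩ w₀ hw₀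
  have hK : IsCompact (closedBall w₀ (ρ / 2)) := isCompact_closedBall _ _
  have hKΩ : closedBall w₀ (ρ / 2) ⊆ Ω :=
    (closedBall_subset_ball (by linarith)).trans hρΩ
  have huc := hK.uniformContinuousOn_of_continuous (hf.continuousOn.mono hKΩ)
  rw [Metric.uniformContinuousOn_iff] at huc
  rw [Metric.continuousAt_iff]
  intro ε hε
  obtain ⟨δ, hδ, hδf⟩ := huc (ε * (ρ / 4) / 4) (by positivity)
  refine ⟨min δ (ρ / 4), by positivity, fun {w} hw => ?_⟩
  have hwδ := hw.trans_le (min_le_left _ _)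
  have hwρ := hw.trans_le (min_le_right _ _)
  have hmem : ∀ x ∈ ball (0 : E) (ρ / 4), w + x ∈ closedBall w₀ (ρ / 2) := by
    intro x hx
    rw [mem_ball_zero_iff] at hx
    rw [mem_closedBall, dist_eq_norm]
    rw [dist_eq_norm] at hwρ
    have := norm_add_le (w - w₀) x
    rw [show w + x - w₀ = w - w₀ + x by abel]
    linarith
  have hmem₀ : ∀ x ∈ ball (0 : E) (ρ / 4), w₀ + x ∈ closedBall w₀ (ρ / 2) := by
    intro x hx
    rw [mem_ball_zero_iff] at hx
    rw [mem_closedBall, dist_eq_norm, add_sub_cancel_left]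
    linarith
  have hd : ∀ u : E, u ∈ Ω → HasFDerivAt f (fderiv ℂ f u) u := fun u hu =>
    (hf.differentiableAt (hΩ.mem_nhds hu)).hasFDerivAt
  have hda : ∀ a x : E, a + x ∈ Ω →
      HasFDerivAt (fun x => f (a + x)) (fderiv ℂ f (a + x)) x := fun a x hax => by
    rw [hasFDerivAt_comp_add_left]
    exact hd _ hax
  have h0 : (0 : E) ∈ ball (0 : E) (ρ / 4) := mem_ball_self (by positivity)
  have key := norm_fderiv_le_of_norm_le_on_ball (f := fun x => f (w + x) - f (w₀ + x)) (c := (0 : E))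
    (r := ρ / 4) (ε := ε * (ρ / 4) / 4) (by positivity)
    (fun x hx => ((hda w x (hKΩ (hmem x hx))).sub
      (hda w₀ x (hKΩ (hmem₀ x hx)))).differentiableAt.differentiableWithinAt)
    (fun x hx => by
      rw [← dist_eq_norm]
      exact (hδf _ (hmem x hx) _ (hmem₀ x hx) (by simpa using hwδ)).le)
  have heq : fderiv ℂ (fun x => f (w + x) - f (w₀ + x)) 0 = fderiv ℂ f w - fderiv ℂ f w₀ := by
    have := ((hda w 0 (hKΩ (hmem 0 h0))).sub (hda w₀ 0 (hKΩ (hmem₀ 0 h0)))).fderiv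
    simp only [add_zero] at this
    exact this
  rw [heq] at key
  rw [dist_eq_norm]
  refine key.trans_lt ?_
  rw [div_lt_iff₀ (by positivity)]
  have : 0 < ε * (ρ / 4) := by positivity
  linarith

/-- The limit of a sequence of holomorphic functions, uniformly Cauchy on a ball, is holomorphic. -/
theorem differentiableAt_of_tendsto_of_cauchy_on_ball {E : Type*} [NormedAddCommGroup E]
    [NormedSpace ℂ E] {F : ℕ → E → ℂ} (hF : ∀ k, Differentiable ℂ (F k)) {g : E → ℂ} {z₀ : E}
    {ρ : ℝ} (hρ : 0 < ρ)
    (hc : ∀ ε > 0, ∃ N, ∀ k ≥ N, ∀ l ≥ N, ∀ z ∈ ball z₀ ρ, ‖F k z - F l z‖ ≤ ε)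
    (hg : ∀ z ∈ ball z₀ ρ, Tendsto (fun k => F k z) atTop (𝓝 (g z))) :
    DifferentiableAt ℂ g z₀ := by
  have hsub : ∀ z ∈ ball z₀ (ρ / 2), ball z (ρ / 2) ⊆ ball z₀ ρ := fun z hz =>
    ball_subset_ball' (by rw [mem_ball] at hz; linarith)
  have hcauchy : UniformCauchySeqOn (fun k => fderiv ℂ (F k)) atTop (ball z₀ (ρ / 2)) := by
    rw [Metric.uniformCauchySeqOn_iff]
    intro ε hε
    obtain ⟨N, hN⟩ := hc (ε * (ρ / 2) / 4) (by positivity)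
    refine ⟨N, fun k hk l hl z hz => ?_⟩
    have key := norm_fderiv_le_of_norm_le_on_ball (f := fun z => F k z - F l z) (c := z)
      (r := ρ / 2) (ε := ε * (ρ / 2) / 4) (by positivity)
      ((hF k).sub (hF l)).differentiableOn (fun w hw => hN k hk l hl w (hsub z hz hw))
    rw [fderiv_fun_sub (hF k z) (hF l z)] at key
    rw [dist_eq_norm]
    refine key.trans_lt ?_
    rw [div_lt_iff₀ (by positivity)]
    have : 0 < ε * (ρ / 2) := by positivity
    linarith
  have hlim : ∀ z ∈ ball z₀ (ρ / 2), ∃ L, Tendsto (fun k => fderiv ℂ (F k) z) atTop (𝓝 L) :=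
    fun z hz => cauchySeq_tendsto_of_complete (hcauchy.cauchySeq hz)
  choose! g' hg' using hlim
  have hu := hcauchy.tendstoUniformlyOn_of_tendsto hg'
  exact (hasFDerivAt_of_tendstoUniformlyOn isOpen_ball hu
    (fun k z _ => (hF k z).hasFDerivAt)
    (fun z hz => hg z (ball_subset_ball (by linarith) hz))
    (mem_ball_self (by positivity))).differentiableAt

/-- A connected set contained in an open set `H` which is closed under filling in triangles has its
convex hull contained in `H`. -/
theorem convexHull_subset_of_triangle {E : Type*} [NormedAddCommGroup E] [NormedSpace ℝ E]
    {U H : Set E} (hH : IsOpen H) (hU : IsPreconnected U) (hUH : U ⊆ H)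
    (htri : ∀ a b c, segment ℝ a b ⊆ H → segment ℝ a c ⊆ H → ∀ α β : ℝ, 0 ≤ α → 0 ≤ β →
      α + β ≤ 1 → a + α • (b - a) + β • (c - a) ∈ H) :
    convexHull ℝ U ⊆ H := by
  rcases U.eq_empty_or_nonempty with rfl | ⟨x₀, hx₀⟩
  · simp
  set C : Set E := {y | segment ℝ x₀ y ⊆ H} with hC
  have hCH : C ⊆ H := fun y hy => hy (right_mem_segment ℝ x₀ y)
  have hCconv : Convex ℝ C := by
    intro b hb c hc s t hs ht hst p hp
    rw [segment_eq_image'] at hp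
    obtain ⟨l, ⟨hl0, hl1⟩, rfl⟩ := hp
    have := htri x₀ b c hb hc (l * s) (l * t) (by positivity) (by positivity)
      (by rw [← mul_add, hst]; linarith)
    convert this using 1
    have : (x₀ : E) = s • x₀ + t • x₀ := by rw [← add_smul, hst, one_smul]
    have h2 : s • b + t • c - x₀ = s • (b - x₀) + t • (c - x₀) := by
      nth_rw 1 [this]; simp only [smul_sub]; abel
    simp only [h2, smul_add, smul_smul, add_assoc]
  have hCopen : IsOpen C := by
    rw [Metric.isOpen_iff]
    intro y hy
    have hcomp : IsCompact (segment ℝ x₀ y) := by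
      rw [segment_eq_image']
      exact isCompact_Icc.image (by fun_prop)
    obtain ⟨δ, hδ, hδH⟩ := hcomp.exists_thickening_subset_open hH hy
    refine ⟨δ, hδ, fun y' hy' p hp => hδH ?_⟩
    rw [segment_eq_image'] at hp
    obtain ⟨l, ⟨hl0, hl1⟩, rfl⟩ := hp
    rw [mem_thickening_iff]
    refine ⟨x₀ + l • (y - x₀), by rw [segment_eq_image']; exact ⟨l, ⟨hl0, hl1⟩, rfl⟩, ?_⟩
    rw [mem_ball, dist_eq_norm] at hy'
    rw [dist_eq_norm, show x₀ + l • (y' - x₀) - (x₀ + l • (y - x₀)) = l • (y' - y) by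
      simp only [smul_sub]; abel, norm_smul, Real.norm_of_nonneg hl0]
    nlinarith [norm_nonneg (y' - y)]
  have hUC : U ⊆ C := by
    refine hU.subset_of_closure_inter_subset hCopen ⟨x₀, hx₀, ?_⟩ ?_
    · rw [hC, mem_ofPred_eq, segment_same]
      simpa using hUH hx₀
    · rintro y ⟨hyC, hyU⟩
      obtain ⟨δ, hδ, hδH⟩ := Metric.isOpen_iff.1 hH y (hUH hyU)
      obtain ⟨y', hy'C, hy'⟩ := Metric.mem_closure_iff.1 hyC δ hδ
      intro p hp
      rw [segment_eq_image'] at hp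
      obtain ⟨l, ⟨hl0, hl1⟩, rfl⟩ := hp
      have h1 : segment ℝ y' x₀ ⊆ H := by rw [segment_symm]; exact hy'C
      have h2 : segment ℝ y' y ⊆ H := ((convex_ball y δ).segment_subset
        (by rwa [mem_ball, dist_comm]) (mem_ball_self hδ)).trans hδH
      have := htri y' x₀ y h1 h2 (1 - l) l (by linarith) hl0 (by linarith)
      convert this using 1
      simp only [smul_sub, sub_smul, one_smul]; abel
  exact (convexHull_min hUC hCconv).trans hCH

theorem exists_bounded_domain_two_segments {α β κ : ℝ} (hα : 0 < α) (hβ : 0 < β)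
    (hαβ : α + β ≤ 1) (hκ : 0 < κ) (hκ1 : κ ≤ 1) :
    ∃ (V : Set ℂ) (P Q : ℂ → ℂ) (T : ℝ), Bornology.IsBounded V ∧ 0 ∈ V ∧
      Differentiable ℂ P ∧ Differentiable ℂ Q ∧ P 0 = 0 ∧ Q 0 = 0 ∧
      ∀ ζ ∈ frontier V, |(P ζ).im| ≤ T ∧ |(Q ζ).im| ≤ T ∧
        ((α + (P ζ).re = 0 ∧ 0 ≤ β + (Q ζ).re ∧ β + (Q ζ).re ≤ 1 + κ) ∨
          (β + (Q ζ).re = 0 ∧ 0 ≤ α + (P ζ).re ∧ α + (P ζ).re ≤ 1 + κ)) := by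
  set ε : ℝ := κ / 8 with hε
  have hε0 : 0 < ε := by positivity
  have hε1 : ε ≤ 1 / 8 := by rw [hε]; linarith
  set P : ℂ → ℂ := fun ζ => ζ + ε * ζ ^ 2 with hP
  set Q : ℂ → ℂ := fun ζ => -ζ + ε * ζ ^ 2 with hQ
  have hPd : Differentiable ℂ P := by rw [hP]; fun_prop
  have hQd : Differentiable ℂ Q := by rw [hQ]; fun_prop
  have hPre : ∀ ζ, (P ζ).re = ζ.re + ε * (ζ.re ^ 2 - ζ.im ^ 2) := fun ζ => by
    simp [hP, pow_two]
  have hQre : ∀ ζ, (Q ζ).re = -ζ.re + ε * (ζ.re ^ 2 - ζ.im ^ 2) := fun ζ => by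
    simp [hQ, pow_two]
  have hPim : ∀ ζ, (P ζ).im = ζ.im + ε * (2 * ζ.re * ζ.im) := fun ζ => by
    simp only [hP, pow_two, Complex.add_im, Complex.mul_im, Complex.mul_re, Complex.ofReal_re,
      Complex.ofReal_im]; ring
  have hQim : ∀ ζ, (Q ζ).im = -ζ.im + ε * (2 * ζ.re * ζ.im) := fun ζ => by
    simp only [hQ, pow_two, Complex.add_im, Complex.neg_im, Complex.mul_im, Complex.mul_re,
      Complex.ofReal_re, Complex.ofReal_im]; ring
  set V : Set ℂ := {ζ | |ζ.re| < 2} ∩ ({ζ | 0 < α + (P ζ).re} ∩ {ζ | 0 < β + (Q ζ).re}) with hV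
  set W : Set ℂ := {ζ | |ζ.re| ≤ 2} ∩ ({ζ | 0 ≤ α + (P ζ).re} ∩ {ζ | 0 ≤ β + (Q ζ).re}) with hW
  have hPc : Continuous fun ζ => (P ζ).re := Complex.continuous_re.comp hPd.continuous
  have hQc : Continuous fun ζ => (Q ζ).re := Complex.continuous_re.comp hQd.continuous
  have hrc : Continuous fun ζ : ℂ => |ζ.re| := Complex.continuous_re.abs
  have hVo : IsOpen V := (isOpen_lt hrc continuous_const).inter
    ((isOpen_lt continuous_const (continuous_const.add hPc)).inter
      (isOpen_lt continuous_const (continuous_const.add hQc)))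
  have hWc : IsClosed W := (isClosed_le hrc continuous_const).inter
    ((isClosed_le continuous_const (continuous_const.add hPc)).inter
      (isClosed_le continuous_const (continuous_const.add hQc)))
  have hVW : V ⊆ W := by
    rintro ζ ⟨h1, h2, h3⟩
    simp only [mem_ofPred_eq] at h1 h2 h3
    exact ⟨h1.le, h2.le, h3.le⟩
  set S : ℝ := 1 / ε + 4 with hS
  have hS0 : 0 < S := by positivity
  have him : ∀ ζ ∈ W, |ζ.im| ≤ S := by
    rintro ζ ⟨h1, h2, h3⟩
    simp only [mem_ofPred_eq, hPre, hQre] at h1 h2 h3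
    have h4 : ζ.re ^ 2 ≤ 4 := by rw [← sq_abs]; nlinarith [abs_nonneg ζ.re]
    have h5 : 0 ≤ 1 + 2 * ε * (ζ.re ^ 2 - ζ.im ^ 2) := by nlinarith
    have h6 : ζ.im ^ 2 ≤ S := by
      have : ε * ζ.im ^ 2 ≤ ε * S := by
        rw [hS, mul_add, mul_one_div_cancel hε0.ne']
        nlinarith
      exact le_of_mul_le_mul_left this hε0
    rw [← sq_abs] at h6
    have hS1 : 1 ≤ S := by
      have : 0 < 1 / ε := by positivity
      linarith
    nlinarith [abs_nonneg ζ.im]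
  refine ⟨V, P, Q, 2 * S, ?_, ?_, hPd, hQd, by simp [hP], by simp [hQ], ?_⟩
  · refine (Metric.isBounded_closedBall (x := (0 : ℂ)) (r := 2 + S)).subset fun ζ hζ => ?_
    rw [mem_closedBall_zero_iff]
    exact (Complex.norm_le_abs_re_add_abs_im ζ).trans
      (add_le_add (hVW hζ).1 (him ζ (hVW hζ)))
  · simp [hV, hP, hQ, hα, hβ]
  · intro ζ hζ
    have hζW : ζ ∈ W := closure_minimal hVW hWc hζ.1
    have hζV : ζ ∉ V := by
      have := hζ.2
      rwa [hVo.interior_eq] at this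
    have hi := him ζ hζW
    obtain ⟨h1, h2, h3⟩ := hζW
    simp only [mem_ofPred_eq, hPre, hQre] at h1 h2 h3
    have hr2 : ζ.re ^ 2 ≤ 4 := by rw [← sq_abs]; nlinarith [abs_nonneg ζ.re]
    have hcross : |ε * (2 * ζ.re * ζ.im)| ≤ S := by
      rw [abs_mul, abs_mul, abs_mul, abs_of_pos hε0, abs_two]
      have h7 : |ζ.re| * |ζ.im| ≤ 2 * S := mul_le_mul h1 hi (abs_nonneg _) (by norm_num)
      have h8 : 0 ≤ |ζ.re| * |ζ.im| := by positivity
      nlinarith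
    refine ⟨?_, ?_, ?_⟩
    · rw [hPim]
      exact (abs_add_le _ _).trans (by linarith)
    · rw [hQim]
      refine (abs_add_le _ _).trans ?_
      rw [abs_neg]
      linarith
    have hlt : |ζ.re| < 2 := by
      refine lt_of_le_of_ne h1 fun h => ?_
      have hs : 0 ≤ ζ.im ^ 2 := sq_nonneg _
      rcases (abs_eq (by norm_num)).1 h with h | h
      · rw [h] at h3; nlinarith
      · rw [h] at h2; nlinarith
    have hsum : α + (ζ.re + ε * (ζ.re ^ 2 - ζ.im ^ 2)) + (β + (-ζ.re + ε * (ζ.re ^ 2 - ζ.im ^ 2)))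
        ≤ 1 + κ := by
      have : κ = 8 * ε := by rw [hε]; ring
      nlinarith [sq_nonneg ζ.im]
    rw [hPre, hQre]
    rcases h2.eq_or_lt with h | h
    · exact Or.inl ⟨h.symm, h3, by linarith⟩
    rcases h3.eq_or_lt with h' | h'
    · exact Or.inr ⟨h'.symm, h2, by linarith⟩
    exact absurd ⟨hlt, by simpa only [mem_ofPred_eq, hPre] using h,
      by simpa only [mem_ofPred_eq, hQre] using h'⟩ hζV

/-- The real part of a complex vector. -/
def reVec {n : ℕ} (z : Fin n → ℂ) : Fin n → ℝ := fun i => (z i).re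

/-- The imaginary part of a complex vector. -/
def imVec {n : ℕ} (z : Fin n → ℂ) : Fin n → ℝ := fun i => (z i).im

theorem mem_tube_iff {n : ℕ} {U : Set (Fin n → ℝ)} {z : Fin n → ℂ} :
    z ∈ tube n U ↔ reVec z ∈ U := Iff.rfl

theorem continuous_reVec {n : ℕ} : Continuous (reVec (n := n)) :=
  continuous_pi fun i => Complex.continuous_re.comp (continuous_apply i)

theorem continuous_imVec {n : ℕ} : Continuous (imVec (n := n)) :=
  continuous_pi fun i => Complex.continuous_im.comp (continuous_apply i)

theorem isOpen_tube {n : ℕ} {U : Set (Fin n → ℝ)} (hU : IsOpen U) : IsOpen (tube n U) :=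
  hU.preimage continuous_reVec

theorem norm_le_norm_reVec_add_norm_imVec {n : ℕ} (z : Fin n → ℂ) :
    ‖z‖ ≤ ‖reVec z‖ + ‖imVec z‖ := by
  refine (pi_norm_le_iff_of_nonneg (by positivity)).2 fun i => ?_
  exact (Complex.norm_le_abs_re_add_abs_im (z i)).trans
    (add_le_add (norm_le_pi_norm (reVec z) i) (norm_le_pi_norm (imVec z) i))

theorem isCompact_reVec_imVec {n : ℕ} {K : Set (Fin n → ℝ)} (hK : IsCompact K) (r : ℝ) :
    IsCompact {z : Fin n → ℂ | reVec z ∈ K ∧ ‖imVec z‖ ≤ r} := by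
  refine Metric.isCompact_of_isClosed_isBounded ?_ ?_
  · exact (hK.isClosed.preimage continuous_reVec).inter
      (isClosed_le continuous_imVec.norm continuous_const)
  · obtain ⟨R, hR⟩ := hK.isBounded.exists_norm_le
    refine (Metric.isBounded_closedBall (x := (0 : Fin n → ℂ)) (r := R + r)).subset ?_
    rintro z ⟨h1, h2⟩
    rw [mem_closedBall_zero_iff]
    exact (norm_le_norm_reVec_add_norm_imVec z).trans (add_le_add (hR _ h1) h2)

/-- Every truncated tube over `N` is contained in the hull, with respect to entire functions, of a
compact subset of the tube over `U`. -/
def EntireHull {n : ℕ} (U N : Set (Fin n → ℝ)) : Prop :=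
  ∀ r : ℝ, ∃ K : Set (Fin n → ℂ), IsCompact K ∧ K ⊆ tube n U ∧
    ∀ F : (Fin n → ℂ) → ℂ, Differentiable ℂ F → ∀ M : ℝ, (∀ w ∈ K, ‖F w‖ ≤ M) →
      ∀ z, reVec z ∈ N → ‖imVec z‖ ≤ r → ‖F z‖ ≤ M

theorem EntireHull.mono {n : ℕ} {U N N' : Set (Fin n → ℝ)} (h : EntireHull U N) (hN : N' ⊆ N) :
    EntireHull U N' := fun r => by
  obtain ⟨K, hK, hKU, hF⟩ := h r
  exact ⟨K, hK, hKU, fun F hd M hM z hz => hF F hd M hM z (hN hz)⟩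

theorem EntireHull.union {n : ℕ} {U N N' : Set (Fin n → ℝ)} (h : EntireHull U N)
    (h' : EntireHull U N') : EntireHull U (N ∪ N') := fun r => by
  obtain ⟨K, hK, hKU, hF⟩ := h r
  obtain ⟨K', hK', hKU', hF'⟩ := h' r
  refine ⟨K ∪ K', hK.union hK', union_subset hKU hKU', fun F hd M hM z hz hr => ?_⟩
  rcases hz with hz | hz
  · exact hF F hd M (fun w hw => hM w (Or.inl hw)) z hz hr
  · exact hF' F hd M (fun w hw => hM w (Or.inr hw)) z hz hr

theorem EntireHull.of_isCompact {n : ℕ} {U K : Set (Fin n → ℝ)} (hK : IsCompact K) (hKU : K ⊆ U) :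
    EntireHull U K := fun r =>
  ⟨_, isCompact_reVec_imVec hK r, fun _ hz => hKU hz.1, fun _ _ _ hM z hz hr => hM z ⟨hz, hr⟩⟩

/-- The open set of points having a neighbourhood in the entire hull. -/
def entireHullSet {n : ℕ} (U : Set (Fin n → ℝ)) : Set (Fin n → ℝ) :=
  {x | ∃ N : Set (Fin n → ℝ), IsOpen N ∧ x ∈ N ∧ EntireHull U N}

theorem isOpen_entireHullSet {n : ℕ} (U : Set (Fin n → ℝ)) : IsOpen (entireHullSet U) := by
  rw [isOpen_iff_forall_mem_open]
  rintro x ⟨N, hN, hx, h⟩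
  exact ⟨N, fun y hy => ⟨N, hN, hy, h⟩, hN, hx⟩

theorem subset_entireHullSet {n : ℕ} {U : Set (Fin n → ℝ)} (hU : IsOpen U) :
    U ⊆ entireHullSet U := by
  intro x hx
  obtain ⟨δ, hδ, hδU⟩ := Metric.nhds_basis_closedBall.mem_iff.1 (hU.mem_nhds hx)
  exact ⟨ball x δ, isOpen_ball, mem_ball_self hδ,
    (EntireHull.of_isCompact (isCompact_closedBall x δ) hδU).mono ball_subset_closedBall⟩

theorem exists_open_entireHull_of_isCompact {n : ℕ} {U L : Set (Fin n → ℝ)} (hL : IsCompact L)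
    (hLU : L ⊆ entireHullSet U) :
    ∃ N : Set (Fin n → ℝ), IsOpen N ∧ L ⊆ N ∧ EntireHull U N := by
  refine hL.induction_on (p := fun s => ∃ N : Set (Fin n → ℝ), IsOpen N ∧ s ⊆ N ∧ EntireHull U N)
    ?_ ?_ ?_ ?_
  · exact ⟨∅, isOpen_empty, subset_rfl,
      (EntireHull.of_isCompact isCompact_empty (empty_subset _))⟩
  · rintro s t hst ⟨N, h1, h2, h3⟩
    exact ⟨N, h1, hst.trans h2, h3⟩
  · rintro s t ⟨N, h1, h2, h3⟩ ⟨N', h1', h2', h3'⟩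
    exact ⟨N ∪ N', h1.union h1', union_subset_union h2 h2', h3.union h3'⟩
  · intro x hx
    obtain ⟨N, h1, h2, h3⟩ := hLU hx
    exact ⟨N, mem_nhdsWithin_of_mem_nhds (h1.mem_nhds h2), N, h1, subset_rfl, h3⟩

theorem dist_add_smul_segment_lt {E : Type*} [NormedAddCommGroup E] [NormedSpace ℝ E] {a b w : E}
    {s κ δ : ℝ} (hs0 : 0 ≤ s) (hs1 : s ≤ 1 + κ) (hκ : 0 ≤ κ) (h : κ * ‖b - a‖ + ‖w‖ < δ) :
    a + s • (b - a) + w ∈ thickening δ (segment ℝ a b) := by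
  rw [mem_thickening_iff]
  refine ⟨a + min s 1 • (b - a), ?_, ?_⟩
  · rw [segment_eq_image']
    exact ⟨min s 1, ⟨le_min hs0 zero_le_one, min_le_right _ _⟩, rfl⟩
  · rw [dist_eq_norm, show a + s • (b - a) + w - (a + min s 1 • (b - a)) =
      (s - min s 1) • (b - a) + w by rw [sub_smul]; abel]
    refine ((norm_add_le _ _).trans ?_).trans_lt h
    gcongr
    rw [norm_smul]
    gcongr
    rw [Real.norm_eq_abs, abs_le]
    rcases le_total s 1 with h1 | h1
    · rw [min_eq_left h1]; constructor <;> linarith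
    · rw [min_eq_right h1]; constructor <;> linarith

theorem entireHullSet_triangle {n : ℕ} {U : Set (Fin n → ℝ)} (a b c : Fin n → ℝ)
    (hab : segment ℝ a b ⊆ entireHullSet U) (hac : segment ℝ a c ⊆ entireHullSet U) (α β : ℝ)
    (hα : 0 ≤ α) (hβ : 0 ≤ β) (hαβ : α + β ≤ 1) :
    a + α • (b - a) + β • (c - a) ∈ entireHullSet U := by
  rcases hα.eq_or_lt with rfl | hα
  · refine hac ?_
    rw [segment_eq_image']
    exact ⟨β, ⟨hβ, by linarith⟩, by simp⟩
  rcases hβ.eq_or_lt with rfl | hβ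
  · refine hab ?_
    rw [segment_eq_image']
    exact ⟨α, ⟨hα.le, by linarith⟩, by simp⟩
  have hcompact : ∀ x y : Fin n → ℝ, IsCompact (segment ℝ x y) := fun x y => by
    rw [segment_eq_image']
    exact isCompact_Icc.image (by fun_prop)
  have hL := (hcompact a b).union (hcompact a c)
  obtain ⟨N, hNo, hLN, hN⟩ := exists_open_entireHull_of_isCompact hL (union_subset hab hac)
  obtain ⟨δ, hδ, hδN⟩ := hL.exists_thickening_subset_open hNo hLN
  set B := ‖b - a‖
  set C := ‖c - a‖
  have hB : 0 ≤ B := norm_nonneg _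
  have hC : 0 ≤ C := norm_nonneg _
  obtain ⟨κ, hκ, hκ1, hκδ⟩ : ∃ κ : ℝ, 0 < κ ∧ κ ≤ 1 ∧ κ * (B + C) ≤ δ / 2 := by
    refine ⟨min 1 (δ / 2 / (B + C + 1)), by positivity, min_le_left _ _, ?_⟩
    calc min 1 (δ / 2 / (B + C + 1)) * (B + C) ≤ δ / 2 / (B + C + 1) * (B + C + 1) :=
          mul_le_mul (min_le_right _ _) (by linarith) (by positivity) (by positivity)
      _ = δ / 2 := div_mul_cancel₀ _ (by positivity)
  obtain ⟨V, P, Q, T, hVb, h0V, hPd, hQd, hP0, hQ0, hfr⟩ :=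
    exists_bounded_domain_two_segments hα hβ hαβ hκ hκ1
  refine ⟨ball (a + α • (b - a) + β • (c - a)) (δ / 2), isOpen_ball,
    mem_ball_self (by positivity), fun r => ?_⟩
  obtain ⟨K, hK, hKU, hF⟩ := hN (r + T * B + T * C)
  refine ⟨K, hK, hKU, fun F hFd M hM z hz hzr => ?_⟩
  set φ : ℂ → Fin n → ℂ := fun ζ i => z i + P ζ * ((b i - a i : ℝ) : ℂ) + Q ζ * ((c i - a i : ℝ) : ℂ)
    with hφ
  have hφd : Differentiable ℂ φ := by
    rw [differentiable_pi]
    intro i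
    exact ((differentiable_const _).add (hPd.mul_const _)).add (hQd.mul_const _)
  have hφ0 : φ 0 = z := by
    ext i; simp [hφ, hP0, hQ0]
  have hre : ∀ ζ, reVec (φ ζ) = reVec z + (P ζ).re • (b - a) + (Q ζ).re • (c - a) := by
    intro ζ; ext i; simp [hφ, reVec]
  have him : ∀ ζ, imVec (φ ζ) = imVec z + (P ζ).im • (b - a) + (Q ζ).im • (c - a) := by
    intro ζ; ext i; simp [hφ, imVec]
  have key := Complex.norm_le_of_forall_mem_frontier_norm_le (f := F ∘ φ) hVb
    (hFd.comp hφd).diffContOnCl (C := M) (fun ζ hζ => ?_) (subset_closure h0V)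
  · simpa only [Function.comp, hφ0] using key
  obtain ⟨hPT, hQT, hor⟩ := hfr ζ hζ
  refine hF F hFd M hM _ (hδN ?_) ?_
  · set w := reVec z - (a + α • (b - a) + β • (c - a)) with hw
    have hwδ : ‖w‖ < δ / 2 := by rwa [hw, ← dist_eq_norm]
    have hre' : reVec (φ ζ) = a + (α + (P ζ).re) • (b - a) + (β + (Q ζ).re) • (c - a) + w := by
      rw [hre, hw]; simp only [add_smul]; abel
    rw [thickening_union, hre']
    rcases hor with ⟨h1, h2, h3⟩ | ⟨h1, h2, h3⟩
    · right
      rw [h1, zero_smul, add_zero]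
      exact dist_add_smul_segment_lt h2 h3 hκ.le (by nlinarith)
    · left
      rw [h1, zero_smul, add_zero]
      exact dist_add_smul_segment_lt h2 h3 hκ.le (by nlinarith)
  · rw [him]
    refine (norm_add₃_le).trans ?_
    rw [norm_smul, norm_smul, Real.norm_eq_abs, Real.norm_eq_abs]
    gcongr

theorem convexHull_subset_entireHullSet {n : ℕ} {U : Set (Fin n → ℝ)} (hU : IsOpen U)
    (hc : IsPreconnected U) : convexHull ℝ U ⊆ entireHullSet U :=
  convexHull_subset_of_triangle (isOpen_entireHullSet U) hc (subset_entireHullSet hU)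
    entireHullSet_triangle

/-- If a sequence of entire functions converges locally uniformly on the tube over `U`, then the
limit extends holomorphically to the tube over the convex hull. -/
theorem exists_extension_of_entire_approx {n : ℕ} {U : Set (Fin n → ℝ)} (hU : IsOpen U)
    (hc : IsPreconnected U) {f : (Fin n → ℂ) → ℂ}
    (happrox : ∀ K : Set (Fin n → ℂ), IsCompact K → K ⊆ tube n U → ∀ ε > 0,
      ∃ F : (Fin n → ℂ) → ℂ, Differentiable ℂ F ∧ ∀ z ∈ K, ‖F z - f z‖ ≤ ε) :
    ∃ g : (Fin n → ℂ) → ℂ, DifferentiableOn ℂ g (tube n (convexHull ℝ U)) ∧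
      EqOn g f (tube n U) := by
  have hTo := isOpen_tube hU
  have : LocallyCompactSpace (tube n U) := hTo.locallyCompactSpace
  let E : CompactExhaustion (tube n U) := CompactExhaustion.choice _
  have hE : ∀ k, ∃ F : (Fin n → ℂ) → ℂ, Differentiable ℂ F ∧
      ∀ z ∈ (Subtype.val '' (E k)), ‖F z - f z‖ ≤ 1 / ((k : ℝ) + 1) := fun k =>
    happrox _ ((E.isCompact k).image continuous_subtype_val) (by rintro _ ⟨z, _, rfl⟩; exact z.2) _
      (by positivity)
  choose F hFd hF using hE
  have hconv : ∀ K : Set (Fin n → ℂ), IsCompact K → K ⊆ tube n U → ∀ ε > 0, ∃ N, ∀ k ≥ N,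
      ∀ z ∈ K, ‖F k z - f z‖ ≤ ε := by
    intro K hK hKU ε hε
    obtain ⟨m, hm⟩ := E.exists_superset_of_isCompact
      (Topology.IsInducing.subtypeVal.isCompact_preimage' hK (by simpa using hKU))
    obtain ⟨N, hN⟩ := exists_nat_one_div_lt hε
    refine ⟨max m N, fun k hk z hz => ?_⟩
    refine (hF k z ⟨⟨z, hKU hz⟩, E.subset ((le_max_left m N).trans hk) (hm hz), rfl⟩).trans
      (le_trans ?_ hN.le)
    have : (N : ℝ) ≤ k := by exact_mod_cast (le_max_right m N).trans hk
    gcongr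
  have hcauchy : ∀ z₀ ∈ tube n (convexHull ℝ U), ∃ ρ > 0, ∀ ε > 0, ∃ N, ∀ k ≥ N, ∀ l ≥ N,
      ∀ z ∈ ball z₀ ρ, ‖F k z - F l z‖ ≤ ε := by
    intro z₀ hz₀
    obtain ⟨N, hNo, hzN, hN⟩ := convexHull_subset_entireHullSet hU hc hz₀
    obtain ⟨K, hK, hKU, hb⟩ := hN (‖imVec z₀‖ + 1)
    have hO : {z : Fin n → ℂ | reVec z ∈ N ∧ ‖imVec z‖ < ‖imVec z₀‖ + 1} ∈ 𝓝 z₀ :=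
      ((hNo.preimage continuous_reVec).inter
        (isOpen_lt continuous_imVec.norm continuous_const)).mem_nhds ⟨hzN, by simp⟩
    obtain ⟨ρ, hρ, hρO⟩ := Metric.mem_nhds_iff.1 hO
    refine ⟨ρ, hρ, fun ε hε => ?_⟩
    obtain ⟨m, hm⟩ := hconv K hK hKU (ε / 2) (by positivity)
    refine ⟨m, fun k hk l hl z hz => ?_⟩
    refine hb (fun z => F k z - F l z) ((hFd k).sub (hFd l)) ε (fun w hw => ?_) z (hρO hz).1
      (hρO hz).2.le
    have h1 := hm k hk w hw
    have h2 := hm l hl w hw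
    rw [show F k w - F l w = (F k w - f w) - (F l w - f w) by ring]
    exact (norm_sub_le _ _).trans (by linarith)
  have hlim : ∀ z ∈ tube n (convexHull ℝ U), ∃ L, Tendsto (fun k => F k z) atTop (𝓝 L) := by
    intro z hz
    obtain ⟨ρ, hρ, h⟩ := hcauchy z hz
    refine cauchySeq_tendsto_of_complete (Metric.cauchySeq_iff.2 fun ε hε => ?_)
    obtain ⟨N, hN⟩ := h (ε / 2) (by positivity)
    refine ⟨N, fun k hk l hl => ?_⟩
    rw [dist_eq_norm]
    exact (hN k hk l hl z (mem_ball_self hρ)).trans_lt (by linarith)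
  choose! g hg using hlim
  refine ⟨g, fun z hz => ?_, fun z hz => ?_⟩
  · obtain ⟨ρ, hρ, h⟩ := hcauchy z hz
    have hopen : tube n (convexHull ℝ U) ∈ 𝓝 z :=
      (isOpen_tube (hU.convexHull)).mem_nhds hz
    obtain ⟨ρ', hρ', hb⟩ := Metric.mem_nhds_iff.1 hopen
    refine (differentiableAt_of_tendsto_of_cauchy_on_ball hFd (lt_min hρ hρ') ?_ ?_
      ).differentiableWithinAt
    · intro ε hε
      obtain ⟨N, hN⟩ := h ε hε
      exact ⟨N, fun k hk l hl w hw => hN k hk l hl w (ball_subset_ball (min_le_left _ _) hw)⟩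
    · exact fun w hw => hg w (hb (ball_subset_ball (min_le_right _ _) hw))
  · refine tendsto_nhds_unique (hg z (subset_convexHull ℝ U hz)) ?_
    rw [Metric.tendsto_atTop]
    intro ε hε
    obtain ⟨N, hN⟩ := hconv {z} isCompact_singleton (by simpa using hz) (ε / 2) (by positivity)
    refine ⟨N, fun k hk => ?_⟩
    rw [dist_eq_norm]
    exact (hN k hk z rfl).trans_lt (by linarith)

theorem exists_isCompact_isPreconnected_superset {E : Type*} [NormedAddCommGroup E]
    [NormedSpace ℝ E] [ProperSpace E] {U K : Set E} (hU : IsOpen U) (hc : IsPreconnected U)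
    (hK : IsCompact K) (hKU : K ⊆ U) {x₀ : E} (hx₀ : x₀ ∈ U) :
    ∃ K' : Set E, IsCompact K' ∧ IsPreconnected K' ∧ K ⊆ K' ∧ K' ⊆ U ∧ x₀ ∈ K' := by
  have hpc : IsPathConnected U := (hU.isConnected_iff_isPathConnected).1 ⟨⟨x₀, hx₀⟩, hc⟩
  refine hK.induction_on (p := fun s => ∃ K' : Set E, IsCompact K' ∧ IsPreconnected K' ∧ s ⊆ K' ∧
    K' ⊆ U ∧ x₀ ∈ K') ?_ ?_ ?_ ?_
  · exact ⟨{x₀}, isCompact_singleton, isPreconnected_singleton, empty_subset _, by simpa, rfl⟩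
  · rintro s t hst ⟨K', h1, h2, h3, h4⟩
    exact ⟨K', h1, h2, hst.trans h3, h4⟩
  · rintro s t ⟨K', h1, h2, h3, h4, h5⟩ ⟨L, h1', h2', h3', h4', h5'⟩
    exact ⟨K' ∪ L, h1.union h1', h2.union x₀ h5 h5' h2', union_subset_union h3 h3',
      union_subset h4 h4', Or.inl h5⟩
  · intro x hx
    obtain ⟨δ, hδ, hδU⟩ := Metric.nhds_basis_closedBall.mem_iff.1 (hU.mem_nhds (hKU hx))
    obtain ⟨γ, hγ⟩ := hpc.joinedIn x₀ hx₀ x (hKU hx)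
    refine ⟨closedBall x δ, mem_nhdsWithin_of_mem_nhds (closedBall_mem_nhds x hδ),
      closedBall x δ ∪ range γ, (isCompact_closedBall x δ).union (isCompact_range γ.continuous),
      (convex_closedBall x δ).isPreconnected.union x (mem_closedBall_self hδ.le) ⟨1, γ.target⟩
        (isPreconnected_range γ.continuous), subset_union_left, union_subset hδU ?_,
      Or.inr ⟨0, γ.source⟩⟩
    rintro _ ⟨t, rfl⟩
    exact hγ t

/-- If the oscillation of `J N` over `δ`-close points of a connected compact set tends to zero
uniformly in `z`, then so does its oscillation over the whole compact set. -/
theorem eventually_norm_sub_le_of_chain {E Z : Type*} [PseudoMetricSpace E] {K : Set E}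
    (hK : IsCompact K) (hc : IsPreconnected K) {x₀ : E} (hx₀ : x₀ ∈ K) {S : Set Z}
    {J : ℝ → E → Z → ℂ} {b : ℝ → ℝ} (hb : Tendsto b atTop (𝓝 0)) {δ : ℝ} (hδ : 0 < δ)
    (hJ : ∀ᶠ N in atTop, ∀ p ∈ K, ∀ q ∈ K, dist q p < δ → ∀ z ∈ S, ‖J N q z - J N p z‖ ≤ b N)
    {η : ℝ} (hη : 0 < η) :
    ∀ᶠ N in atTop, ∀ p ∈ K, ∀ z ∈ S, ‖J N p z - J N x₀ z‖ ≤ η := by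
  set P : E → Prop := fun p => ∀ η > 0, ∀ᶠ N in atTop, ∀ z ∈ S, ‖J N p z - J N x₀ z‖ ≤ η with hP
  have hbη : ∀ η > 0, ∀ᶠ N in atTop, b N ≤ η := fun η hη =>
    (hb.eventually (gt_mem_nhds hη)).mono fun N h => le_of_lt h
  have step : ∀ p ∈ K, ∀ q ∈ K, dist q p < δ → P p → P q := by
    intro p hp q hq hpq hPp η hη
    filter_upwards [hPp (η / 2) (by positivity), hbη (η / 2) (by positivity), hJ] with N h1 h2 h3 z hz
    have h4 := h1 z hz
    have h5 := h3 p hp q hq hpq z hz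
    rw [show J N q z - J N x₀ z = (J N q z - J N p z) + (J N p z - J N x₀ z) by ring]
    exact (norm_add_le _ _).trans (by linarith)
  have hPx₀ : P x₀ := fun η hη => Eventually.of_forall fun N z _ => by simpa using hη.le
  have hall : ∀ q ∈ K, P q := by
    have hsub : K ⊆ ⋃ p ∈ {p | p ∈ K ∧ P p}, ball p (δ / 2) := by
      refine hc.subset_of_closure_inter_subset (isOpen_biUnion fun _ _ => isOpen_ball) ?_ ?_
      · exact ⟨x₀, hx₀, mem_biUnion (show x₀ ∈ {p | p ∈ K ∧ P p} from ⟨hx₀, hPx₀⟩)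
          (mem_ball_self (by positivity))⟩
      · rintro x ⟨hx, hxK⟩
        obtain ⟨y, hy, hxy⟩ := Metric.mem_closure_iff.1 hx (δ / 2) (by positivity)
        obtain ⟨p, ⟨hp, hPp⟩, hyp⟩ := mem_iUnion₂.1 hy
        have hxp : dist x p < δ := by
          have := dist_triangle x y p
          rw [mem_ball] at hyp
          linarith
        exact mem_biUnion (show x ∈ {p | p ∈ K ∧ P p} from ⟨hxK, step p hp x hxK hxp hPp⟩)
          (mem_ball_self (by positivity))
    intro q hq
    obtain ⟨p, ⟨hp, hPp⟩, hqp⟩ := mem_iUnion₂.1 (hsub hq)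
    exact step p hp q hq (by rw [mem_ball] at hqp; linarith) hPp
  obtain ⟨t, htK, htf, htc⟩ := hK.finite_cover_balls hδ
  have hfin : ∀ᶠ N in atTop, ∀ p ∈ t, ∀ z ∈ S, ‖J N p z - J N x₀ z‖ ≤ η / 2 :=
    (htf.eventually_all).2 fun p hp => hall p (htK hp) (η / 2) (by positivity)
  filter_upwards [hfin, hbη (η / 2) (by positivity), hJ] with N h1 h2 h3 q hq z hz
  obtain ⟨p, hp, hqp⟩ := mem_iUnion₂.1 (htc hq)
  have h4 := h1 p hp z hz
  have h5 := h3 p (htK hp) q hq hqp z hz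
  rw [show J N q z - J N x₀ z = (J N q z - J N p z) + (J N p z - J N x₀ z) by ring]
  exact (norm_add_le _ _).trans (by linarith)

theorem hasFDerivAt_integral_of_eq_zero_off_compact {𝕜 H α : Type*} [RCLike 𝕜]
    [NormedAddCommGroup H] [NormedSpace 𝕜 H] [ProperSpace H] [TopologicalSpace α]
    [T2Space α] [MeasurableSpace α] [BorelSpace α] [SecondCountableTopology α]
    {μ : Measure α} [IsFiniteMeasureOnCompacts μ] [NormedSpace 𝕜 ℂ] {G : H → α → ℂ}
    {G' : H → α → H →L[𝕜] ℂ} {O : Set H} (hO : IsOpen O) {K : Set α} (hK : IsCompact K)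
    (hG : ∀ x ∈ O, Continuous (G x)) (hG0 : ∀ x ∈ O, ∀ t ∉ K, G x t = 0)
    (hG' : ContinuousOn (fun q : H × α => G' q.1 q.2) (O ×ˢ univ))
    (hG'0 : ∀ x ∈ O, ∀ t ∉ K, G' x t = 0)
    (hd : ∀ x ∈ O, ∀ t, HasFDerivAt (fun x => G x t) (G' x t) x) {x₀ : H} (hx₀ : x₀ ∈ O) :
    HasFDerivAt (fun x => ∫ t, G x t ∂μ) (∫ t, G' x₀ t ∂μ) x₀ := by
  obtain ⟨ρ, hρ, hρO⟩ := Metric.nhds_basis_closedBall.mem_iff.1 (hO.mem_nhds hx₀)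
  obtain ⟨M, hM⟩ := ((isCompact_closedBall x₀ ρ).prod hK).exists_bound_of_continuousOn
    (hG'.mono (prod_mono hρO (subset_univ _)))
  have hcs : HasCompactSupport (G x₀) := HasCompactSupport.intro hK (hG0 x₀ hx₀)
  have hG'c : Continuous (G' x₀) := by
    rw [← continuousOn_univ]
    exact hG'.comp (f := fun t => (x₀, t)) (by fun_prop) (fun t _ => ⟨hx₀, mem_univ t⟩)
  refine hasFDerivAt_integral_of_dominated_of_fderiv_le (bound := K.indicator fun _ => M)
    (closedBall_mem_nhds x₀ hρ) ?_ ((hG x₀ hx₀).integrable_of_hasCompactSupport hcs) ?_ ?_ ?_ ?_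
  · filter_upwards [hO.mem_nhds hx₀] with x hx
    refine ((hG x hx).stronglyMeasurable_of_hasCompactSupport
      (HasCompactSupport.intro hK (hG0 x hx))).aestronglyMeasurable
  · exact (hG'c.stronglyMeasurable_of_hasCompactSupport
      (HasCompactSupport.intro hK (hG'0 x₀ hx₀))).aestronglyMeasurable
  · refine Eventually.of_forall fun t x hx => ?_
    by_cases ht : t ∈ K
    · rw [indicator_of_mem ht]
      exact hM (x, t) ⟨hx, ht⟩
    · rw [indicator_of_notMem ht, hG'0 x (hρO hx) t ht, norm_zero]
  · rw [integrable_indicator_iff hK.measurableSet]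
    exact integrableOn_const hK.measure_lt_top.ne
  · exact Eventually.of_forall fun t x hx => hd x (hρO hx) t

/-- The inclusion of real vectors in complex vectors. -/
noncomputable def ofRealVec (n : ℕ) : (Fin n → ℝ) →L[ℝ] (Fin n → ℂ) :=
  ContinuousLinearMap.pi fun i => Complex.ofRealCLM.comp (ContinuousLinearMap.proj i)

/-- The complex vector with real part `x` and imaginary part `y`. -/
noncomputable def ofReIm {n : ℕ} (x y : Fin n → ℝ) : Fin n → ℂ :=
  ofRealVec n x + Complex.I • ofRealVec n y

theorem ofReIm_apply {n : ℕ} (x y : Fin n → ℝ) (i : Fin n) :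
    ofReIm x y i = (x i : ℂ) + Complex.I * (y i : ℂ) := rfl

@[simp]
theorem reVec_ofReIm {n : ℕ} (x y : Fin n → ℝ) : reVec (ofReIm x y) = x := by
  ext i
  simp [reVec, ofReIm_apply]

@[simp]
theorem imVec_ofReIm {n : ℕ} (x y : Fin n → ℝ) : imVec (ofReIm x y) = y := by
  ext i
  simp [imVec, ofReIm_apply]

theorem ofReIm_reVec_imVec {n : ℕ} (z : Fin n → ℂ) : ofReIm (reVec z) (imVec z) = z := by
  ext i
  simp [reVec, imVec, ofReIm_apply, mul_comm Complex.I, Complex.re_add_im]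

theorem ofReIm_mem_tube {n : ℕ} {U : Set (Fin n → ℝ)} {x y : Fin n → ℝ} (hx : x ∈ U) :
    ofReIm x y ∈ tube n U := by
  rwa [mem_tube_iff, reVec_ofReIm]

theorem continuous_ofReIm {n : ℕ} :
    Continuous (fun q : (Fin n → ℝ) × (Fin n → ℝ) => ofReIm q.1 q.2) := by
  unfold ofReIm
  fun_prop

theorem continuous_comp_ofReIm {n : ℕ} {U : Set (Fin n → ℝ)} {h : (Fin n → ℂ) → ℂ}
    (hh : ContinuousOn h (tube n U)) {x : Fin n → ℝ} (hx : x ∈ U) :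
    Continuous (fun t => h (ofReIm x t)) :=
  hh.comp_continuous (continuous_ofReIm.comp (by fun_prop : Continuous fun t => (x, t)))
    fun _ => ofReIm_mem_tube hx

theorem integral_fderiv_ofReIm_mul {n : ℕ} {U : Set (Fin n → ℝ)} (hU : IsOpen U)
    {h : (Fin n → ℂ) → ℂ} (hh : DifferentiableOn ℂ h (tube n U)) {X : (Fin n → ℝ) → ℂ}
    (hX : ContDiff ℝ 1 X) (hXc : HasCompactSupport X) {x : Fin n → ℝ} (hx : x ∈ U)
    (v : Fin n → ℝ) :
    ∫ t, fderiv ℂ h (ofReIm x t) (ofRealVec n v) * X t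
      = Complex.I * ∫ t, h (ofReIm x t) * fderiv ℝ X t v := by
  have hcX' : Continuous (fun t => fderiv ℝ X t v) :=
    (hX.continuous_fderiv one_ne_zero).clm_apply continuous_const
  have hcX's : HasCompactSupport (fun t => fderiv ℝ X t v) := hXc.fderiv_apply (𝕜 := ℝ) v
  have hch : Continuous (fun t => h (ofReIm x t)) := continuous_comp_ofReIm hh.continuousOn hx
  have hch' : Continuous (fun t => fderiv ℂ h (ofReIm x t)) :=
    (DifferentiableOn.continuousOn_fderiv_complex (isOpen_tube hU) hh).comp_continuous
      (continuous_ofReIm.comp (by fun_prop : Continuous fun t => (x, t)))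
      fun _ => ofReIm_mem_tube hx
  have hder : ∀ t, HasFDerivAt (fun t => h (ofReIm x t))
      (((fderiv ℂ h (ofReIm x t)).restrictScalars ℝ).comp (Complex.I • ofRealVec n)) t := by
    intro t
    have h1 : HasFDerivAt (fun t => ofReIm x t) (Complex.I • ofRealVec n) t :=
      ((ofRealVec n).hasFDerivAt.const_smul Complex.I).const_add _
    exact ((hh.differentiableAt ((isOpen_tube hU).mem_nhds
      (ofReIm_mem_tube hx))).hasFDerivAt.restrictScalars ℝ).comp t h1
  have hfd : ∀ t, fderiv ℝ (fun t => h (ofReIm x t)) t v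
      = Complex.I * fderiv ℂ h (ofReIm x t) (ofRealVec n v) := by
    intro t
    rw [(hder t).fderiv]
    simp
  have hparts := integral_mul_fderiv_eq_neg_fderiv_mul_of_integrable (μ := volume)
    (f := fun t => h (ofReIm x t)) (g := X) (v := v) ?_ ?_ ?_ ?_ ?_
  · rw [hparts]
    simp_rw [hfd, mul_assoc]
    rw [integral_const_mul, mul_neg, ← mul_assoc, Complex.I_mul_I]
    ring
  · simp_rw [hfd]
    exact ((continuous_const.mul (hch'.clm_apply continuous_const)).mul
      hX.continuous).integrable_of_hasCompactSupport hXc.mul_left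
  · exact (hch.mul hcX').integrable_of_hasCompactSupport hcX's.mul_left
  · exact (hch.mul hX.continuous).integrable_of_hasCompactSupport hXc.mul_left
  · exact fun t _ => (hder t).differentiableAt
  · exact fun t _ => (hX.differentiable one_ne_zero).differentiableAt

theorem norm_integral_ofReIm_sub_le_of_segment {n : ℕ} {U : Set (Fin n → ℝ)} (hU : IsOpen U)
    {h : (Fin n → ℂ) → ℂ} (hh : DifferentiableOn ℂ h (tube n U)) {X : (Fin n → ℝ) → ℂ}
    (hX : ContDiff ℝ 1 X) (hXc : HasCompactSupport X) {p v : Fin n → ℝ}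
    (hseg : ∀ s ∈ Icc (0 : ℝ) 1, p + s • v ∈ U) {B : ℝ}
    (hB : ∀ s ∈ Icc (0 : ℝ) 1, ‖∫ t, h (ofReIm (p + s • v) t) * fderiv ℝ X t v‖ ≤ B) :
    ‖(∫ t, h (ofReIm (p + v) t) * X t) - ∫ t, h (ofReIm p t) * X t‖ ≤ B := by
  set O : Set ℝ := {s | p + s • v ∈ U} with hO
  have hOo : IsOpen O := hU.preimage (by fun_prop : Continuous fun s : ℝ => p + s • v)
  have hcf := DifferentiableOn.continuousOn_fderiv_complex (isOpen_tube hU) hh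
  have hderiv : ∀ s ∈ O, HasDerivAt (fun s : ℝ => ∫ t, h (ofReIm (p + s • v) t) * X t)
      (∫ t, fderiv ℂ h (ofReIm (p + s • v) t) (ofRealVec n v) * X t) s := by
    intro s hs
    have key := hasFDerivAt_integral_of_eq_zero_off_compact (𝕜 := ℝ) (μ := volume)
      (G := fun (s : ℝ) t => h (ofReIm (p + s • v) t) * X t)
      (G' := fun (s : ℝ) t => ContinuousLinearMap.toSpanSingleton ℝ
        (fderiv ℂ h (ofReIm (p + s • v) t) (ofRealVec n v) * X t)) hOo hXc.isCompact
      ?_ ?_ ?_ ?_ ?_ hs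
    · have := key.hasDerivAt
      convert this using 1
      rw [ContinuousLinearMap.integral_apply]
      · simp
      · have hc : Continuous fun t => fderiv ℂ h (ofReIm (p + s • v) t) (ofRealVec n v) * X t :=
          ((hcf.comp_continuous (continuous_ofReIm.comp
            (by fun_prop : Continuous fun t => (p + s • v, t)))
            fun _ => ofReIm_mem_tube hs).clm_apply continuous_const).mul hX.continuous
        refine Continuous.integrable_of_hasCompactSupport
          ((ContinuousLinearMap.toSpanSingletonCLE (𝕜 := ℝ) (E := ℂ)).continuous.comp hc)
          (HasCompactSupport.intro hXc.isCompact fun t ht => ?_)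
        simp [image_eq_zero_of_notMem_tsupport ht]
    · exact fun s hs => (continuous_comp_ofReIm hh.continuousOn hs).mul hX.continuous
    · intro s hs t ht
      simp [image_eq_zero_of_notMem_tsupport ht]
    · refine (ContinuousLinearMap.toSpanSingletonCLE (𝕜 := ℝ) (E := ℂ)).continuous.comp_continuousOn
        (f := fun q : ℝ × (Fin n → ℝ) =>
          fderiv ℂ h (ofReIm (p + q.1 • v) q.2) (ofRealVec n v) * X q.2) ?_
      refine ContinuousOn.mul (ContinuousOn.clm_apply (hcf.comp (Continuous.continuousOn ?_)
        fun q hq => ofReIm_mem_tube hq.1) continuousOn_const)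
        (hX.continuous.comp continuous_snd).continuousOn
      exact continuous_ofReIm.comp
        (by fun_prop : Continuous fun q : ℝ × (Fin n → ℝ) => (p + q.1 • v, q.2))
    · intro s hs t ht
      simp [image_eq_zero_of_notMem_tsupport ht]
    · intro s hs t
      refine HasDerivAt.hasFDerivAt ?_
      refine HasDerivAt.mul_const ?_ _
      have h1 : HasDerivAt (fun s : ℝ => ofReIm (p + s • v) t) (ofRealVec n v) s := by
        have h2 : HasDerivAt (fun s : ℝ => p + s • v) v s := by
          simpa using ((hasDerivAt_id s).smul_const v).const_add p
        exact ((ofRealVec n).hasFDerivAt.comp_hasDerivAt s h2).add_const _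
      exact ((hh.differentiableAt ((isOpen_tube hU).mem_nhds
        (ofReIm_mem_tube hs))).hasFDerivAt.restrictScalars ℝ).comp_hasDerivAt s h1
  have hmv := norm_image_sub_le_of_norm_deriv_le_segment_01'
    (f := fun s : ℝ => ∫ t, h (ofReIm (p + s • v) t) * X t) (C := B)
    (fun s hs => (hderiv s (hseg s hs)).hasDerivWithinAt) fun s hs => ?_
  · simpa using hmv
  · rw [integral_fderiv_ofReIm_mul hU hh hX hXc (hseg s (Ico_subset_Icc_self hs)), norm_mul,
      Complex.norm_I, one_mul]
    exact hB s (Ico_subset_Icc_self hs)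

/-- The Gaussian kernel `exp (N² ∑ (zᵢ - wᵢ)²)` on `ℂⁿ`. -/
noncomputable def gaussKernel {n : ℕ} (N : ℝ) (z w : Fin n → ℂ) : ℂ :=
  Complex.exp ((N : ℂ) ^ 2 * ∑ i, (z i - w i) ^ 2)

theorem norm_gaussKernel_ofReIm {n : ℕ} (N : ℝ) (z : Fin n → ℂ) (x t : Fin n → ℝ) :
    ‖gaussKernel N z (ofReIm x t)‖ =
      Real.exp (N ^ 2 * (∑ i, (reVec z i - x i) ^ 2 - ∑ i, (imVec z i - t i) ^ 2)) := by
  rw [gaussKernel, Complex.norm_exp, ← Finset.sum_sub_distrib, ← Complex.ofReal_pow,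
    Complex.re_ofReal_mul, Complex.re_sum]
  congr 2
  refine Finset.sum_congr rfl fun i _ => ?_
  simp [ofReIm_apply, reVec, imVec, sq]

theorem differentiable_gaussKernel_right {n : ℕ} (N : ℝ) (z : Fin n → ℂ) :
    Differentiable ℂ (gaussKernel N z) := by
  unfold gaussKernel
  fun_prop

/-- The derivative of the Gaussian kernel in its first variable. -/
noncomputable def gaussKernelDeriv {n : ℕ} (N : ℝ) (z w : Fin n → ℂ) : (Fin n → ℂ) →L[ℂ] ℂ :=
  gaussKernel N z w • ((N : ℂ) ^ 2 •
    ∑ i, (2 * (z i - w i)) • ContinuousLinearMap.proj (R := ℂ) (φ := fun _ : Fin n => ℂ) i)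

theorem hasFDerivAt_gaussKernel_left {n : ℕ} (N : ℝ) (z w : Fin n → ℂ) :
    HasFDerivAt (fun z => gaussKernel N z w) (gaussKernelDeriv N z w) z := by
  refine HasFDerivAt.cexp (HasFDerivAt.const_mul (HasFDerivAt.fun_sum fun i _ => ?_) _)
  have h : HasFDerivAt (fun z : Fin n → ℂ => z i - w i)
      (ContinuousLinearMap.proj i : (Fin n → ℂ) →L[ℂ] ℂ) z :=
    (ContinuousLinearMap.proj i : (Fin n → ℂ) →L[ℂ] ℂ).hasFDerivAt.sub_const _
  simpa using h.pow 2

theorem Continuous.gaussKernel {n : ℕ} {α : Type*} [TopologicalSpace α] (N : ℝ)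
    {z w : α → Fin n → ℂ} (hz : Continuous z) (hw : Continuous w) :
    Continuous fun a => gaussKernel N (z a) (w a) := by
  unfold _root_.gaussKernel
  fun_prop

theorem Continuous.gaussKernelDeriv {n : ℕ} {α : Type*} [TopologicalSpace α] (N : ℝ)
    {z w : α → Fin n → ℂ} (hz : Continuous z) (hw : Continuous w) :
    Continuous fun a => gaussKernelDeriv N (z a) (w a) := by
  have h : ∀ i, Continuous fun a => (2 * (z a i - w a i)) •
      ContinuousLinearMap.proj (R := ℂ) (φ := fun _ : Fin n => ℂ) i := fun i => by
    have h1 : Continuous fun a => 2 * (z a i - w a i) := by fun_prop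
    exact h1.smul continuous_const
  have h2 := continuous_finsetSum Finset.univ fun i _ => h i
  exact (hz.gaussKernel N hw).smul (h2.const_smul ((N : ℂ) ^ 2))

theorem differentiable_integral_gaussKernel {n : ℕ} (N : ℝ) (x : Fin n → ℝ)
    {g : (Fin n → ℝ) → ℂ} (hg : Continuous g) (hgc : HasCompactSupport g) :
    Differentiable ℂ fun z => ∫ t, gaussKernel N z (ofReIm x t) * g t := by
  intro z
  have hi : Continuous fun t => ofReIm x t :=
    continuous_ofReIm.comp (by fun_prop : Continuous fun t => (x, t))
  refine (hasFDerivAt_integral_of_eq_zero_off_compact (𝕜 := ℂ) (μ := volume)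
    (G := fun z t => gaussKernel N z (ofReIm x t) * g t)
    (G' := fun z t => g t • gaussKernelDeriv N z (ofReIm x t))
    isOpen_univ hgc.isCompact ?_ ?_ ?_ ?_ ?_ (mem_univ z)).differentiableAt
  · exact fun z _ => (continuous_const.gaussKernel N hi).mul hg
  · intro z _ t ht
    simp [image_eq_zero_of_notMem_tsupport ht]
  · exact ((hg.comp continuous_snd).smul
      (continuous_fst.gaussKernelDeriv N (hi.comp continuous_snd))).continuousOn
  · intro z _ t ht
    simp only [image_eq_zero_of_notMem_tsupport ht]
    exact zero_smul ℂ (gaussKernelDeriv N z (ofReIm x t))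
  · exact fun z _ t => (hasFDerivAt_gaussKernel_left N z _).mul_const _

theorem norm_gaussKernel_le_exp_neg {n : ℕ} {N D r R : ℝ} (hr : 0 ≤ r)
    (hR : r + (n * D ^ 2 + 1) ≤ R) {z : Fin n → ℂ} {x t : Fin n → ℝ} (hx : ‖reVec z - x‖ ≤ D)
    (hz : ‖imVec z‖ ≤ r) (ht : R ≤ ‖t‖) :
    ‖gaussKernel N z (ofReIm x t)‖ ≤ Real.exp (-N ^ 2) := by
  rw [norm_gaussKernel_ofReIm, Real.exp_le_exp]
  have h0 : 0 ≤ (n : ℝ) * D ^ 2 := by positivity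
  have h1 : ∑ i, (reVec z i - x i) ^ 2 ≤ n * D ^ 2 := by
    calc ∑ i, (reVec z i - x i) ^ 2 ≤ ∑ _i : Fin n, D ^ 2 := by
          refine Finset.sum_le_sum fun i _ => sq_le_sq' ?_ ?_
          · exact (abs_le.1 ((norm_le_pi_norm (reVec z - x) i).trans hx)).1
          · exact (abs_le.1 ((norm_le_pi_norm (reVec z - x) i).trans hx)).2
      _ = n * D ^ 2 := by simp
  obtain ⟨i, hi⟩ : ∃ i, R ≤ ‖t i‖ := by
    by_contra! h
    exact absurd ht (not_le.2 ((pi_norm_lt_iff (by linarith)).2 h))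
  have h2 : n * D ^ 2 + 1 ≤ |imVec z i - t i| := by
    have h3 : |imVec z i| ≤ r := (norm_le_pi_norm (imVec z) i).trans hz
    have h4 : |t i| - |imVec z i| ≤ |t i - imVec z i| := abs_sub_abs_le_abs_sub _ _
    rw [abs_sub_comm]
    rw [Real.norm_eq_abs] at hi
    linarith
  have h5 : n * D ^ 2 + 1 ≤ (imVec z i - t i) ^ 2 := by
    rw [← sq_abs (imVec z i - t i)]
    nlinarith
  have h6 : (imVec z i - t i) ^ 2 ≤ ∑ i, (imVec z i - t i) ^ 2 :=
    Finset.single_le_sum (f := fun i => (imVec z i - t i) ^ 2) (fun _ _ => sq_nonneg _)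
      (Finset.mem_univ i)
  nlinarith [sq_nonneg N]

theorem exists_norm_integral_gaussKernel_le {n : ℕ} {U K : Set (Fin n → ℝ)}
    {f : (Fin n → ℂ) → ℂ} (hf : ContinuousOn f (tube n U)) (hK : IsCompact K) (hKU : K ⊆ U)
    {S : Set (Fin n → ℂ)} {D r R δ : ℝ} (hr : 0 ≤ r) (hS : ∀ z ∈ S, ‖imVec z‖ ≤ r)
    (hD : ∀ z ∈ S, ∀ x ∈ K, ‖reVec z - x‖ ≤ D) (hR : r + (n * D ^ 2 + 1) ≤ R)
    {X : (Fin n → ℝ) → ℂ} (hX : ContDiff ℝ 1 X) (hXc : HasCompactSupport X)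
    (hXR : ∀ t, ‖t‖ < R → fderiv ℝ X t = 0) :
    ∃ A : ℝ, ∀ N : ℝ, ∀ z ∈ S, ∀ x ∈ K, ∀ v : Fin n → ℝ, ‖v‖ ≤ δ →
      ‖∫ t, gaussKernel N z (ofReIm x t) * f (ofReIm x t) * fderiv ℝ X t v‖
        ≤ A * Real.exp (-N ^ 2) := by
  have hT : IsCompact (tsupport X) := hXc.isCompact
  obtain ⟨M, hM⟩ := (hK.prod hT).exists_bound_of_continuousOn
    (f := fun q : (Fin n → ℝ) × (Fin n → ℝ) => f (ofReIm q.1 q.2))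
    (hf.comp continuous_ofReIm.continuousOn fun q hq => ofReIm_mem_tube (hKU hq.1))
  obtain ⟨M', hM'⟩ := hT.exists_bound_of_continuousOn
    (hX.continuous_fderiv one_ne_zero).continuousOn
  refine ⟨M * (M' * δ) * volume.real (tsupport X), fun N z hz x hx v hv => ?_⟩
  rw [← setIntegral_eq_integral_of_forall_compl_eq_zero (s := tsupport X)]
  · refine (norm_setIntegral_le_of_norm_le_const (C := Real.exp (-N ^ 2) * M * (M' * δ))
      hT.measure_lt_top fun t ht => ?_).trans_eq (by ring)
    have hMn := hM (x, t) ⟨hx, ht⟩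
    have hM0 := (norm_nonneg _).trans hMn
    have hMn' := hM' t ht
    have hM0' := (norm_nonneg _).trans hMn'
    have hδ := (norm_nonneg _).trans hv
    rw [norm_mul, norm_mul]
    rcases lt_or_ge ‖t‖ R with h | h
    · rw [hXR t h]
      simp only [zero_apply, norm_zero, mul_zero]
      positivity
    · gcongr
      · exact norm_gaussKernel_le_exp_neg hr hR (hD z hz x hx) (hS z hz) h
      · exact (ContinuousLinearMap.le_opNorm _ _).trans (by gcongr)
  · intro t ht
    rw [image_eq_zero_of_notMem_tsupport (f := fderiv ℝ X)
      fun h => ht (tsupport_fderiv_subset ℝ h)]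
    simp

/-- The integral of the standard Gaussian over `ℝⁿ`. -/
noncomputable def gaussConst (n : ℕ) : ℂ :=
  ∫ σ : Fin n → ℝ, Complex.exp (-∑ i, (σ i : ℂ) ^ 2)

theorem integrable_gauss (n : ℕ) :
    Integrable fun σ : Fin n → ℝ => Complex.exp (-∑ i, (σ i : ℂ) ^ 2) := by
  simpa using GaussianFourier.integrable_cexp_neg_mul_sum_add (ι := Fin n) (b := 1) (by simp) 0

theorem gaussConst_ne_zero (n : ℕ) : gaussConst n ≠ 0 := by
  have h := GaussianFourier.integral_cexp_neg_mul_sum_add (ι := Fin n) (b := 1) (by simp) 0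
  simp only [neg_mul, one_mul, Pi.zero_apply, zero_mul, Finset.sum_const_zero, add_zero] at h
  rw [gaussConst, h]
  refine mul_ne_zero ?_ (Complex.exp_ne_zero _)
  rw [Ne, Complex.cpow_eq_zero_iff]
  simp [Real.pi_ne_zero]

theorem pow_mul_integral_gaussKernel_reVec {n : ℕ} {N : ℝ} (hN : 0 < N) (z : Fin n → ℂ)
    (g : (Fin n → ℝ) → ℂ) :
    (N : ℂ) ^ n * ∫ t, gaussKernel N z (ofReIm (reVec z) t) * g t
      = ∫ σ : Fin n → ℝ, Complex.exp (-∑ i, (σ i : ℂ) ^ 2) * g (imVec z + N⁻¹ • σ) := by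
  have h1 : ∀ σ : Fin n → ℝ, Complex.exp (-∑ i, (σ i : ℂ) ^ 2)
      = gaussKernel N z (ofReIm (reVec z) (imVec z + N⁻¹ • σ)) := by
    intro σ
    have hN' : (N : ℂ) ≠ 0 := by exact_mod_cast hN.ne'
    rw [gaussKernel, Finset.mul_sum, ← Finset.sum_neg_distrib]
    congr 1
    refine Finset.sum_congr rfl fun i _ => ?_
    have h2 : z i - ofReIm (reVec z) (imVec z + N⁻¹ • σ) i = -(Complex.I * ((N : ℂ)⁻¹ * σ i)) := by
      conv_lhs => rw [← ofReIm_reVec_imVec z]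
      simp only [ofReIm_apply, reVec_ofReIm, imVec_ofReIm, Pi.add_apply, Pi.smul_apply,
        smul_eq_mul, Complex.ofReal_add, Complex.ofReal_mul, Complex.ofReal_inv]
      ring
    rw [h2, neg_sq, mul_pow, mul_pow, Complex.I_sq]
    field_simp
  simp_rw [h1]
  rw [Measure.integral_comp_smul volume
    (fun σ => gaussKernel N z (ofReIm (reVec z) (imVec z + σ)) * g (imVec z + σ)) N⁻¹,
    integral_add_left_eq_self (fun t => gaussKernel N z (ofReIm (reVec z) t) * g t)]
  have h3 : |((N⁻¹ : ℝ) ^ Module.finrank ℝ (Fin n → ℝ))⁻¹| = N ^ n := by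
    rw [Module.finrank_fin_fun, inv_pow, inv_inv, abs_of_pos (by positivity)]
  rw [h3, Complex.real_smul, Complex.ofReal_pow]

theorem eventually_norm_gauss_mean_sub_le {n : ℕ} {U K : Set (Fin n → ℝ)}
    {f : (Fin n → ℂ) → ℂ} (hf : ContinuousOn f (tube n U)) (hK : IsCompact K) (hKU : K ⊆ U)
    {r : ℝ} {X : (Fin n → ℝ) → ℂ} (hX : Continuous X) (hXc : HasCompactSupport X)
    (hX1 : ∀ t, ‖t‖ ≤ r → X t = 1) {η : ℝ} (hη : 0 < η) :
    ∀ᶠ N : ℝ in atTop, ∀ z, reVec z ∈ K → ‖imVec z‖ ≤ r →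
      ‖(N : ℂ) ^ n * (∫ t, gaussKernel N z (ofReIm (reVec z) t) * (f (ofReIm (reVec z) t) * X t))
        - gaussConst n * f z‖ ≤ η := by
  set S : Set (Fin n → ℂ) := {z | reVec z ∈ K ∧ ‖imVec z‖ ≤ r} with hS
  have hSc : IsCompact S := isCompact_reVec_imVec hK r
  have hcont : ContinuousOn (fun q : (Fin n → ℝ) × (Fin n → ℝ) => f (ofReIm q.1 q.2) * X q.2)
      (K ×ˢ univ) :=
    (hf.comp continuous_ofReIm.continuousOn fun q hq => ofReIm_mem_tube (hKU hq.1)).mul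
      (hX.comp continuous_snd).continuousOn
  obtain ⟨M, hM⟩ : ∃ M, ∀ x ∈ K, ∀ t, ‖f (ofReIm x t) * X t‖ ≤ M := by
    obtain ⟨M, hM⟩ := (hK.prod hXc.isCompact).exists_bound_of_continuousOn
      (hcont.mono (prod_mono_right (subset_univ _)))
    refine ⟨max M 0, fun x hx t => ?_⟩
    by_cases ht : t ∈ tsupport X
    · exact (hM (x, t) ⟨hx, ht⟩).trans (le_max_left _ _)
    · simp [image_eq_zero_of_notMem_tsupport ht]
  set Φ : ℝ × (Fin n → ℂ) → ℂ := fun q => ∫ σ : Fin n → ℝ,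
    Complex.exp (-∑ i, (σ i : ℂ) ^ 2) *
      (f (ofReIm (reVec q.2) (imVec q.2 + q.1 • σ)) * X (imVec q.2 + q.1 • σ)) with hΦ
  have hΦc : ContinuousOn Φ (Icc 0 1 ×ˢ S) := by
    refine continuousOn_of_dominated
      (bound := fun σ => ‖Complex.exp (-∑ i, (σ i : ℂ) ^ 2)‖ * M) ?_ ?_ ?_ ?_
    · intro q hq
      refine Continuous.aestronglyMeasurable (Continuous.mul (by fun_prop) ?_)
      exact hcont.comp_continuous (f := fun σ => (reVec q.2, imVec q.2 + q.1 • σ))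
        (by fun_prop) fun σ => ⟨hq.2.1, mem_univ _⟩
    · refine fun q hq => Eventually.of_forall fun σ => ?_
      rw [norm_mul]
      gcongr
      exact hM _ hq.2.1 _
    · exact (integrable_gauss n).norm.mul_const M
    · refine Eventually.of_forall fun σ => continuousOn_const.mul ?_
      refine hcont.comp (f := fun q : ℝ × (Fin n → ℂ) => (reVec q.2, imVec q.2 + q.1 • σ))
        (Continuous.continuousOn ?_) fun q hq => ⟨hq.2.1, mem_univ _⟩
      exact (continuous_reVec.comp continuous_snd).prodMk
        ((continuous_imVec.comp continuous_snd).add (by fun_prop))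
  have hΦ0 : ∀ z ∈ S, Φ (0, z) = gaussConst n * f z := by
    intro z hz
    simp only [hΦ, zero_smul, add_zero, ofReIm_reVec_imVec, hX1 _ hz.2, mul_one]
    rw [integral_mul_const, gaussConst]
  obtain ⟨ε, hε, hu⟩ := Metric.uniformContinuousOn_iff.1
    ((isCompact_Icc.prod hSc).uniformContinuousOn_of_continuous hΦc) η hη
  filter_upwards [eventually_gt_atTop (max 1 ε⁻¹)] with N hN z hz hzr
  have hN1 : 1 < N := (le_max_left _ _).trans_lt hN
  have hNε : N⁻¹ < ε := by
    rw [inv_lt_comm₀ (by linarith) hε]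
    exact (le_max_right _ _).trans_lt hN
  have hNpos : 0 < N⁻¹ := by positivity
  rw [pow_mul_integral_gaussKernel_reVec (by linarith)
    z (fun t => f (ofReIm (reVec z) t) * X t), ← hΦ0 z ⟨hz, hzr⟩, ← dist_eq_norm]
  refine (hu (N⁻¹, z) ⟨⟨hNpos.le, inv_le_one_of_one_le₀ hN1.le⟩, hz, hzr⟩ (0, z)
    ⟨⟨le_rfl, zero_le_one⟩, hz, hzr⟩ ?_).le
  rw [dist_prod_same_right, Real.dist_0_eq_abs, abs_of_pos hNpos]
  exact hNε

theorem tendsto_const_mul_pow_mul_exp_neg_sq (A : ℝ) (n : ℕ) :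
    Tendsto (fun N : ℝ => N ^ n * (A * Real.exp (-N ^ 2))) atTop (𝓝 0) := by
  have h : Tendsto (fun N : ℝ => N ^ n * Real.exp (-N ^ 2)) atTop (𝓝 0) := by
    refine squeeze_zero' ?_ ?_ (Real.tendsto_pow_mul_exp_neg_atTop_nhds_zero n)
    · filter_upwards [eventually_ge_atTop 0] with N hN
      positivity
    · filter_upwards [eventually_ge_atTop 1] with N hN
      gcongr
      nlinarith
  simpa [mul_left_comm] using h.const_mul A

theorem exists_entire_approx {n : ℕ} {U : Set (Fin n → ℝ)} (hU : IsOpen U) (hc : IsConnected U)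
    {f : (Fin n → ℂ) → ℂ} (hf : DifferentiableOn ℂ f (tube n U)) {K : Set (Fin n → ℂ)}
    (hK : IsCompact K) (hKU : K ⊆ tube n U) {ε : ℝ} (hε : 0 < ε) :
    ∃ F : (Fin n → ℂ) → ℂ, Differentiable ℂ F ∧ ∀ z ∈ K, ‖F z - f z‖ ≤ ε := by
  obtain ⟨x₀, hx₀⟩ := hc.nonempty
  obtain ⟨L, hL, hLc, hKL, hLU, hx₀L⟩ := exists_isCompact_isPreconnected_superset hU
    hc.isPreconnected (hK.image continuous_reVec) (image_subset_iff.2 hKU) hx₀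
  obtain ⟨δ, hδ, hδU⟩ := hL.exists_cthickening_subset_open hU hLU
  set L' := cthickening δ L
  have hL' : IsCompact L' := hL.cthickening
  obtain ⟨r, hr0, hr⟩ : ∃ r : ℝ, 0 ≤ r ∧ ∀ z ∈ K, ‖imVec z‖ ≤ r := by
    obtain ⟨r, hr⟩ := hK.exists_bound_of_continuousOn continuous_imVec.continuousOn
    exact ⟨max r 0, le_max_right _ _, fun z hz => (hr z hz).trans (le_max_left _ _)⟩
  obtain ⟨D, hD⟩ := (hL.prod hL').exists_bound_of_continuousOn
    (f := fun q : (Fin n → ℝ) × (Fin n → ℝ) => q.1 - q.2) (by fun_prop)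
  set S : Set (Fin n → ℂ) := {z | reVec z ∈ L ∧ ‖imVec z‖ ≤ r} with hS
  set R : ℝ := r + (n * D ^ 2 + 1) with hRdef
  have hrR : r < R := by
    have : 0 ≤ n * D ^ 2 := by positivity
    linarith
  set χ : ContDiffBump (0 : Fin n → ℝ) := ⟨R, R + 1, hr0.trans_lt hrR, by linarith⟩ with hχ
  set X : (Fin n → ℝ) → ℂ := fun t => (χ t : ℂ) with hXdef
  have hX : ContDiff ℝ 1 X := Complex.ofRealCLM.contDiff.comp χ.contDiff
  have hXc : HasCompactSupport X := χ.hasCompactSupport.comp_left Complex.ofReal_zero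
  have hX1 : ∀ t, ‖t‖ ≤ r → X t = 1 := fun t ht => by
    rw [hXdef]
    simp [χ.one_of_mem_closedBall (x := t) (by simpa [hχ] using ht.trans hrR.le)]
  have hXR : ∀ t, ‖t‖ < R → fderiv ℝ X t = 0 := fun t ht => by
    have h1 : X =ᶠ[𝓝 t] fun _ => 1 := by
      filter_upwards [χ.eventuallyEq_one_of_mem_ball (x := t) (by simpa [hχ] using ht)] with y hy
      simp [hXdef, hy]
    rw [h1.fderiv_eq]
    simp
  obtain ⟨A, hA⟩ := exists_norm_integral_gaussKernel_le (S := S) (δ := δ) hf.continuousOn hL' hδU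
    hr0 (fun z hz => hz.2) (fun z hz x hx => hD (reVec z, x) ⟨hz.1, hx⟩) hRdef.ge hX hXc hXR
  set J : ℝ → (Fin n → ℝ) → (Fin n → ℂ) → ℂ := fun N p z =>
    (N : ℂ) ^ n * ∫ t, gaussKernel N z (ofReIm p t) * (f (ofReIm p t) * X t) with hJ
  have hC := norm_pos_iff.2 (gaussConst_ne_zero n)
  have hη : 0 < ε * ‖gaussConst n‖ / 2 := by positivity
  have hchain := eventually_norm_sub_le_of_chain (S := S) (J := J) hL hLc hx₀L
    (tendsto_const_mul_pow_mul_exp_neg_sq A n) hδ ?_ hη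
  · obtain ⟨N, h1, h2⟩ := (hchain.and (eventually_norm_gauss_mean_sub_le hf.continuousOn hL hLU
      hX.continuous hXc hX1 hη)).exists
    refine ⟨fun z => (gaussConst n)⁻¹ * J N x₀ z,
      ((differentiable_integral_gaussKernel N x₀ ((continuous_comp_ofReIm hf.continuousOn hx₀).mul
        hX.continuous) hXc.mul_left).const_mul _).const_mul _, fun z hz => ?_⟩
    have hzL : reVec z ∈ L := hKL (mem_image_of_mem _ hz)
    have h3 := h1 _ hzL z ⟨hzL, hr z hz⟩
    have h4 := h2 z hzL (hr z hz)
    have h5 : (gaussConst n)⁻¹ * J N x₀ z - f z = (gaussConst n)⁻¹ *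
        ((J N (reVec z) z - gaussConst n * f z) - (J N (reVec z) z - J N x₀ z)) := by
      have := gaussConst_ne_zero n
      field_simp
      ring
    rw [h5, norm_mul, norm_inv, inv_mul_le_iff₀ hC]
    exact (norm_sub_le _ _).trans ((add_le_add h4 h3).trans_eq (by ring))
  · filter_upwards [eventually_ge_atTop 0] with N hN p hp q hq hpq z hz
    have hsegL : ∀ s ∈ Icc (0 : ℝ) 1, p + s • (q - p) ∈ L' := fun s hs => by
      refine mem_cthickening_of_dist_le _ p δ L hp ?_
      rw [dist_eq_norm, add_sub_cancel_left, norm_smul, Real.norm_of_nonneg hs.1]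
      rw [dist_eq_norm] at hpq
      nlinarith [hs.2, norm_nonneg (q - p)]
    have hmain := norm_integral_ofReIm_sub_le_of_segment hU
      (h := fun w => gaussKernel N z w * f w)
      ((differentiable_gaussKernel_right N z).differentiableOn.mul hf) hX hXc
      (fun s hs => hδU (hsegL s hs)) fun s hs => hA N z hz _ (hsegL s hs) (q - p)
        (by rw [← dist_eq_norm]; exact hpq.le)
    rw [add_sub_cancel] at hmain
    simp only [hJ, ← mul_sub, norm_mul, norm_pow, Complex.norm_real, Real.norm_of_nonneg hN]
    simp only [mul_assoc] at hmain
    gcongr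

end BochnerTube

/-- Bochner's tube theorem: If U ⊆ ℝⁿ is a connected open set and f is
holomorphic on the tube T(U) = U + iℝⁿ, then f has a holomorphic continuation to the tube
over the convex hull of U. -/
theorem bochner_tube_theorem (n : ℕ) (U : Set (Fin n → ℝ)) (hUopen : IsOpen U)
    (hUconn : IsConnected U) (f : (Fin n → ℂ) → ℂ)
    (hf : DifferentiableOn ℂ f (tube n U)) :
    ∃ g : (Fin n → ℂ) → ℂ,
      DifferentiableOn ℂ g (tube n (convexHull ℝ U)) ∧
      Set.EqOn g f (tube n U) := by
  obtain ⟨g, hg, hgf⟩ := exists_extension_of_entire_approx hUopen hUconn.isPreconnected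
    fun K hK hKU ε hε => exists_entire_approx hUopen hUconn hf hK hKU hε
  exact ⟨g, hg, hgf⟩
end

section
/- Let T ⊆ C^n be a tube domain, let g, h: T → C be holomorphic with |g(z)| ≤ |h(z)| for all z ∈ T and h nonvanishing on T, and let g̃, h̃ be their holomorphic continuations to the convex hull of T (which exist by Bochner's tube theorem). Then |g̃(z)| ≤ |h̃(z)| for all z in the convex hull of T. -/
open Set Filter Topology

/-- The parameters `(t, ζ)` for which `(ζ, t - ζ + ε ζ²)` lies over the quadrant
`0 ≤ x₁, 0 ≤ x₂`, truncated to `t ≤ t₁` and `x₁ ≤ 1`. -/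
def parabolaParams (ε t₁ : ℝ) : Set (ℝ × ℂ) :=
  {p | p.1 ≤ t₁ ∧ 0 ≤ p.2.re ∧ p.2.re ≤ 1 ∧ 0 ≤ ((p.1 : ℂ) - p.2 + ε * p.2 ^ 2).re}

theorem parabola_re (ε t : ℝ) (ζ : ℂ) :
    ((t : ℂ) - ζ + ε * ζ ^ 2).re = t - ζ.re + ε * (ζ.re ^ 2 - ζ.im ^ 2) := by
  simp [pow_two]

theorem isCompact_parabolaParams {ε t₁ : ℝ} (hε : 0 < ε) (hε1 : ε < 1) :
    IsCompact (parabolaParams ε t₁) := by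
  have hcl : IsClosed (parabolaParams ε t₁) := by
    simp only [parabolaParams, ofPred_and]
    refine (isClosed_le ?_ ?_).inter ((isClosed_le ?_ ?_).inter
      ((isClosed_le ?_ ?_).inter (isClosed_le ?_ ?_))) <;> fun_prop
  refine ((isCompact_Icc (a := (0 : ℝ)) (b := t₁)).prod
    ((isCompact_Icc (a := (0 : ℝ)) (b := 1)).reProdIm
      (isCompact_Icc (a := -(t₁ / ε + 1)) (b := t₁ / ε + 1)))).of_isClosed_subset hcl ?_
  rintro ⟨t, ζ⟩ ⟨h1, h2, h3, h4⟩
  rw [parabola_re] at h4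
  dsimp only at h1 h2 h3 h4
  have hx : ε * ζ.re ^ 2 ≤ ζ.re := by nlinarith
  have hy : ε * ζ.im ^ 2 ≤ t := by nlinarith
  have hsq : ζ.im ^ 2 ≤ t₁ / ε := by
    rw [le_div_iff₀ hε]; linarith
  refine ⟨⟨by nlinarith [mul_nonneg hε.le (sq_nonneg ζ.im)], h1⟩, ⟨h2, h3⟩, ?_, ?_⟩
  · nlinarith [sq_nonneg (ζ.im + 1)]
  · nlinarith [sq_nonneg (ζ.im - 1)]

/-- A form of the continuity principle for the family of parabolas `z₂ = t - z₁ + ε z₁²`. -/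
theorem ne_zero_of_parabola_boundary {ε t₁ : ℝ} (hε : 0 < ε) (hε1 : ε < 1) (ht₁ : t₁ < 1 - ε)
    {H : ℝ → ℂ → ℂ} (hcont : ContinuousOn (Function.uncurry H) (parabolaParams ε t₁))
    (hdiff : ∀ t, DifferentiableOn ℂ (H t) {ζ | (t, ζ) ∈ parabolaParams ε t₁})
    (hbd : ∀ t ζ, (t, ζ) ∈ parabolaParams ε t₁ →
      (ζ.re = 0 ∨ ((t : ℂ) - ζ + ε * ζ ^ 2).re = 0) → H t ζ ≠ 0) :
    ∀ t ζ, (t, ζ) ∈ parabolaParams ε t₁ → H t ζ ≠ 0 := by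
  have hK : IsCompact (parabolaParams ε t₁) := isCompact_parabolaParams hε hε1
  set K := parabolaParams ε t₁ with hKdef
  obtain ⟨δ, hδ, hδle⟩ : ∃ δ > 0, ∀ t ζ, (t, ζ) ∈ K →
      (ζ.re = 0 ∨ ((t : ℂ) - ζ + ε * ζ ^ 2).re = 0) → δ ≤ ‖H t ζ‖ := by
    have hL : IsCompact (K ∩ {p | p.2.re = 0 ∨ ((p.1 : ℂ) - p.2 + ε * p.2 ^ 2).re = 0}) := by
      refine hK.inter_right (IsClosed.union (isClosed_eq ?_ ?_) (isClosed_eq ?_ ?_)) <;> fun_prop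
    obtain ⟨δ, hδ, h⟩ := hL.exists_forall_le' (a := 0) (hcont.norm.mono inter_subset_left)
      (fun p hp => norm_pos_iff.2 (hbd p.1 p.2 hp.1 hp.2))
    exact ⟨δ, hδ, fun t ζ h1 h2 => h (t, ζ) ⟨h1, h2⟩⟩
  have hmax : ∀ t, (∀ ζ, (t, ζ) ∈ K → H t ζ ≠ 0) → ∀ ζ, (t, ζ) ∈ K → δ ≤ ‖H t ζ‖ := by
    intro t hne ζ hζ
    by_cases hb : ζ.re = 0 ∨ ((t : ℂ) - ζ + ε * ζ ^ 2).re = 0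
    · exact hδle t ζ hζ hb
    push Not at hb
    set D : Set ℂ := {w | 0 < w.re ∧ w.re < 1 ∧ 0 < ((t : ℂ) - w + ε * w ^ 2).re} with hD
    have hDo : IsOpen D := by
      simp only [hD, ofPred_and]
      refine (isOpen_lt ?_ ?_).inter ((isOpen_lt ?_ ?_).inter (isOpen_lt ?_ ?_)) <;> fun_prop
    have hEc : IsClosed {w : ℂ | (t, w) ∈ K} := hK.isClosed.preimage (by fun_prop)
    have hDE : D ⊆ {w : ℂ | (t, w) ∈ K} :=
      fun w hw => ⟨hζ.1, hw.1.le, hw.2.1.le, hw.2.2.le⟩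
    have hclE : closure D ⊆ {w : ℂ | (t, w) ∈ K} := hEc.closure_subset_iff.2 hDE
    have hlt : ∀ w, (t, w) ∈ K → w.re < 1 := by
      rintro w ⟨h1, h2, h3, h4⟩
      rw [parabola_re] at h4
      dsimp only at h1 h2 h3 h4
      refine lt_of_le_of_ne h3 fun h => ?_
      rw [h] at h4
      nlinarith [mul_nonneg hε.le (sq_nonneg w.im)]
    have hmem : ∀ w, (t, w) ∈ K → ¬ (w.re = 0 ∨ ((t : ℂ) - w + ε * w ^ 2).re = 0) → w ∈ D := by
      intro w hw hn
      push Not at hn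
      exact ⟨lt_of_le_of_ne hw.2.1 hn.1.symm, hlt w hw, lt_of_le_of_ne hw.2.2.2 hn.2.symm⟩
    have hbdd : Bornology.IsBounded D :=
      ((hK.image continuous_snd).isBounded).subset fun w hw => ⟨(t, w), hDE hw, rfl⟩
    have hdc : DiffContOnCl ℂ (fun w => (H t w)⁻¹) D :=
      DifferentiableOn.diffContOnCl
        (((hdiff t).mono hclE).inv fun w hw => hne w (hclE hw))
    have := Complex.norm_le_of_forall_mem_frontier_norm_le hbdd hdc (C := δ⁻¹) (z := ζ) ?_
      (subset_closure (hmem ζ hζ (by push Not; exact hb)))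
    · rw [norm_inv] at this
      exact (inv_le_inv₀ (norm_pos_iff.2 (hne ζ hζ)) hδ).1 this
    · intro w hw
      have hwE := hclE hw.1
      rw [hDo.frontier_eq] at hw
      rw [norm_inv]
      exact inv_anti₀ hδ (hδle t w hwE (by_contra fun h => hw.2 (hmem w hwE h)))
  by_contra! hex
  obtain ⟨t', ζ', hζ', h0'⟩ := hex
  have hZ : IsCompact (K ∩ Function.uncurry H ⁻¹' {0}) :=
    hK.of_isClosed_subset (hcont.preimage_isClosed_of_isClosed hK.isClosed isClosed_singleton)
      inter_subset_left
  obtain ⟨⟨t, ζ⟩, ⟨hζ, h0⟩, hmin⟩ :=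
    hZ.exists_isMinOn ⟨(t', ζ'), hζ', h0'⟩ continuous_fst.continuousOn
  have h0 : H t ζ = 0 := h0
  have hnb : ¬ (ζ.re = 0 ∨ ((t : ℂ) - ζ + ε * ζ ^ 2).re = 0) := fun h => hbd t ζ hζ h h0
  push Not at hnb
  have hpos : 0 < ((t : ℂ) - ζ + ε * ζ ^ 2).re := lt_of_le_of_ne hζ.2.2.2 hnb.2.symm
  have hev : ∀ᶠ s in 𝓝[<] t, (s, ζ) ∈ K ∧ δ ≤ ‖H s ζ‖ := by
    have h1 : ∀ᶠ s : ℝ in 𝓝 t, 0 < ((s : ℂ) - ζ + ε * ζ ^ 2).re :=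
      (ContinuousAt.eventually_lt (by fun_prop) (by fun_prop) hpos)
    filter_upwards [self_mem_nhdsWithin, nhdsWithin_le_nhds h1] with s hs hs1
    have hsK : (s, ζ) ∈ K := ⟨(le_of_lt hs).trans hζ.1, hζ.2.1, hζ.2.2.1, hs1.le⟩
    refine ⟨hsK, hmax s (fun w hw hw0 => ?_) ζ hsK⟩
    exact not_le.2 hs (isMinOn_iff.1 hmin (s, w) ⟨hw, hw0⟩)
  have htend : Tendsto (fun s => ‖H s ζ‖) (𝓝[<] t) (𝓝 ‖H t ζ‖) := by
    have h1 : Tendsto (fun s : ℝ => (s, ζ)) (𝓝[<] t) (𝓝[K] (t, ζ)) :=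
      tendsto_nhdsWithin_iff.2 ⟨((Continuous.prodMk_left ζ).tendsto t).mono_left
        nhdsWithin_le_nhds, hev.mono fun s hs => hs.1⟩
    exact ((hcont (t, ζ) hζ).tendsto.comp h1).norm
  have := ge_of_tendsto htend (hev.mono fun s hs => hs.2)
  rw [h0, norm_zero] at this
  exact absurd this (not_le.2 hδ)

theorem Convex.add_smul_add_smul_mem {E : Type*} [AddCommGroup E] [Module ℝ E] {W : Set E}
    (hW : Convex ℝ W) {a u v : E} (ha : a ∈ W) (hu : a + u ∈ W) (hv : a + v ∈ W) {r s : ℝ}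
    (hr : 0 ≤ r) (hs : 0 ≤ s) (hrs : r + s ≤ 1) : a + r • u + s • v ∈ W := by
  have h := hW.sum_mem (t := Finset.univ) (w := ![1 - r - s, r, s]) (z := ![a, a + u, a + v])
    (by intro i _; fin_cases i <;> simp <;> linarith)
    (by simp only [Fin.sum_univ_three, Matrix.cons_val]; ring)
    (by intro i _; fin_cases i; exacts [ha, hu, hv])
  convert h using 1
  simp only [Fin.sum_univ_three, Matrix.cons_val]
  module

/-- Nonvanishing propagates from the tube over two legs of a triangle to the triangle without
its third side. -/
theorem ne_zero_of_legs {n : ℕ} {V W : Set (Fin n → ℝ)} (hW : Convex ℝ W)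
    (hVW : V ⊆ W) {F : (Fin n → ℂ) → ℂ} (hF : DifferentiableOn ℂ F (tube n W))
    (hne : ∀ z ∈ tube n V, F z ≠ 0) {a u v : Fin n → ℝ}
    (hu : ∀ s ∈ Icc (0 : ℝ) 1, a + s • u ∈ V) (hv : ∀ s ∈ Icc (0 : ℝ) 1, a + s • v ∈ V)
    {p q : ℝ} (hp : 0 ≤ p) (hq : 0 ≤ q) (hpq : p + q < 1) :
    ∀ z ∈ tube n {a + p • u + q • v}, F z ≠ 0 := by
  intro z hz
  set ε : ℝ := (1 - (p + q)) / 2 with hεdef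
  have hε : 0 < ε := by linarith
  have hε1 : ε < 1 := by linarith
  have ht₁ : p + q - ε * p ^ 2 < 1 - ε := by nlinarith [mul_nonneg hε.le (sq_nonneg p)]
  set t₁ := p + q - ε * p ^ 2 with ht₁def
  set γ : ℝ × ℂ → Fin n → ℂ := fun x i =>
    z i - p * u i - q * v i + x.2 * u i + ((x.1 : ℂ) - x.2 + ε * x.2 ^ 2) * v i with hγ
  have hz' : ∀ i, (z i).re = a i + p * u i + q * v i := fun i => congrFun hz i
  have hre : ∀ x : ℝ × ℂ, (fun i => (γ x i).re) =
      a + x.2.re • u + ((x.1 : ℂ) - x.2 + ε * x.2 ^ 2).re • v := by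
    intro x
    funext i
    simp only [hγ, Complex.add_re, Complex.sub_re, Complex.re_mul_ofReal, hz', Pi.add_apply,
      Pi.smul_apply, smul_eq_mul, Complex.ofReal_re]
    ring
  have ha : a ∈ V := by simpa using hu 0 (by simp)
  have hsum : ∀ x ∈ parabolaParams ε t₁,
      x.2.re + ((x.1 : ℂ) - x.2 + ε * x.2 ^ 2).re ≤ 1 := by
    rintro ⟨t, ζ⟩ ⟨h1, h2, h3, -⟩
    rw [parabola_re]
    dsimp only at h1 h2 h3 ⊢
    have hx : ζ.re ^ 2 ≤ 1 := pow_le_one₀ h2 h3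
    nlinarith [mul_nonneg hε.le (sq_nonneg ζ.im)]
  have hmaps : ∀ x ∈ parabolaParams ε t₁, γ x ∈ tube n W := by
    intro x hx
    have hs := hsum x hx
    obtain ⟨-, h2, -, h4⟩ := hx
    change (fun i => (γ x i).re) ∈ W
    rw [hre]
    exact hW.add_smul_add_smul_mem (hVW ha) (hVW (by simpa using hu 1 (by simp)))
      (hVW (by simpa using hv 1 (by simp))) h2 h4 hs
  have hcontγ : Continuous γ := by fun_prop
  have key := ne_zero_of_parabola_boundary hε hε1 ht₁ (H := fun t ζ => F (γ (t, ζ)))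
    (hF.continuousOn.comp hcontγ.continuousOn hmaps)
    (fun t => hF.comp (by
      apply Differentiable.differentiableOn
      simp only [hγ]
      fun_prop) (fun ζ hζ => hmaps _ hζ))
    (by
      intro t ζ hx hb
      have hs := hsum _ hx
      obtain ⟨-, h2, h3, h4⟩ := hx
      refine hne _ (show (fun i => (γ (t, ζ) i).re) ∈ V from ?_)
      rw [hre]
      dsimp only at h2 h3 h4 hs ⊢
      rcases hb with hb | hb
      · rw [hb] at hs ⊢
        simpa using hv _ ⟨h4, by linarith⟩
      · rw [hb]
        simpa using hu _ ⟨h2, h3⟩)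
  have hγz : γ (t₁, p) = z := by
    funext i
    simp only [hγ, ht₁def]
    push_cast
    ring
  have := key t₁ p ⟨le_rfl, by simpa using hp, by simp; linarith, by
    rw [parabola_re]; simp [ht₁def]; linarith⟩
  rwa [hγz] at this

theorem eventually_extended_segment_subset {E : Type*} [AddCommGroup E] [Module ℝ E]
    [TopologicalSpace E] [ContinuousAdd E] [ContinuousSMul ℝ E] {V : Set E} (hV : IsOpen V)
    {a b : E} (hab : segment ℝ a b ⊆ V) :
    ∀ᶠ r in 𝓝[>] (1 : ℝ), ∀ s ∈ Icc (0 : ℝ) 1, a + s • r • (b - a) ∈ V := by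
  have hIcc : ∀ s ∈ Icc (0 : ℝ) 1, a + s • (b - a) ∈ V := fun s hs =>
    hab (by rw [segment_eq_image']; exact ⟨s, hs, rfl⟩)
  have h : ∀ᶠ r : ℝ in 𝓝 1, ∀ s ∈ Icc (0 : ℝ) 1, a + s • r • (b - a) ∈ V := by
    refine isCompact_Icc.eventually_forall_of_forall_eventually fun s hs => ?_
    have hc : Continuous fun x : ℝ × ℝ => a + x.2 • x.1 • (b - a) := by fun_prop
    exact hc.continuousAt.eventually_mem (hV.mem_nhds (by simpa using hIcc s hs))
  exact nhdsWithin_le_nhds h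

theorem ne_zero_of_segments {n : ℕ} {V W : Set (Fin n → ℝ)} (hV : IsOpen V) (hW : Convex ℝ W)
    (hVW : V ⊆ W) {F : (Fin n → ℂ) → ℂ} (hF : DifferentiableOn ℂ F (tube n W))
    (hne : ∀ z ∈ tube n V, F z ≠ 0) {a b c : Fin n → ℝ} (hab : segment ℝ a b ⊆ V)
    (hac : segment ℝ a c ⊆ V) {p q : ℝ} (hp : 0 ≤ p) (hq : 0 ≤ q) (hpq : p + q ≤ 1) :
    ∀ z ∈ tube n {a + p • (b - a) + q • (c - a)}, F z ≠ 0 := by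
  obtain ⟨r, ⟨hb, hc⟩, hr⟩ := (((eventually_extended_segment_subset hV hab).and
    (eventually_extended_segment_subset hV hac)).and self_mem_nhdsWithin).exists
  have hr : 1 < r := hr
  have hr0 : 0 < r := by linarith
  have := ne_zero_of_legs hW hVW hF hne hb hc (p := p / r) (q := q / r) (by positivity)
    (by positivity) (by rw [← add_div, div_lt_one hr0]; linarith)
  simpa only [smul_smul, div_mul_cancel₀ _ hr0.ne'] using this

/-- A holomorphic function on the tube over the convex hull of a connected open set `U` that
does not vanish over `U` does not vanish anywhere. -/
theorem ne_zero_on_tube_convexHull {n : ℕ} {U : Set (Fin n → ℝ)} (hUo : IsOpen U)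
    (hUc : IsPreconnected U) {F : (Fin n → ℂ) → ℂ}
    (hF : DifferentiableOn ℂ F (tube n (convexHull ℝ U)))
    (hne : ∀ z ∈ tube n U, F z ≠ 0) : ∀ z ∈ tube n (convexHull ℝ U), F z ≠ 0 := by
  set W := convexHull ℝ U with hWdef
  have hW : Convex ℝ W := convex_convexHull ℝ U
  set N : Set (Fin n → ℝ) := {x | x ∈ W ∧ ∀ z ∈ tube n {x}, F z ≠ 0} with hN
  set V := interior N with hVdef
  have hV : IsOpen V := isOpen_interior
  have hVW : V ⊆ W := fun x hx => (interior_subset hx).1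
  have hUV : U ⊆ V := interior_maximal (fun x hx => ⟨subset_convexHull ℝ U hx, fun z hz =>
    hne z (by change _ ∈ U; rw [show (fun i => (z i).re) = x from hz]; exact hx)⟩) hUo
  have hneV : ∀ z ∈ tube n V, F z ≠ 0 := fun z hz => (interior_subset hz).2 z rfl
  have htri : ∀ a b c, segment ℝ a b ⊆ V → segment ℝ a c ⊆ V → ∀ p q : ℝ, 0 ≤ p → 0 ≤ q →
      p + q ≤ 1 → a + p • (b - a) + q • (c - a) ∈ V := by
    intro a b c hab hac p q hp hq hpq
    have hshift : ∀ d, segment ℝ a d ⊆ V → ∀ᶠ w in 𝓝 (0 : Fin n → ℝ),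
        segment ℝ (a + w) (d + w) ⊆ V := by
      intro d had
      have : ∀ᶠ w in 𝓝 (0 : Fin n → ℝ), ∀ s ∈ Icc (0 : ℝ) 1, a + w + s • (d - a) ∈ V := by
        refine isCompact_Icc.eventually_forall_of_forall_eventually fun s hs => ?_
        have hc : Continuous fun x : (Fin n → ℝ) × ℝ => a + x.1 + x.2 • (d - a) := by fun_prop
        refine hc.continuousAt.eventually_mem (hV.mem_nhds (had ?_))
        rw [segment_eq_image']
        exact ⟨s, hs, by simp⟩
      filter_upwards [this] with w hw
      rw [segment_eq_image']
      rintro _ ⟨s, hs, rfl⟩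
      simpa using hw s hs
    have hev : ∀ᶠ w in 𝓝 (0 : Fin n → ℝ), a + p • (b - a) + q • (c - a) + w ∈ N := by
      filter_upwards [hshift b hab, hshift c hac] with w hb hc
      have heq : a + p • (b - a) + q • (c - a) + w =
          (a + w) + p • ((b + w) - (a + w)) + q • ((c + w) - (a + w)) := by module
      rw [heq]
      refine ⟨hW.add_smul_add_smul_mem (hVW (hb (left_mem_segment ℝ _ _))) ?_ ?_ hp hq hpq,
        ne_zero_of_segments hV hW hVW hF hneV hb hc hp hq hpq⟩
      · rw [add_sub_cancel]
        exact hVW (hb (right_mem_segment ℝ _ _))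
      · rw [add_sub_cancel]
        exact hVW (hc (right_mem_segment ℝ _ _))
    rw [hVdef, mem_interior_iff_mem_nhds, ← map_add_left_nhds_zero]
    exact hev
  have htrans : ∀ a b c, segment ℝ a b ⊆ V → segment ℝ a c ⊆ V → segment ℝ b c ⊆ V := by
    rintro a b c hab hac _ ⟨p, q, hp, hq, hpq, rfl⟩
    convert htri a b c hab hac p q hp hq hpq.le using 1
    rw [← sub_eq_zero, show p = 1 - q by linarith]
    module
  intro z hz
  obtain ⟨a, ha⟩ : U.Nonempty := convexHull_nonempty_iff.1 ⟨_, hz⟩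
  have hUS : ∀ b ∈ U, segment ℝ a b ⊆ V := fun b hb =>
    hUc.induction₂ (fun x y => segment ℝ x y ⊆ V)
      (fun x hx => by
        obtain ⟨r, hr, hball⟩ := Metric.isOpen_iff.1 hUo x hx
        filter_upwards [nhdsWithin_le_nhds (Metric.ball_mem_nhds x hr)] with y hy
        exact (((convex_ball x r).segment_subset (Metric.mem_ball_self hr) hy).trans hball).trans
          hUV)
      (fun x y w _ _ _ hxy hyw => htrans y x w (by rwa [segment_symm]) hyw)
      (fun x y _ _ h => by rwa [segment_symm]) ha hb
  have hconv : Convex ℝ {b | segment ℝ a b ⊆ V} := by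
    rintro b hb c hc p q hp hq hpq x hx
    rw [segment_eq_image'] at hx
    obtain ⟨s, ⟨hs0, hs1⟩, rfl⟩ := hx
    convert htri a b c hb hc (s * p) (s * q) (by positivity) (by positivity)
      (by rw [← mul_add, hpq, mul_one]; exact hs1) using 1
    rw [← sub_eq_zero, show p = 1 - q by linarith]
    module
  exact hneV z (convexHull_min hUS hconv hz (right_mem_segment ℝ _ _))

/-- Let T = T(U) be a tube domain, g, h holomorphic on T with |g| ≤ |h| and h
nonvanishing on T, and let g̃, h̃ be holomorphic continuations of g, h to the tube over the
convex hull of U. Then |g̃(z)| ≤ |h̃(z)| on the tube over the convex hull. -/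
theorem extending_inequalities (n : ℕ) (U : Set (Fin n → ℝ)) (hUopen : IsOpen U)
    (hUconn : IsConnected U) (g h : (Fin n → ℂ) → ℂ)
    (hg : DifferentiableOn ℂ g (tube n U)) (hh : DifferentiableOn ℂ h (tube n U))
    (hle : ∀ z ∈ tube n U, ‖g z‖ ≤ ‖h z‖) (hne : ∀ z ∈ tube n U, h z ≠ 0)
    (gt ht : (Fin n → ℂ) → ℂ)
    (hgt : DifferentiableOn ℂ gt (tube n (convexHull ℝ U)))
    (hht : DifferentiableOn ℂ ht (tube n (convexHull ℝ U)))
    (hgt_eq : Set.EqOn gt g (tube n U)) (hht_eq : Set.EqOn ht h (tube n U)) :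
    ∀ z ∈ tube n (convexHull ℝ U), ‖gt z‖ ≤ ‖ht z‖ := by
  have hht_ne : ∀ z ∈ tube n (convexHull ℝ U), ht z ≠ 0 :=
    ne_zero_on_tube_convexHull hUopen hUconn.isPreconnected hht
      fun z hz => by rw [hht_eq hz]; exact hne z hz
  intro z hz
  by_contra! hlt
  have hpos : 0 < ‖ht z‖ := norm_pos_iff.2 (hht_ne z hz)
  refine ne_zero_on_tube_convexHull (F := fun w => gt w - gt z / ht z * ht w) hUopen
    hUconn.isPreconnected (hgt.sub (hht.const_mul _)) (fun w hw h0 => ?_) z hz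
    (by simp [hht_ne z hz])
  have hw0 : 0 < ‖h w‖ := norm_pos_iff.2 (hne w hw)
  have hc : 1 < ‖gt z / ht z‖ := by rwa [norm_div, one_lt_div hpos]
  have heq : g w = gt z / ht z * h w := by
    rw [← hgt_eq hw, ← hht_eq hw]
    exact sub_eq_zero.1 h0
  have := hle w hw
  rw [heq, norm_mul] at this
  nlinarith
end

section
/- Let q ≡ 2 (mod 3) be an odd prime power and g an even integer. Then the set of primitive cubic characters of genus g over F_q(T) is in bijection with the set of monic squarefree polynomials F ∈ F_{q^2}[T] of degree g/2 + 1 having no irreducible divisor lying in F_q[T], via F ↦ χ_F restricted to F_q[T]. Consequently Σ_{χ primitive cubic, genus(χ)=g} L_q(1/2, χ) = Σ_{F ∈ H_{q^2}, P|F ⇒ P ∉ F_q[T]} L_q(1/2, χ_F), where H_{q^2} is the set of monic squarefree polynomials in F_{q^2}[T] of degree g/2 + 1. -/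
open scoped Classical
/-- `GoodF Fq g F`: F is a monic squarefree polynomial in F_{q²}[T] of degree g/2 + 1
having no (monic) irreducible divisor lying in F_q[T]. -/
def GoodF (Fq : Type*) {Fq2 : Type*} [Field Fq] [Field Fq2] [Algebra Fq Fq2]
    (g : ℕ) (F : Polynomial Fq2) : Prop :=
  F.Monic ∧ Squarefree F ∧ F.natDegree = g / 2 + 1 ∧
    ∀ P : Polynomial Fq, P.Monic → Irreducible P → ¬ P.map (algebraMap Fq Fq2) ∣ F

/-- `IsPrimCubicGenus g h χ`: χ is a primitive cubic character of F_q[T] of genus g —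
an even character of order 3, primitive of (monic) conductor h, where (Riemann–Hurwitz
for even cubic characters) deg h = g + 2. -/
def IsPrimCubicGenus {Fq : Type*} [Field Fq] [Fintype Fq] (g : ℕ)
    (h : Polynomial Fq) (χ : MulChar (Polynomial Fq ⧸ Ideal.span {h}) ℂ) : Prop :=
  h.Monic ∧ h.natDegree = g + 2 ∧ χ ^ 3 = 1 ∧ χ ≠ 1 ∧
  (∀ c : Fq, c ≠ 0 → χ (Ideal.Quotient.mk (Ideal.span {h}) (Polynomial.C c)) = 1) ∧
  ∀ h' : Polynomial Fq, h'.Monic → h' ∣ h → h' ≠ h →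
    ¬ ∃ χ' : MulChar (Polynomial Fq ⧸ Ideal.span {h'}) ℂ,
      ∀ a : Polynomial Fq, IsCoprime a h →
        χ (Ideal.Quotient.mk (Ideal.span {h}) a) = χ' (Ideal.Quotient.mk (Ideal.span {h'}) a)

/-- The central value L_q(1/2, χ) = Σ_{f monic} χ(f) q^{−deg f/2} of the L-function of a
character χ modulo h of F_q[T] (a finite sum, as the coefficient sums vanish for
deg f ≥ deg h). -/
noncomputable def LhalfChar {Fq : Type*} [Field Fq] [Fintype Fq] (q : ℕ)
    (h : Polynomial Fq) (χ : MulChar (Polynomial Fq ⧸ Ideal.span {h}) ℂ) : ℂ :=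
  ∑' n : ℕ, (∑ᶠ f : Polynomial Fq,
      if f.Monic ∧ f.natDegree = n then χ (Ideal.Quotient.mk (Ideal.span {h}) f) else 0) *
    ((Real.sqrt q : ℂ))⁻¹ ^ n

/-- The central value L_q(1/2, χ_F) = Σ_{f ∈ F_q[T] monic} χ_F(f) q^{−deg f/2}, where
χ_F(f) is the cubic residue symbol of F_{q²}[T] restricted to F_q[T]. -/
noncomputable def LhalfSym (Fq : Type*) {Fq2 : Type*} [Field Fq] [Field Fq2]
    [Algebra Fq Fq2] (q : ℕ)
    (χsym : Polynomial Fq2 → Polynomial Fq2 → ℂ) (F : Polynomial Fq2) : ℂ :=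
  ∑' n : ℕ, (∑ᶠ f : Polynomial Fq,
      if f.Monic ∧ f.natDegree = n then χsym F (f.map (algebraMap Fq Fq2)) else 0) *
    ((Real.sqrt q : ℂ))⁻¹ ^ n

namespace CubicCharacters

open Polynomial

section FiniteField

variable {k : Type*} [Field k]

theorem monic_induction {p : ∀ F : k[X], F.Monic → Prop} (one : p 1 monic_one)
    (mul : ∀ (P F : k[X]) (hP : P.Monic) (_ : Irreducible P) (hF : F.Monic),
      p F hF → p (P * F) (hP.mul hF)) (F : k[X]) (hF : F.Monic) : p F hF := by
  induction hn : F.natDegree using Nat.strong_induction_on generalizing F with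
  | _ n ih =>
    by_cases h1 : F = 1
    · subst h1; exact one
    obtain ⟨P, hPm, hPi, G, rfl⟩ := F.exists_monic_irreducible_factor
      (fun h => h1 (hF.eq_one_of_isUnit h))
    have hG := hPm.of_mul_monic_left hF
    refine mul P G hPm hPi hG (ih _ ?_ G hG rfl)
    rw [← hn, hPm.natDegree_mul hG]
    have := hPi.natDegree_pos
    omega

theorem isCoprime_of_not_dvd {P a : k[X]} (hP : Irreducible P) (h : ¬ P ∣ a) : IsCoprime P a :=
  hP.coprime_iff_not_dvd.2 h

theorem isCoprime_of_ne {P Q : k[X]} (hP : P.Monic) (hQ : Q.Monic) (hPi : Irreducible P)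
    (hQi : Irreducible Q) (h : P ≠ Q) : IsCoprime P Q :=
  isCoprime_of_not_dvd hPi fun hd =>
    h (eq_of_monic_of_associated hP hQ (hPi.associated_of_dvd hQi hd))

/-- A character with values in the cube roots of unity kills elements of order prime to three. -/
theorem eq_one_of_pow_eq_one {z : ℂ} {n : ℕ} (h3 : z ^ 3 = 1) (hn : z ^ n = 1)
    (hc : ¬ 3 ∣ n) : z = 1 := by
  have h := orderOf_dvd_of_pow_eq_one h3
  have h' := orderOf_dvd_of_pow_eq_one hn
  rcases (Nat.dvd_prime Nat.prime_three).1 h with h1 | h1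
  · exact orderOf_eq_one_iff.1 h1
  · exact absurd (h1 ▸ h') hc

theorem dvd_of_forall_irreducible {F G : k[X]} (hF : F.Monic) (hs : Squarefree F)
    (h : ∀ P : k[X], P.Monic → Irreducible P → P ∣ F → P ∣ G) : F ∣ G := by
  induction F, hF using monic_induction with
  | one => exact one_dvd G
  | mul P F hPm hP hF ih =>
    obtain ⟨hco, -, hsF⟩ := squarefree_mul_iff.1 hs
    exact (isRelPrime_iff_isCoprime.1 hco).mul_dvd (h P hPm hP (dvd_mul_right _ _))
      (ih hsF fun R hRm hR hd => h R hRm hR (hd.mul_left P))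

theorem sq_mod_three {q : ℕ} (h : q % 3 = 2) : q ^ 2 % 3 = 1 := by
  rw [Nat.pow_mod, h]

variable [Fintype k]

theorem exists_residue_generator {P : k[X]} (hP : Irreducible P) :
    ∃ u : k[X], ¬ P ∣ u ∧ (∀ a, ¬ P ∣ a → ∃ n : ℕ, P ∣ a - u ^ n) ∧
      ∀ n : ℕ, P ∣ u ^ n - 1 ↔ (Fintype.card k ^ P.natDegree - 1) ∣ n := by
  have := Fact.mk hP
  have : Module.Finite k (AdjoinRoot P) := .of_basis (AdjoinRoot.powerBasis hP.ne_zero).basis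
  have : Finite (AdjoinRoot P) := Module.finite_of_finite k
  let _ : Fintype (AdjoinRoot P) := Fintype.ofFinite _
  have hcard : Fintype.card (AdjoinRoot P) = Fintype.card k ^ P.natDegree := by
    rw [Module.card_eq_pow_finrank (K := k), (AdjoinRoot.powerBasis hP.ne_zero).finrank,
      AdjoinRoot.powerBasis_dim]
  obtain ⟨v, hv⟩ := IsCyclic.exists_generator (α := (AdjoinRoot P)ˣ)
  obtain ⟨u, hu⟩ := AdjoinRoot.mk_surjective (v : AdjoinRoot P)
  refine ⟨u, ?_, ?_, ?_⟩
  · rw [← AdjoinRoot.mk_eq_zero, hu]; exact v.ne_zero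
  · intro a ha
    rw [← AdjoinRoot.mk_eq_zero] at ha
    obtain ⟨n, hn⟩ := (mem_powers_iff_mem_zpowers (x := v)).2 (hv (Units.mk0 _ ha))
    refine ⟨n, ?_⟩
    rw [← AdjoinRoot.mk_eq_zero, map_sub, map_pow, hu, sub_eq_zero]
    have := congrArg Units.val hn
    simpa using this.symm
  · intro n
    rw [← AdjoinRoot.mk_eq_zero, map_sub, map_pow, hu, sub_eq_zero, map_one, ← hcard,
      ← Fintype.card_units, ← Nat.card_eq_fintype_card, ← orderOf_eq_card_of_forall_mem_zpowers hv,
      orderOf_dvd_iff_pow_eq_one, ← Units.val_pow_eq_pow_val, Units.val_eq_one]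

theorem dvd_pow_card_sub_one {P a : k[X]} (hP : Irreducible P) (ha : ¬ P ∣ a) :
    P ∣ a ^ (Fintype.card k ^ P.natDegree - 1) - 1 := by
  obtain ⟨u, -, hgen, hord⟩ := exists_residue_generator hP
  obtain ⟨n, hn⟩ := hgen a ha
  have h1 := hn.trans (sub_dvd_pow_sub_pow a (u ^ n) (Fintype.card k ^ P.natDegree - 1))
  have h2 := (hord (n * (Fintype.card k ^ P.natDegree - 1))).2 (Dvd.intro_left _ rfl)
  rw [pow_mul] at h2
  simpa using dvd_add h1 h2

end FiniteField
section Symbol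

variable {k : Type*} [Field k] [Fintype k] {Q : ℕ} {Ω : rootsOfUnity 3 ℂ ≃* rootsOfUnity 3 k}
  {χ : k[X] → k[X] → ℂ}

theorem three_dvd_pow_sub_one (hQ : Q % 3 = 1) (d : ℕ) : 3 ∣ Q ^ d - 1 :=
  (Nat.modEq_iff_dvd' (Nat.one_le_pow _ _ (by omega))).1
    (by simpa using (Nat.ModEq.pow d (show Q ≡ 1 [MOD 3] from hQ)).symm)

theorem exists_ne_one_rootsOfUnity_three : ∃ α : rootsOfUnity 3 ℂ, α ≠ 1 := by
  have h := Complex.isPrimitiveRoot_exp 3 (by norm_num)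
  refine ⟨h.toRootsOfUnity, fun h1 => h.ne_one (by norm_num) ?_⟩
  have := congrArg (fun x : rootsOfUnity 3 ℂ => ((x : ℂˣ) : ℂ)) h1
  simpa using this

theorem rootsOfUnity_three_pow (K : Type*) [Field K] (α : rootsOfUnity 3 K) :
    ((α : Kˣ) : K) ^ 3 = 1 := by
  have := α.2
  rw [mem_rootsOfUnity] at this
  simpa using congrArg (Units.val) this

theorem sq_add_self_add_one {K : Type*} [Field K] {w : K} (h3 : w ^ 3 = 1) (h1 : w ≠ 1) :
    w ^ 2 + w + 1 = 0 := by
  have : (w - 1) * (w ^ 2 + w + 1) = 0 := by linear_combination h3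
  exact (mul_eq_zero.1 this).resolve_left (sub_ne_zero.2 h1)

theorem rootsOfUnity_three_ne_one (K : Type*) [Field K] {α : rootsOfUnity 3 K} (h : α ≠ 1) :
    ((α : Kˣ) : K) ≠ 1 :=
  fun h1 => h (Subtype.ext (Units.ext (by simpa using h1)))

theorem rootsOfUnity_three_sq_add (K : Type*) [Field K] {α : rootsOfUnity 3 K} (h : α ≠ 1) :
    ((α : Kˣ) : K) ^ 2 + ((α : Kˣ) : K) + 1 = 0 :=
  sq_add_self_add_one (rootsOfUnity_three_pow K α) (rootsOfUnity_three_ne_one K h)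

theorem exists_symbol_value (hcard : Fintype.card k = Q) (hQ : Q % 3 = 1)
    (Ω : rootsOfUnity 3 ℂ ≃* rootsOfUnity 3 k) {P a : k[X]}
    (hP : Irreducible P) (ha : ¬ P ∣ a) :
    ∃ α : rootsOfUnity 3 ℂ, P ∣ a ^ ((Q ^ P.natDegree - 1) / 3) - C ((Ω α : kˣ) : k) := by
  obtain ⟨α, hα⟩ := exists_ne_one_rootsOfUnity_three
  have hw := rootsOfUnity_three_sq_add k ((map_ne_one_iff Ω Ω.injective).2 hα)
  have hfermat := dvd_pow_card_sub_one hP ha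
  rw [hcard, ← Nat.div_mul_cancel (three_dvd_pow_sub_one hQ P.natDegree), pow_mul] at hfermat
  have hα2 : ((Ω (α ^ 2) : kˣ) : k) = ((Ω α : kˣ) : k) ^ 2 := by
    rw [map_pow]; push_cast; rfl
  set w : k := ((Ω α : kˣ) : k)
  set b := a ^ ((Q ^ P.natDegree - 1) / 3)
  have hwC : (C w : k[X]) ^ 2 + C w + 1 = 0 := by
    have := congrArg (C : k → k[X]) hw
    simpa using this
  have hfac : b ^ 3 - 1 = (b - 1) * ((b - C w) * (b - C w ^ 2)) := by
    linear_combination (b ^ 2 - b + (b - 1) * (1 - C w)) * hwC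
  rw [hfac] at hfermat
  rcases hP.prime.dvd_or_dvd hfermat with h | h
  · exact ⟨1, by simpa using h⟩
  rcases hP.prime.dvd_or_dvd h with h | h
  · exact ⟨α, h⟩
  · exact ⟨α ^ 2, by rwa [hα2, C_pow]⟩

theorem symbol_eq_zero_of_dvd (hχ : IsCubicSymbol Q Ω χ) {P a : k[X]} (hP : Irreducible P)
    (hd : P ∣ a) : χ P a = 0 :=
  hχ.1 P a fun h => hP.not_isUnit (h.isUnit_of_dvd hd)

theorem symbol_mul (hcard : Fintype.card k = Q) (hQ : Q % 3 = 1) (hχ : IsCubicSymbol Q Ω χ)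
    {F : k[X]} (hF : F.Monic) (a b : k[X]) : χ F (a * b) = χ F a * χ F b := by
  induction F, hF using monic_induction with
  | one => simp [hχ.2.1]
  | mul P F hPm hP hF ih =>
    rw [hχ.2.2.1 P F _ hPm hF, hχ.2.2.1 P F _ hPm hF, hχ.2.2.1 P F _ hPm hF, ih]
    suffices χ P (a * b) = χ P a * χ P b by rw [this]; ring
    by_cases ha : P ∣ a
    · rw [symbol_eq_zero_of_dvd hχ hP ha, symbol_eq_zero_of_dvd hχ hP (ha.mul_right b), zero_mul]
    by_cases hb : P ∣ b
    · rw [symbol_eq_zero_of_dvd hχ hP hb, symbol_eq_zero_of_dvd hχ hP (hb.mul_left a), mul_zero]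
    obtain ⟨α, hα⟩ := exists_symbol_value hcard hQ Ω hP ha
    obtain ⟨β, hβ⟩ := exists_symbol_value hcard hQ Ω hP hb
    rw [hχ.2.2.2 P a α hPm hP ha hα, hχ.2.2.2 P b β hPm hP hb hβ,
      hχ.2.2.2 P (a * b) (α * β) hPm hP (fun h => (hP.prime.dvd_or_dvd h).elim ha hb)]
    · simp
    · have : ((Ω (α * β) : kˣ) : k) = ((Ω α : kˣ) : k) * ((Ω β : kˣ) : k) := by
        rw [map_mul]; simp
      rw [this, C_mul, mul_pow]
      have := dvd_add (hα.mul_right (b ^ ((Q ^ P.natDegree - 1) / 3)))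
        (hβ.mul_left (C ((Ω α : kˣ) : k)))
      convert this using 1
      ring

theorem symbol_congr (hcard : Fintype.card k = Q) (hQ : Q % 3 = 1) (hχ : IsCubicSymbol Q Ω χ)
    {F : k[X]} (hF : F.Monic) {a b : k[X]} (hab : F ∣ a - b) : χ F a = χ F b := by
  induction F, hF using monic_induction with
  | one => simp [hχ.2.1]
  | mul P F hPm hP hF ih =>
    rw [hχ.2.2.1 P F _ hPm hF, hχ.2.2.1 P F _ hPm hF, ih ((Dvd.intro_left P rfl).trans hab)]
    congr 1
    have hPab : P ∣ a - b := (Dvd.intro F rfl).trans hab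
    by_cases ha : P ∣ a
    · rw [symbol_eq_zero_of_dvd hχ hP ha, symbol_eq_zero_of_dvd hχ hP ((dvd_iff_dvd_of_dvd_sub hPab).1 ha)]
    obtain ⟨α, hα⟩ := exists_symbol_value hcard hQ Ω hP ha
    rw [hχ.2.2.2 P a α hPm hP ha hα, hχ.2.2.2 P b α hPm hP
      (fun h => ha ((dvd_iff_dvd_of_dvd_sub hPab).2 h))]
    have := dvd_sub hα (hPab.trans (sub_dvd_pow_sub_pow a b ((Q ^ P.natDegree - 1) / 3)))
    simpa using this

theorem symbol_pow_three (hcard : Fintype.card k = Q) (hQ : Q % 3 = 1)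
    (hχ : IsCubicSymbol Q Ω χ) {F : k[X]} (hF : F.Monic) {a : k[X]} (ha : IsCoprime F a) :
    χ F a ^ 3 = 1 := by
  induction F, hF using monic_induction with
  | one => simp [hχ.2.1]
  | mul P F hPm hP hF ih =>
    rw [hχ.2.2.1 P F _ hPm hF, mul_pow, ih ha.of_mul_left_right, mul_one]
    have ha' : ¬ P ∣ a := hP.coprime_iff_not_dvd.1 ha.of_mul_left_left
    obtain ⟨α, hα⟩ := exists_symbol_value hcard hQ Ω hP ha'
    rw [hχ.2.2.2 P a α hPm hP ha' hα, rootsOfUnity_three_pow]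

theorem symbol_one (hcard : Fintype.card k = Q) (hQ : Q % 3 = 1)
    (hχ : IsCubicSymbol Q Ω χ) {F : k[X]} (hF : F.Monic) : χ F 1 = 1 := by
  have h := symbol_mul hcard hQ hχ hF 1 1
  have h3 := symbol_pow_three hcard hQ hχ hF (isCoprime_one_right (x := F))
  have h0 : χ F 1 ≠ 0 := fun h0 => by simp [h0] at h3
  rw [mul_one] at h
  exact mul_left_cancel₀ h0 (by rw [← h, mul_one])

theorem symbol_eq_one_of_dvd (hcard : Fintype.card k = Q) (hQ : Q % 3 = 1)
    (hχ : IsCubicSymbol Q Ω χ) {F : k[X]} (hF : F.Monic) {a : k[X]} (ha : F ∣ a - 1) :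
    χ F a = 1 :=
  (symbol_congr hcard hQ hχ hF ha).trans (symbol_one hcard hQ hχ hF)

theorem exists_symbol_ne_one (hcard : Fintype.card k = Q) (hQ : Q % 3 = 1)
    (hχ : IsCubicSymbol Q Ω χ) {P : k[X]} (hPm : P.Monic) (hP : Irreducible P) :
    ∃ u, ¬ P ∣ u ∧ χ P u ≠ 1 := by
  obtain ⟨u, hu, -, hord⟩ := exists_residue_generator hP
  refine ⟨u, hu, fun h1 => ?_⟩
  obtain ⟨α, hα⟩ := exists_symbol_value hcard hQ Ω hP hu
  have hα1 : α = 1 := by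
    rw [hχ.2.2.2 P u α hPm hP hu hα] at h1
    exact Subtype.ext (Units.ext (by simpa using h1))
  rw [hα1, map_one] at hα
  have hdvd := (hord _).1 (by simpa using hα)
  rw [hcard] at hdvd
  have h1Q : 1 < Q := hcard ▸ Fintype.one_lt_card
  have hpos : 1 < Q ^ P.natDegree := Nat.one_lt_pow hP.natDegree_pos.ne' h1Q
  have h3 := three_dvd_pow_sub_one hQ P.natDegree
  have := Nat.le_of_dvd (by omega) hdvd
  omega

end Symbol

section Conjugation

variable (K : Type*) {L : Type*} [Field K] [Field L] [Fintype K] [Algebra K L]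

/-- The action on `L[X]` of the Frobenius of `L` over `K`. -/
noncomputable def conj : L[X] →+* L[X] :=
  mapRingHom (FiniteField.frobeniusAlgHom K L : L →+* L)

variable {K}

theorem conj_C (x : L) : conj K (C x) = C (x ^ Fintype.card K) := by
  simp [conj]

theorem conj_map (a : K[X]) : conj K (a.map (algebraMap K L)) = a.map (algebraMap K L) := by
  simp only [conj, coe_mapRingHom, map_map]
  congr 1
  ext x
  simp

theorem monic_conj {F : L[X]} (hF : F.Monic) : (conj K F).Monic := hF.map _

theorem natDegree_conj (F : L[X]) : (conj K F).natDegree = F.natDegree :=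
  natDegree_map _

theorem conj_dvd_map (a : K[X]) {F : L[X]} (h : F ∣ a.map (algebraMap K L)) :
    conj K F ∣ a.map (algebraMap K L) := by
  simpa [conj_map] using map_dvd (conj K) h

theorem isCoprime_conj_map {F : L[X]} {a : K[X]} (h : IsCoprime F (a.map (algebraMap K L))) :
    IsCoprime (conj K F) (a.map (algebraMap K L)) := by
  simpa [conj_map] using h.map (conj K)

theorem isCoprime_norm_iff {h : K[X]} {F : L[X]} (hh : h.map (algebraMap K L) = F * conj K F)
    (a : K[X]) : IsCoprime a h ↔ IsCoprime F (a.map (algebraMap K L)) := by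
  rw [← isCoprime_map (algebraMap K L), hh]
  exact ⟨fun H => H.of_mul_right_left.symm,
    fun H => (H.symm).mul_right (isCoprime_conj_map H).symm⟩

variable [Fintype L]

theorem conj_conj (hL : Fintype.card L = Fintype.card K ^ 2) (F : L[X]) :
    conj K (conj K F) = F := by
  ext n
  simp only [conj, coe_mapRingHom, coeff_map, RingHom.coe_coe, FiniteField.coe_frobeniusAlgHom]
  rw [← pow_mul, ← pow_two, ← hL, FiniteField.pow_card]

theorem exists_algebraMap_eq_of_pow_card_eq {x : L} (hx : x ^ Fintype.card K = x) :
    ∃ y : K, algebraMap K L y = x := by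
  have : x ∈ (⊥ : IntermediateField K L) := by
    rw [IsGalois.mem_bot_iff_fixed]
    intro f
    obtain ⟨n, rfl⟩ := (FiniteField.bijective_frobeniusAlgEquivOfAlgebraic_pow K L).2 f
    simp only [AlgEquiv.coe_pow]
    exact Function.iterate_fixed hx _
  exact IntermediateField.mem_bot.1 this

theorem exists_map_eq_of_conj_eq {F : L[X]} (hF : conj K F = F) :
    ∃ H : K[X], H.map (algebraMap K L) = F := by
  rw [← mem_lifts, lifts_iff_coeff_lifts]
  intro n
  have := congrArg (fun G => coeff G n) hF
  simp only [conj, coe_mapRingHom, coeff_map, RingHom.coe_coe,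
    FiniteField.coe_frobeniusAlgHom] at this
  exact exists_algebraMap_eq_of_pow_card_eq this

theorem conj_dvd_comm (hL : Fintype.card L = Fintype.card K ^ 2) {F G : L[X]} :
    conj K F ∣ G ↔ F ∣ conj K G :=
  ⟨fun h => by simpa [conj_conj hL] using map_dvd (conj K) h,
    fun h => by simpa [conj_conj hL] using map_dvd (conj K) h⟩

theorem isCoprime_conj_comm (hL : Fintype.card L = Fintype.card K ^ 2) {F G : L[X]} :
    IsCoprime (conj K F) G ↔ IsCoprime F (conj K G) :=
  ⟨fun h => by simpa [conj_conj hL] using h.map (conj K),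
    fun h => by simpa [conj_conj hL] using h.map (conj K)⟩

theorem irreducible_conj (hL : Fintype.card L = Fintype.card K ^ 2) {P : L[X]}
    (hP : Irreducible P) : Irreducible (conj K P) := by
  let e : L[X] ≃+* L[X] := RingEquiv.ofRingHom (conj K) (conj K)
    (RingHom.ext (conj_conj hL)) (RingHom.ext (conj_conj hL))
  exact (MulEquiv.irreducible_iff e).2 hP

theorem exists_norm (hL : Fintype.card L = Fintype.card K ^ 2) {F : L[X]} (hF : F.Monic) :
    ∃ h : K[X], h.Monic ∧ h.map (algebraMap K L) = F * conj K F := by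
  obtain ⟨h, hh⟩ := exists_map_eq_of_conj_eq (K := K) (F := F * conj K F)
    (by rw [map_mul, conj_conj hL, mul_comm])
  exact ⟨h, (monic_map_iff (f := algebraMap K L)).1 (hh ▸ hF.mul (monic_conj hF)), hh⟩

theorem map_eq_of_dvd_map {Q : K[X]} (hQm : Q.Monic) (hQ : Irreducible Q) {G : L[X]}
    (hG : G.Monic) (hconj : conj K G = G) (hne : G ≠ 1) (hd : G ∣ Q.map (algebraMap K L)) :
    Q.map (algebraMap K L) = G := by
  obtain ⟨R, rfl⟩ := exists_map_eq_of_conj_eq hconj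
  have hR := (monic_map_iff (f := algebraMap K L)).1 hG
  obtain ⟨S, rfl⟩ := (map_dvd_map' (algebraMap K L)).1 hd
  have hS := hR.of_mul_monic_left hQm
  rcases hQ.isUnit_or_isUnit rfl with h | h
  · exact absurd (by rw [hR.eq_one_of_isUnit h, Polynomial.map_one]) hne
  · rw [hS.eq_one_of_isUnit h, mul_one]

/-- A monic irreducible of `K[X]` is inert or split in `L[X]`. -/
theorem inert_or_split (hL : Fintype.card L = Fintype.card K ^ 2) {Q : K[X]} (hQm : Q.Monic)
    (hQ : Irreducible Q) : Irreducible (Q.map (algebraMap K L)) ∨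
      ∃ P : L[X], P.Monic ∧ Irreducible P ∧ IsCoprime P (conj K P) ∧
        Q.map (algebraMap K L) = P * conj K P := by
  obtain ⟨P, hPm, hP, hd⟩ := (Q.map (algebraMap K L)).exists_monic_irreducible_factor
    (fun h => hQ.not_isUnit ((isUnit_map (algebraMap K L)).1 h))
  by_cases hc : conj K P = P
  · left
    rwa [map_eq_of_dvd_map hQm hQ hPm hc hP.ne_one hd]
  · right
    have hco := isCoprime_of_ne hPm (monic_conj hPm) hP (irreducible_conj hL hP) (Ne.symm hc)
    refine ⟨P, hPm, hP, hco, map_eq_of_dvd_map hQm hQ (hPm.mul (monic_conj hPm)) ?_ ?_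
      (hco.mul_dvd hd (conj_dvd_map Q hd))⟩
    · rw [map_mul, conj_conj hL, mul_comm]
    · exact fun h => hP.not_isUnit (.of_mul_eq_one _ h)

/-- Every residue modulo `P` is represented by a polynomial over `K` congruent to `1` modulo
a given `m`, when `P` is prime to its conjugate and to `m`. -/
theorem exists_map_congr (hL : Fintype.card L = Fintype.card K ^ 2) {P : L[X]} {m : K[X]}
    (hP : IsCoprime P (conj K P)) (hm : IsCoprime P (m.map (algebraMap K L))) (b : L[X]) :
    ∃ a : K[X], P ∣ a.map (algebraMap K L) - b ∧ m ∣ a - 1 := by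
  obtain ⟨u, v, huv⟩ := hP.mul_right hm
  set c := v * (conj K P * m.map (algebraMap K L)) * (b - 1) with hc
  obtain ⟨a, ha⟩ := exists_map_eq_of_conj_eq (K := K) (F := 1 + (c + conj K c))
    (by simp only [map_add, map_one, conj_conj hL]; ring)
  have hcc : conj K c = conj K v * (P * m.map (algebraMap K L)) * (conj K b - 1) := by
    simp [hc, conj_conj hL, conj_map]
  refine ⟨a, ⟨conj K v * m.map (algebraMap K L) * (conj K b - 1) - u * (b - 1), ?_⟩, ?_⟩
  · rw [ha, hcc, hc]
    linear_combination (b - 1) * huv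
  · rw [← map_dvd_map' (algebraMap K L), Polynomial.map_sub, ha, Polynomial.map_one, hcc]
    exact ⟨v * conj K P * (b - 1) + conj K v * P * (conj K b - 1), by rw [hc]; ring⟩

theorem symbol_conj {Ω : rootsOfUnity 3 ℂ ≃* rootsOfUnity 3 L} {χ : L[X] → L[X] → ℂ}
    (hL : Fintype.card L = Fintype.card K ^ 2) (h3 : Fintype.card K % 3 = 2)
    (hχ : IsCubicSymbol (Fintype.card K ^ 2) Ω χ) {P : L[X]} (hPm : P.Monic)
    (hP : Irreducible P) (a : K[X]) :
    χ (conj K P) (a.map (algebraMap K L)) = χ P (a.map (algebraMap K L)) ^ 2 := by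
  by_cases hd : P ∣ a.map (algebraMap K L)
  · rw [symbol_eq_zero_of_dvd hχ hP hd,
      symbol_eq_zero_of_dvd hχ (irreducible_conj hL hP) (conj_dvd_map a hd)]
    simp
  obtain ⟨α, hα⟩ := exists_symbol_value hL (sq_mod_three h3) Ω hP hd
  rw [hχ.2.2.2 P _ α hPm hP hd hα, hχ.2.2.2 (conj K P) _ (α ^ 2) (monic_conj hPm)
    (irreducible_conj hL hP) (fun h => hd (by rwa [conj_dvd_comm hL, conj_map] at h))]
  · simp
  · have hα2 : ((Ω (α ^ 2) : Lˣ) : L) = ((Ω α : Lˣ) : L) ^ 2 := by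
      rw [map_pow]; push_cast; rfl
    have hw : ((Ω α : Lˣ) : L) ^ Fintype.card K = ((Ω α : Lˣ) : L) ^ 2 := by
      rw [← Nat.div_add_mod (Fintype.card K) 3, h3, pow_add, pow_mul, rootsOfUnity_three_pow,
        one_pow, one_mul]
    have := map_dvd (conj K) hα
    rwa [map_sub, map_pow, conj_map, conj_C, hw, ← hα2, ← natDegree_conj (K := K) P] at this

end Conjugation

section SplitPolynomials

variable (K : Type*) {L : Type*} [Field K] [Field L] [Fintype K] [Algebra K L]

/-- Monic squarefree polynomials prime to their conjugate. -/
structure IsSplit (F : L[X]) : Prop where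
  monic : F.Monic
  squarefree : Squarefree F
  isCoprime : IsCoprime F (conj K F)

variable {K}

theorem isSplit_one : IsSplit K (1 : L[X]) :=
  ⟨monic_one, squarefree_one, isCoprime_one_left⟩

theorem IsSplit.of_dvd {F G : L[X]} (hF : IsSplit K F) (hG : G.Monic) (hd : G ∣ F) :
    IsSplit K G :=
  ⟨hG, hF.squarefree.squarefree_of_dvd hd,
    (hF.isCoprime.of_isCoprime_of_dvd_left hd).of_isCoprime_of_dvd_right (map_dvd (conj K) hd)⟩

/-- A prime factor of a split polynomial is prime to the norm of the cofactor. -/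
theorem IsSplit.isCoprime_norm {P F : L[X]} {m : K[X]} (h : IsSplit K (P * F))
    (hm : m.map (algebraMap K L) = F * conj K F) : IsCoprime P (m.map (algebraMap K L)) := by
  rw [hm]
  refine IsCoprime.mul_right (isRelPrime_iff_isCoprime.1 (squarefree_mul_iff.1 h.squarefree).1) ?_
  have := h.isCoprime.of_mul_left_left
  rw [map_mul] at this
  exact this.of_mul_right_right

variable [Fintype L]

theorem goodF_iff (hL : Fintype.card L = Fintype.card K ^ 2) {g : ℕ} {F : L[X]} :
    GoodF K g F ↔ IsSplit K F ∧ F.natDegree = g / 2 + 1 := by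
  refine ⟨fun ⟨hm, hs, hd, hP⟩ => ⟨⟨hm, hs, ?_⟩, hd⟩, fun ⟨h, hd⟩ => ⟨h.monic, h.squarefree, hd, ?_⟩⟩
  · have key : ∀ G : L[X], G.Monic → G ≠ 1 → conj K G = G → ¬ G ∣ F := by
      intro G hG hne hc hGF
      obtain ⟨R, rfl⟩ := exists_map_eq_of_conj_eq hc
      have hR := (monic_map_iff (f := algebraMap K L)).1 hG
      obtain ⟨S, hSm, hS, hd⟩ := R.exists_monic_irreducible_factor
        (fun h => hne (by rw [hR.eq_one_of_isUnit h, Polynomial.map_one]))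
      exact hP S hSm hS (((map_dvd_map' _).2 hd).trans hGF)
    refine isCoprime_of_irreducible_dvd (fun h => hm.ne_zero h.1) fun z hz hzF hzF' => ?_
    obtain ⟨P, hPm, hPi, hPz⟩ := z.exists_monic_irreducible_factor hz.not_isUnit
    have h1 := hPz.trans hzF
    have h2 : conj K P ∣ F := (conj_dvd_comm hL).2 (hPz.trans hzF')
    by_cases hc : conj K P = P
    · exact key P hPm hPi.ne_one hc h1
    · refine key (P * conj K P) (hPm.mul (monic_conj hPm))
        (fun h => hPi.not_isUnit (.of_mul_eq_one _ h))
        (by rw [map_mul, conj_conj hL, mul_comm]) (IsCoprime.mul_dvd ?_ h1 h2)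
      exact isCoprime_of_ne hPm (monic_conj hPm) hPi (irreducible_conj hL hPi) (Ne.symm hc)
  · intro P _ hP hPF
    have h2 := map_dvd (conj K) hPF
    rw [conj_map] at h2
    exact hP.not_isUnit ((isUnit_map (algebraMap K L)).1 (h.isCoprime.isUnit_of_dvd' hPF h2))

variable {Ω : rootsOfUnity 3 ℂ ≃* rootsOfUnity 3 L} {χ : L[X] → L[X] → ℂ}

theorem exists_symbol_ne_one_of_congr (hL : Fintype.card L = Fintype.card K ^ 2)
    (h3 : Fintype.card K % 3 = 2) (hχ : IsCubicSymbol (Fintype.card K ^ 2) Ω χ) {P : L[X]}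
    {m : K[X]} (hPm : P.Monic) (hPi : Irreducible P) (hP : IsCoprime P (conj K P))
    (hm : IsCoprime P (m.map (algebraMap K L))) :
    ∃ a : K[X], m ∣ a - 1 ∧ ¬ P ∣ a.map (algebraMap K L) ∧ χ P (a.map (algebraMap K L)) ≠ 1 := by
  obtain ⟨u, hu, hu1⟩ := exists_symbol_ne_one hL (sq_mod_three h3) hχ hPm hPi
  obtain ⟨a, ha, ham⟩ := exists_map_congr hL hP hm u
  refine ⟨a, ham, fun h => hu ((dvd_iff_dvd_of_dvd_sub ha).1 h), ?_⟩
  rwa [symbol_congr hL (sq_mod_three h3) hχ hPm ha]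

theorem symbol_eq_one_of_norm_dvd (hL : Fintype.card L = Fintype.card K ^ 2)
    (h3 : Fintype.card K % 3 = 2) (hχ : IsCubicSymbol (Fintype.card K ^ 2) Ω χ) {F : L[X]}
    (hF : F.Monic) {m a : K[X]} (hm : F ∣ m.map (algebraMap K L)) (ha : m ∣ a - 1) :
    χ F (a.map (algebraMap K L)) = 1 := by
  refine symbol_eq_one_of_dvd hL (sq_mod_three h3) hχ hF (hm.trans ?_)
  simpa using (map_dvd_map' (algebraMap K L)).2 ha

/-- A split polynomial is determined by the restriction of its symbol to `K[X]`. -/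
theorem dvd_of_symbol_eq (hL : Fintype.card L = Fintype.card K ^ 2)
    (h3 : Fintype.card K % 3 = 2) (hχ : IsCubicSymbol (Fintype.card K ^ 2) Ω χ) {F G : L[X]}
    (hF : IsSplit K F) (hG : IsSplit K G)
    (h : ∀ a : K[X], χ F (a.map (algebraMap K L)) = χ G (a.map (algebraMap K L))) : F ∣ G := by
  refine dvd_of_forall_irreducible hF.monic hF.squarefree fun P hPm hP hPF => ?_
  by_contra hPG
  obtain ⟨F', rfl⟩ := hPF
  have hF' := hPm.of_mul_monic_left hF.monic
  obtain ⟨m, -, hm⟩ := exists_norm hL hF'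
  have hco : IsCoprime P (conj K P) := (hF.of_dvd hPm (dvd_mul_right _ _)).isCoprime
  have hPm' := hF.isCoprime_norm hm
  have hcm := monic_conj (K := K) hPm
  have hci := irreducible_conj hL hP
  obtain ⟨G', hG', hGP, hval⟩ : ∃ G' : L[X], G'.Monic ∧ (IsCoprime P (G' * conj K G')) ∧
      (G = G' ∨ G = conj K P * G') := by
    by_cases hd : conj K P ∣ G
    · obtain ⟨G', rfl⟩ := hd
      have hG' := hcm.of_mul_monic_left hG.monic
      obtain ⟨n, -, hn⟩ := exists_norm hL hG'
      refine ⟨G', hG', ?_, Or.inr rfl⟩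
      rw [← hn]
      simpa [conj_conj hL] using isCoprime_conj_map (hG.isCoprime_norm hn)
    · refine ⟨G, hG.monic, (isCoprime_of_not_dvd hP hPG).mul_right ?_, Or.inl rfl⟩
      exact (isCoprime_conj_comm hL).1 (isCoprime_of_not_dvd hci hd)
  obtain ⟨n, -, hn⟩ := exists_norm hL hG'
  rw [← hn] at hGP
  obtain ⟨a, ha, haP, ha1⟩ := exists_symbol_ne_one_of_congr hL h3 hχ (m := m * n) hPm hP hco
    (by rw [Polynomial.map_mul]; exact hPm'.mul_right hGP)
  have hFa : χ F' (a.map (algebraMap K L)) = 1 := symbol_eq_one_of_norm_dvd hL h3 hχ hF'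
    (hm ▸ dvd_mul_right _ _) ((dvd_mul_right _ _).trans ha)
  have hGa : χ G' (a.map (algebraMap K L)) = 1 := symbol_eq_one_of_norm_dvd hL h3 hχ hG'
    (hn ▸ dvd_mul_right _ _) ((dvd_mul_left _ _).trans ha)
  have hh := h a
  rw [hχ.2.2.1 P F' _ hPm hF', hFa, mul_one] at hh
  rcases hval with rfl | rfl
  · exact ha1 (hh.trans hGa)
  · rw [hχ.2.2.1 _ G' _ hcm hG', hGa, mul_one, symbol_conj hL h3 hχ hPm hP] at hh
    have hc3 := symbol_pow_three hL (sq_mod_three h3) hχ hPm (isCoprime_of_not_dvd hP haP)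
    have h0 : χ P (a.map (algebraMap K L)) ≠ 0 := fun h0 => by simp [h0] at hc3
    exact ha1 (mul_left_cancel₀ h0 (by rw [mul_one, ← pow_two, ← hh]))

/-- The restricted symbol of a split polynomial does not factor through a proper divisor of
its norm. -/
theorem exists_symbol_ne_one_of_proper_dvd (hL : Fintype.card L = Fintype.card K ^ 2)
    (h3 : Fintype.card K % 3 = 2) (hχ : IsCubicSymbol (Fintype.card K ^ 2) Ω χ) {F : L[X]}
    (hF : IsSplit K F) {h h' : K[X]} (hm : h.Monic)
    (hh : h.map (algebraMap K L) = F * conj K F) (hm' : h'.Monic) (hd : h' ∣ h) (hne : h' ≠ h) :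
    ∃ a : K[X], IsCoprime a h ∧ h' ∣ a - 1 ∧ χ F (a.map (algebraMap K L)) ≠ 1 := by
  obtain ⟨k, rfl⟩ := hd
  have hk := hm'.of_mul_monic_left hm
  have hk1 : k ≠ 1 := fun h1 => hne (by rw [h1, mul_one])
  obtain ⟨P, hPm, hP, hPF, hPk⟩ : ∃ P : L[X], P.Monic ∧ Irreducible P ∧ P ∣ F ∧
      P ∣ k.map (algebraMap K L) := by
    obtain ⟨P, hPm, hP, hPk⟩ := (k.map (algebraMap K L)).exists_monic_irreducible_factor
      (fun h => hk1 (hk.eq_one_of_isUnit ((isUnit_map (algebraMap K L)).1 h)))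
    have : P ∣ F * conj K F := by
      rw [← hh, Polynomial.map_mul]; exact hPk.mul_left _
    rcases hP.prime.dvd_or_dvd this with h1 | h1
    · exact ⟨P, hPm, hP, h1, hPk⟩
    · exact ⟨conj K P, monic_conj hPm, irreducible_conj hL hP, (conj_dvd_comm hL).2 h1,
        conj_dvd_map k hPk⟩
  obtain ⟨F', rfl⟩ := hPF
  have hF' := hPm.of_mul_monic_left hF.monic
  obtain ⟨m, -, hnm⟩ := exists_norm hL hF'
  have hco : IsCoprime P (conj K P) := (hF.of_dvd hPm (dvd_mul_right _ _)).isCoprime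
  obtain ⟨a, ha, haP, ha1⟩ := exists_symbol_ne_one_of_congr hL h3 hχ hPm hP hco
    (hF.isCoprime_norm hnm)
  have hdvd : h' ∣ m := by
    obtain ⟨l, hl⟩ := hco.mul_dvd hPk (conj_dvd_map k hPk)
    rw [← map_dvd_map' (algebraMap K L), hnm]
    refine ⟨l, mul_left_cancel₀ (hPm.mul (monic_conj (K := K) hPm)).ne_zero ?_⟩
    rw [Polynomial.map_mul, hl, map_mul] at hh
    linear_combination -hh
  have hF'a : F' ∣ a.map (algebraMap K L) - 1 := by
    refine Dvd.dvd.trans (hnm ▸ dvd_mul_right _ _) (b := m.map (algebraMap K L)) ?_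
    simpa using (map_dvd_map' (algebraMap K L)).2 ha
  refine ⟨a, (isCoprime_norm_iff hh a).2 ?_, hdvd.trans ha, ?_⟩
  · refine (isCoprime_of_not_dvd hP haP).mul_left ?_
    obtain ⟨c, hc⟩ := hF'a
    exact ⟨-c, 1, by linear_combination hc⟩
  · rwa [hχ.2.2.1 P F' _ hPm hF',
      symbol_eq_one_of_dvd hL (sq_mod_three h3) hχ hF' hF'a, mul_one]

end SplitPolynomials

section Classification

variable {K L : Type*} [Field K] [Field L]

/-- Functions on `K[X]` inducing a character of the units modulo `h` with values in the cube
roots of unity. -/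
structure IsCubicMod (h : K[X]) (ψ : K[X] → ℂ) : Prop where
  congr : ∀ a b, h ∣ a - b → ψ a = ψ b
  mul : ∀ a b, IsCoprime a h → IsCoprime b h → ψ (a * b) = ψ a * ψ b
  cube : ∀ a, IsCoprime a h → ψ a ^ 3 = 1

theorem isCoprime_of_dvd_sub {a b h : K[X]} (hab : h ∣ a - b) (hb : IsCoprime b h) :
    IsCoprime a h := by
  obtain ⟨c, hc⟩ := hab
  rw [show a = b + c * h by linear_combination hc]
  exact hb.add_mul_right_left c

theorem IsCubicMod.ne_zero {h : K[X]} {ψ : K[X] → ℂ} (H : IsCubicMod h ψ) {a : K[X]}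
    (ha : IsCoprime a h) : ψ a ≠ 0 := fun h0 => by
  simpa [h0] using H.cube a ha

theorem IsCubicMod.one {h : K[X]} {ψ : K[X] → ℂ} (H : IsCubicMod h ψ) : ψ 1 = 1 := by
  have h1 := H.mul 1 1 isCoprime_one_left isCoprime_one_left
  exact mul_left_cancel₀ (H.ne_zero isCoprime_one_left) (by rw [← h1, mul_one, mul_one])

theorem IsCubicMod.pow {h : K[X]} {ψ : K[X] → ℂ} (H : IsCubicMod h ψ) {a : K[X]}
    (ha : IsCoprime a h) (n : ℕ) : ψ (a ^ n) = ψ a ^ n := by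
  induction n with
  | zero => simpa using H.one
  | succ n ih => rw [pow_succ, H.mul _ _ (ha.pow_left) ha, ih, pow_succ]

theorem IsCubicMod.component {A B e e' : K[X]} {ψ : K[X] → ℂ} (H : IsCubicMod (A * B) ψ)
    (he : e + e' = 1) (hA : A ∣ e') (hB : B ∣ e) : IsCubicMod A (fun a => ψ (a * e + e')) := by
  have hcop : ∀ a, IsCoprime a A → IsCoprime (a * e + e') (A * B) := by
    intro a ha
    refine IsCoprime.mul_right (isCoprime_of_dvd_sub ?_ ha)
      (isCoprime_of_dvd_sub (b := 1) ?_ isCoprime_one_left)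
    · exact hA.trans ⟨1 - a, by linear_combination a * he⟩
    · exact hB.trans ⟨a - 1, by linear_combination he⟩
  refine ⟨fun a b hab => H.congr _ _ ?_, fun a b ha hb => ?_, fun a ha => H.cube _ (hcop a ha)⟩
  · rw [show a * e + e' - (b * e + e') = (a - b) * e by ring]
    exact mul_dvd_mul hab hB
  · rw [← H.mul _ _ (hcop a ha) (hcop b hb)]
    refine H.congr _ _ ((mul_dvd_mul hA hB).trans ⟨a * b - a - b + 1, ?_⟩)
    linear_combination (-(a * b * e) - e') * he

theorem IsCubicMod.eq_mul_components {A B e e' : K[X]} {ψ : K[X] → ℂ}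
    (H : IsCubicMod (A * B) ψ) (he : e + e' = 1) (hA : A ∣ e') (hB : B ∣ e) {a : K[X]}
    (ha : IsCoprime a (A * B)) : ψ a = ψ (a * e + e') * ψ (a * e' + e) := by
  have h1 : IsCoprime (a * e + e') (A * B) := by
    refine IsCoprime.mul_right (isCoprime_of_dvd_sub ?_ ha.of_mul_right_left)
      (isCoprime_of_dvd_sub (b := 1) ?_ isCoprime_one_left)
    · exact hA.trans ⟨1 - a, by linear_combination a * he⟩
    · exact hB.trans ⟨a - 1, by linear_combination he⟩
  have h2 : IsCoprime (a * e' + e) (A * B) := by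
    refine IsCoprime.mul_right (isCoprime_of_dvd_sub (b := 1) ?_ isCoprime_one_left)
      (isCoprime_of_dvd_sub ?_ ha.of_mul_right_right)
    · exact hA.trans ⟨a - 1, by linear_combination he⟩
    · exact hB.trans ⟨1 - a, by linear_combination a * he⟩
  rw [← H.mul _ _ h1 h2]
  refine H.congr _ _ ((mul_dvd_mul hA hB).trans ⟨-(a - 1) ^ 2, ?_⟩)
  linear_combination (-a * (e + e') - a) * he

variable [Fintype K]

theorem IsCubicMod.eq_of_dvd_sub (h3 : Fintype.card K % 3 = 2) {Q : K[X]} {n : ℕ}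
    {ψ : K[X] → ℂ} (H : IsCubicMod (Q ^ n) ψ) {a b : K[X]} (ha : IsCoprime a (Q ^ n))
    (hb : IsCoprime b (Q ^ n)) (hab : Q ∣ a - b) : ψ a = ψ b := by
  obtain ⟨p, hp⟩ := CharP.exists K
  have hprime : p.Prime := CharP.char_is_prime K p
  have := Fact.mk hprime
  obtain ⟨f, -, hf⟩ := FiniteField.card K p
  have hpow : ψ a ^ Fintype.card K ^ n = ψ b ^ Fintype.card K ^ n := by
    rw [← H.pow ha, ← H.pow hb]
    refine H.congr _ _ ?_
    have : (a - b) ^ Fintype.card K ^ n = a ^ Fintype.card K ^ n - b ^ Fintype.card K ^ n := by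
      rw [hf, ← pow_mul]
      exact sub_pow_char_pow _ _ _
    rw [← this]
    exact (pow_dvd_pow _ (Nat.lt_pow_self Fintype.one_lt_card).le).trans (pow_dvd_pow_of_dvd hab _)
  have hb0 := H.ne_zero hb
  have : ψ a / ψ b = 1 := by
    refine eq_one_of_pow_eq_one ?_ (n := Fintype.card K ^ n) ?_ (fun h => ?_)
    · rw [div_pow, H.cube a ha, H.cube b hb, div_one]
    · rw [div_pow, hpow, div_self (pow_ne_zero _ hb0)]
    · have := Nat.prime_three.dvd_of_dvd_pow h
      omega
  exact (div_eq_one_iff_eq hb0).1 this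

variable [Algebra K L]

/-- The residue field of an inert prime has no primitive cube root of unity. -/
theorem not_three_dvd_of_inert (h3 : Fintype.card K % 3 = 2)
    (Ω : rootsOfUnity 3 ℂ ≃* rootsOfUnity 3 L) {Q : K[X]} (hQ : Irreducible Q)
    (hQL : Irreducible (Q.map (algebraMap K L))) :
    ¬ 3 ∣ Fintype.card K ^ Q.natDegree - 1 := by
  rintro ⟨N, hN⟩
  obtain ⟨u, -, -, hord⟩ := exists_residue_generator hQ
  have hpos : 1 < Fintype.card K ^ Q.natDegree :=
    Nat.one_lt_pow hQ.natDegree_pos.ne' Fintype.one_lt_card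
  have h1 : ¬ Q ∣ u ^ N - 1 := fun h => by
    have := Nat.le_of_dvd (by omega) ((hord N).1 h)
    omega
  have h2 : Q ∣ u ^ (N * 3) - 1 := (hord _).2 (by rw [hN, mul_comm])
  rw [pow_mul] at h2
  set w := u ^ N
  rw [show w ^ 3 - 1 = (w - 1) * (w ^ 2 + w + 1) by ring] at h2
  have hw := (hQ.prime.dvd_or_dvd h2).resolve_left h1
  obtain ⟨α, hα⟩ := exists_ne_one_rootsOfUnity_three
  have hα' := (map_ne_one_iff Ω Ω.injective).2 hα
  have key : ∀ z : L, z ^ 3 = 1 → z ≠ 1 →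
      ¬ Q.map (algebraMap K L) ∣ w.map (algebraMap K L) - C z := by
    intro z hz hz1 hd
    have hd' := map_dvd (conj K) hd
    have hzq : z ^ Fintype.card K = z ^ 2 := by
      rw [← Nat.div_add_mod (Fintype.card K) 3, h3, pow_add, pow_mul, hz, one_pow, one_mul]
    rw [map_sub, conj_map, conj_map, conj_C, hzq] at hd'
    have hdd := dvd_sub hd' hd
    rw [sub_sub_sub_cancel_left, ← C_sub] at hdd
    refine hQL.not_isUnit (isUnit_of_dvd_unit hdd (isUnit_C.2 (IsUnit.mk0 _ fun h0 => hz1 ?_)))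
    have hz0 : z ≠ 0 := fun h => by simp [h] at hz
    exact mul_left_cancel₀ hz0 (by linear_combination -h0)
  set z : L := ((Ω α : Lˣ) : L)
  have hz3 : z ^ 3 = 1 := rootsOfUnity_three_pow L _
  have hz2 : z ^ 2 + z + 1 = 0 := rootsOfUnity_three_sq_add L hα'
  have hz1 : z ≠ 1 := rootsOfUnity_three_ne_one L hα'
  have hzC : (C z : L[X]) ^ 2 + C z + 1 = 0 := by simpa using congrArg (C : L → L[X]) hz2
  have hd := (map_dvd_map' (algebraMap K L)).2 hw
  have hfac : (w ^ 2 + w + 1).map (algebraMap K L) =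
      (w.map (algebraMap K L) - C z) * (w.map (algebraMap K L) - C (z ^ 2)) := by
    simp only [Polynomial.map_add, Polynomial.map_pow, Polynomial.map_one, C_pow]
    linear_combination (w.map (algebraMap K L) - C z + 1) * hzC
  rw [hfac] at hd
  rcases hQL.prime.dvd_or_dvd hd with h | h
  · exact key z hz3 hz1 h
  · refine key (z ^ 2) (by rw [← pow_mul, mul_comm, pow_mul, hz3, one_pow]) (fun h => hz1 ?_) h
    linear_combination hz3 - z * h

variable [Fintype L]

variable {Ω : rootsOfUnity 3 ℂ ≃* rootsOfUnity 3 L} {χ : L[X] → L[X] → ℂ}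

/-- Cubic characters modulo a power of a prime are trivial or residue symbols. -/
theorem IsCubicMod.exists_symbol_of_prime_pow (hL : Fintype.card L = Fintype.card K ^ 2)
    (h3 : Fintype.card K % 3 = 2) (hχ : IsCubicSymbol (Fintype.card K ^ 2) Ω χ)
    {Q : K[X]} (hQm : Q.Monic) (hQ : Irreducible Q) {n : ℕ} {ψ : K[X] → ℂ}
    (H : IsCubicMod (Q ^ n) ψ) :
    (∀ a, IsCoprime a Q → ψ a = 1) ∨ ∃ P : L[X], P.Monic ∧ Irreducible P ∧
      IsCoprime P (conj K P) ∧ Q.map (algebraMap K L) = P * conj K P ∧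
      ∀ a, IsCoprime a Q → ψ a = χ P (a.map (algebraMap K L)) := by
  have hcop : ∀ {a}, ¬ Q ∣ a → IsCoprime a (Q ^ n) := fun h =>
    (isCoprime_of_not_dvd hQ h).symm.pow_right
  have hnd : ∀ {a}, IsCoprime a Q → ¬ Q ∣ a := fun h => hQ.coprime_iff_not_dvd.1 h.symm
  rcases inert_or_split hL hQm hQ with hin | ⟨P, hPm, hP, hco, hQP⟩
  · left
    intro a ha
    have hca := hcop (hnd ha)
    refine eq_one_of_pow_eq_one (H.cube a hca) ?_ (not_three_dvd_of_inert h3 Ω hQ hin)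
    rw [← H.pow hca, H.eq_of_dvd_sub h3 hca.pow_left isCoprime_one_left
      (dvd_pow_card_sub_one hQ (hnd ha)), H.one]
  obtain ⟨u, hu, hgen, -⟩ := exists_residue_generator hQ
  have hcu := hcop hu
  have hψ : ∀ a, IsCoprime a Q → ∃ i : ℕ, Q ∣ a - u ^ i ∧ ψ a = ψ u ^ i := by
    intro a ha
    obtain ⟨i, hi⟩ := hgen a (hnd ha)
    exact ⟨i, hi, (H.eq_of_dvd_sub h3 (hcop (hnd ha)) hcu.pow_left hi).trans (H.pow hcu i)⟩
  have hPQ : P ∣ Q.map (algebraMap K L) := hQP ▸ dvd_mul_right _ _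
  have hmap : ∀ i : ℕ, χ P ((u ^ i).map (algebraMap K L)) = χ P (u.map (algebraMap K L)) ^ i := by
    intro i
    induction i with
    | zero => simpa using symbol_one hL (sq_mod_three h3) hχ hPm
    | succ i ih =>
      rw [pow_succ, Polynomial.map_mul, symbol_mul hL (sq_mod_three h3) hχ hPm, ih, pow_succ]
  have hsym : ∀ {a : K[X]} {i : ℕ}, Q ∣ a - u ^ i →
      χ P (a.map (algebraMap K L)) = χ P (u.map (algebraMap K L)) ^ i := by
    intro a i hi
    rw [← hmap]
    refine symbol_congr hL (sq_mod_three h3) hχ hPm (hPQ.trans ?_)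
    rw [← Polynomial.map_sub]
    exact (map_dvd_map' _).2 hi
  have hPu : IsCoprime P (u.map (algebraMap K L)) :=
    (isCoprime_norm_iff hQP u).1 (isCoprime_of_not_dvd hQ hu).symm
  have hω3 := symbol_pow_three hL (sq_mod_three h3) hχ hPm hPu
  have hω1 : χ P (u.map (algebraMap K L)) ≠ 1 := by
    intro h1
    obtain ⟨a, -, haP, ha1⟩ := exists_symbol_ne_one_of_congr hL h3 hχ (m := 1) hPm hP hco
      (by simpa using isCoprime_one_right)
    obtain ⟨i, hi, -⟩ := hψ a ((isCoprime_norm_iff hQP a).2 (isCoprime_of_not_dvd hP haP))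
    exact ha1 (by rw [hsym hi, h1, one_pow])
  set ω := χ P (u.map (algebraMap K L)) with hω
  have hω2 := sq_add_self_add_one hω3 hω1
  have hz : (ψ u - 1) * ((ψ u - ω) * (ψ u - ω ^ 2)) = 0 := by
    linear_combination H.cube u hcu - (ψ u ^ 2 - ψ u + (ψ u - 1) * (1 - ω)) * hω2
  rcases mul_eq_zero.1 hz with h | h
  · left
    intro a ha
    obtain ⟨i, -, hi⟩ := hψ a ha
    rw [hi, sub_eq_zero.1 h, one_pow]
  right
  rcases mul_eq_zero.1 h with h | h
  · refine ⟨P, hPm, hP, hco, hQP, fun a ha => ?_⟩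
    obtain ⟨i, hQi, hi⟩ := hψ a ha
    rw [hi, sub_eq_zero.1 h, hsym hQi]
  · refine ⟨conj K P, monic_conj hPm, irreducible_conj hL hP,
      by rw [conj_conj hL]; exact hco.symm,
      by rw [hQP, conj_conj hL, mul_comm], fun a ha => ?_⟩
    obtain ⟨i, hQi, hi⟩ := hψ a ha
    rw [hi, sub_eq_zero.1 h, symbol_conj hL h3 hχ hPm hP, hsym hQi, ← pow_mul, ← pow_mul, mul_comm]

theorem IsCubicMod.exists_isSplit (hL : Fintype.card L = Fintype.card K ^ 2)
    (h3 : Fintype.card K % 3 = 2) (hχ : IsCubicSymbol (Fintype.card K ^ 2) Ω χ)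
    (h : K[X]) (hm : h.Monic) (ψ : K[X] → ℂ) (H : IsCubicMod h ψ) :
    ∃ F : L[X], IsSplit K F ∧ F * conj K F ∣ h.map (algebraMap K L) ∧
      ∀ a, IsCoprime a h → ψ a = χ F (a.map (algebraMap K L)) := by
  induction hd : h.natDegree using Nat.strong_induction_on generalizing h ψ with
  | _ d ih =>
  by_cases h1 : h = 1
  · subst h1
    refine ⟨1, isSplit_one, by simp, fun a _ => ?_⟩
    rw [hχ.2.1, H.congr a 1 (one_dvd _), H.one]
  obtain ⟨Q, hQm, hQ, hQh⟩ := h.exists_monic_irreducible_factor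
    (fun hu => h1 (hm.eq_one_of_isUnit hu))
  obtain ⟨m, hhm, hQm'⟩ :=
    (FiniteMultiplicity.of_prime_left hQ.prime hm.ne_zero).exists_eq_pow_mul_and_not_dvd
  generalize multiplicity Q h = n at hhm
  subst hhm
  have hn : n ≠ 0 := by
    rintro rfl
    exact hQm' (by simpa using hQh)
  have hmm : m.Monic := (hQm.pow n).of_mul_monic_left hm
  have hQmc : IsCoprime Q m := isCoprime_of_not_dvd hQ hQm'
  have hlt : m.natDegree < d := by
    rw [← hd, (hQm.pow n).natDegree_mul hmm, hQm.natDegree_pow]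
    have := Nat.mul_pos (Nat.pos_of_ne_zero hn) hQ.natDegree_pos
    omega
  obtain ⟨x, y, hxy⟩ := hQmc.pow_left (m := n)
  have he : y * m + x * Q ^ n = 1 := by rw [add_comm, hxy]
  have H1 := H.component he (dvd_mul_left _ _) (dvd_mul_left _ _)
  have H2 := IsCubicMod.component (A := m) (B := Q ^ n) (by rwa [mul_comm]) hxy
    (dvd_mul_left _ _) (dvd_mul_left _ _)
  have hψ := fun a => H.eq_mul_components he (dvd_mul_left _ _) (dvd_mul_left _ _) (a := a)
  obtain ⟨F, hF, hFm, hFψ⟩ := ih _ hlt m hmm _ H2 rfl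
  have hcQ : ∀ {a}, IsCoprime a (Q ^ n * m) → IsCoprime a Q := fun ha =>
    (IsCoprime.pow_right_iff (Nat.pos_of_ne_zero hn)).1 ha.of_mul_right_left
  rcases H1.exists_symbol_of_prime_pow hL h3 hχ hQm hQ with htriv | ⟨P, hPm, hP, hco, hQP, hPψ⟩
  · refine ⟨F, hF, hFm.trans ((map_dvd_map' _).2 (dvd_mul_left _ _)), fun a ha => ?_⟩
    rw [hψ a ha, htriv a (hcQ ha), hFψ a ha.of_mul_right_right, one_mul]
  have hcop : IsCoprime (P * conj K P) (F * conj K F) := by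
    rw [← hQP]
    exact ((isCoprime_map (algebraMap K L)).2 hQmc).of_isCoprime_of_dvd_right hFm
  refine ⟨P * F, ⟨hPm.mul hF.monic, ?_, ?_⟩, ?_, fun a ha => ?_⟩
  · exact squarefree_mul_iff.2 ⟨isRelPrime_iff_isCoprime.2
      hcop.of_mul_left_left.of_mul_right_left, hP.squarefree, hF.squarefree⟩
  · rw [map_mul]
    exact (hco.mul_right hcop.of_mul_left_left.of_mul_right_right).mul_left
      (hcop.of_mul_left_right.of_mul_right_left.symm.mul_right hF.isCoprime)
  · rw [map_mul, mul_mul_mul_comm, ← hQP, Polynomial.map_mul, Polynomial.map_pow]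
    exact mul_dvd_mul (dvd_pow_self _ hn) hFm
  · rw [hψ a ha, hPψ a (hcQ ha), hFψ a ha.of_mul_right_right, hχ.2.2.1 P F _ hPm hF.monic]

end Classification

section Characters

variable {K L : Type*} [Field K] [Field L]

theorem isUnit_mk_iff {h a : K[X]} :
    IsUnit (Ideal.Quotient.mk (Ideal.span {h}) a) ↔ IsCoprime a h := by
  rw [isUnit_iff_exists_inv]
  constructor
  · rintro ⟨b, hb⟩
    obtain ⟨b, rfl⟩ := Ideal.Quotient.mk_surjective b
    rw [← map_mul, ← map_one (Ideal.Quotient.mk (Ideal.span {h})), Ideal.Quotient.eq,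
      Ideal.mem_span_singleton] at hb
    obtain ⟨c, hc⟩ := hb
    exact ⟨b, -c, by linear_combination hc⟩
  · rintro ⟨b, c, hbc⟩
    refine ⟨Ideal.Quotient.mk _ b, ?_⟩
    rw [← map_mul, ← map_one (Ideal.Quotient.mk (Ideal.span {h})), Ideal.Quotient.eq,
      Ideal.mem_span_singleton]
    exact ⟨-c, by linear_combination hbc⟩

theorem mk_eq_mk_of_dvd {h a b : K[X]} (hab : h ∣ a - b) :
    Ideal.Quotient.mk (Ideal.span {h}) a = Ideal.Quotient.mk (Ideal.span {h}) b :=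
  Ideal.Quotient.eq.2 (Ideal.mem_span_singleton.2 hab)

theorem mulChar_ext_mk {h : K[X]} {φ ψ : MulChar (K[X] ⧸ Ideal.span {h}) ℂ}
    (H : ∀ a, IsCoprime a h → φ (Ideal.Quotient.mk (Ideal.span {h}) a) =
      ψ (Ideal.Quotient.mk (Ideal.span {h}) a)) : φ = ψ := by
  refine MulChar.ext fun u => ?_
  obtain ⟨a, ha⟩ := Ideal.Quotient.mk_surjective (u : K[X] ⧸ Ideal.span {h})
  rw [← ha]
  exact H a (isUnit_mk_iff.1 (ha ▸ u.isUnit))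

variable [Fintype K] [Fintype L] [Algebra K L]
  {Ω : rootsOfUnity 3 ℂ ≃* rootsOfUnity 3 L} {χ : L[X] → L[X] → ℂ}

theorem exists_mulChar (hL : Fintype.card L = Fintype.card K ^ 2) (h3 : Fintype.card K % 3 = 2)
    (hχ : IsCubicSymbol (Fintype.card K ^ 2) Ω χ) {F : L[X]} (hF : F.Monic) {h : K[X]}
    (hh : h.map (algebraMap K L) = F * conj K F) :
    ∃ φ : MulChar (K[X] ⧸ Ideal.span {h}) ℂ,
      ∀ a, φ (Ideal.Quotient.mk (Ideal.span {h}) a) = χ F (a.map (algebraMap K L)) := by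
  let r := Function.surjInv (Ideal.Quotient.mk_surjective (I := Ideal.span {h}))
  have hr : ∀ x, Ideal.Quotient.mk (Ideal.span {h}) (r x) = x := Function.surjInv_eq _
  have hcongr : ∀ a b, Ideal.Quotient.mk (Ideal.span {h}) a = Ideal.Quotient.mk (Ideal.span {h}) b →
      χ F (a.map (algebraMap K L)) = χ F (b.map (algebraMap K L)) := by
    intro a b hab
    rw [Ideal.Quotient.eq, Ideal.mem_span_singleton] at hab
    refine symbol_congr hL (sq_mod_three h3) hχ hF ?_
    rw [← Polynomial.map_sub]
    exact (hh ▸ dvd_mul_right F (conj K F)).trans ((map_dvd_map' _).2 hab)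
  refine ⟨⟨⟨⟨fun x => χ F ((r x).map (algebraMap K L)), ?_⟩, ?_⟩, ?_⟩, fun a => hcongr _ _ (hr _)⟩
  · rw [hcongr (r 1) 1 (by rw [hr, map_one]), Polynomial.map_one,
      symbol_one hL (sq_mod_three h3) hχ hF]
  · intro x y
    rw [← symbol_mul hL (sq_mod_three h3) hχ hF, ← Polynomial.map_mul]
    exact hcongr _ _ (by rw [hr, map_mul, hr, hr])
  · intro x hx
    refine hχ.1 _ _ fun hc => hx ?_
    rw [← hr x, isUnit_mk_iff]
    exact (isCoprime_norm_iff hh _).2 hc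

theorem isPrimCubicGenus_of_isSplit (hL : Fintype.card L = Fintype.card K ^ 2)
    (h3 : Fintype.card K % 3 = 2) (hχ : IsCubicSymbol (Fintype.card K ^ 2) Ω χ) {g : ℕ}
    (hg : Even g) {F : L[X]} (hF : IsSplit K F) (hdeg : F.natDegree = g / 2 + 1) {h : K[X]}
    (hm : h.Monic) (hh : h.map (algebraMap K L) = F * conj K F)
    {φ : MulChar (K[X] ⧸ Ideal.span {h}) ℂ}
    (hφ : ∀ a, φ (Ideal.Quotient.mk (Ideal.span {h}) a) = χ F (a.map (algebraMap K L))) :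
    IsPrimCubicGenus g h φ := by
  have hhdeg : h.natDegree = g + 2 := by
    rw [← natDegree_map (algebraMap K L), hh, hF.monic.natDegree_mul (monic_conj hF.monic),
      natDegree_conj, hdeg]
    obtain ⟨r, rfl⟩ := hg
    omega
  have hcube : ∀ a, IsCoprime a h → χ F (a.map (algebraMap K L)) ^ 3 = 1 := fun a ha =>
    symbol_pow_three hL (sq_mod_three h3) hχ hF.monic ((isCoprime_norm_iff hh a).1 ha)
  refine ⟨hm, hhdeg, mulChar_ext_mk fun a ha => ?_, ?_, fun c hc => ?_, ?_⟩
  · rw [MulChar.pow_apply' _ three_ne_zero, MulChar.one_apply (isUnit_mk_iff.2 ha), hφ, hcube a ha]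
  · rintro rfl
    obtain ⟨a, ha, -, ha1⟩ := exists_symbol_ne_one_of_proper_dvd hL h3 hχ hF hm hh monic_one
      (one_dvd h) (by rintro rfl; simp at hhdeg)
    exact ha1 (by rw [← hφ, MulChar.one_apply (isUnit_mk_iff.2 ha)])
  · have hu : IsCoprime (C c) h := ⟨C c⁻¹, 0, by
      rw [zero_mul, add_zero, ← C_mul, inv_mul_cancel₀ hc, C_1]⟩
    rw [hφ]
    refine eq_one_of_pow_eq_one (hcube _ hu) (n := Fintype.card K - 1) ?_ (by omega)
    rw [← hφ, ← map_pow, ← map_pow, ← C_pow, FiniteField.pow_card_sub_one_eq_one c hc, C_1,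
      map_one, map_one]
  · rintro h' hm' hd hne ⟨φ', hφ'⟩
    obtain ⟨a, ha, ha', ha1⟩ := exists_symbol_ne_one_of_proper_dvd hL h3 hχ hF hm hh hm' hd hne
    refine ha1 ?_
    rw [← hφ, hφ' a ha, mk_eq_mk_of_dvd ha', map_one, map_one]

theorem exists_isSplit_of_isPrimCubicGenus (hL : Fintype.card L = Fintype.card K ^ 2)
    (h3 : Fintype.card K % 3 = 2) (hχ : IsCubicSymbol (Fintype.card K ^ 2) Ω χ) {g : ℕ}
    {h : K[X]} {φ : MulChar (K[X] ⧸ Ideal.span {h}) ℂ} (hφ : IsPrimCubicGenus g h φ) :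
    ∃ F : L[X], IsSplit K F ∧ F.natDegree = g / 2 + 1 ∧ h.map (algebraMap K L) = F * conj K F ∧
      ∀ a, IsCoprime a h →
        φ (Ideal.Quotient.mk (Ideal.span {h}) a) = χ F (a.map (algebraMap K L)) := by
  obtain ⟨hm, hdeg, hcube, -, -, hprim⟩ := hφ
  have H : IsCubicMod h (fun a => φ (Ideal.Quotient.mk (Ideal.span {h}) a)) := by
    refine ⟨fun a b hab => by rw [mk_eq_mk_of_dvd hab], fun a b _ _ => by rw [map_mul, map_mul],
      fun a ha => ?_⟩
    rw [← MulChar.pow_apply' _ three_ne_zero, hcube, MulChar.one_apply (isUnit_mk_iff.2 ha)]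
  obtain ⟨F, hF, hFh, hval⟩ := H.exists_isSplit hL h3 hχ h hm _
  obtain ⟨n, hn, hnF⟩ := exists_norm (K := K) hL hF.monic
  have hnh : n ∣ h := (map_dvd_map' (algebraMap K L)).1 (hnF ▸ hFh)
  obtain rfl : n = h := by
    by_contra hne
    obtain ⟨φ', hφ'⟩ := exists_mulChar hL h3 hχ hF.monic hnF
    exact hprim n hn hnh hne ⟨φ', fun a ha => (hval a ha).trans (hφ' a).symm⟩
  refine ⟨F, hF, ?_, hnF, hval⟩
  have := congrArg natDegree hnF
  rw [natDegree_map, hF.monic.natDegree_mul (monic_conj hF.monic), natDegree_conj, hdeg] at this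
  omega

/-- The bijection between split polynomials and primitive cubic characters. -/
theorem exists_equiv (hL : Fintype.card L = Fintype.card K ^ 2) (h3 : Fintype.card K % 3 = 2)
    (hχ : IsCubicSymbol (Fintype.card K ^ 2) Ω χ) {g : ℕ} (hg : Even g) :
    ∃ e : {F : L[X] // GoodF K g F} ≃
        {c : Σ h : K[X], MulChar (K[X] ⧸ Ideal.span {h}) ℂ // IsPrimCubicGenus g c.1 c.2},
      ∀ (F : {F : L[X] // GoodF K g F}) (a : K[X]),
        (e F).1.2 (Ideal.Quotient.mk (Ideal.span {(e F).1.1}) a)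
          = χ F.1 (a.map (algebraMap K L)) := by
  have hex : ∀ F : {F : L[X] // GoodF K g F},
      ∃ c : {c : Σ h : K[X], MulChar (K[X] ⧸ Ideal.span {h}) ℂ // IsPrimCubicGenus g c.1 c.2},
        c.1.1.map (algebraMap K L) = F.1 * conj K F.1 ∧
        ∀ a, c.1.2 (Ideal.Quotient.mk (Ideal.span {c.1.1}) a) = χ F.1 (a.map (algebraMap K L)) := by
    rintro ⟨F, hF⟩
    obtain ⟨hs, hdeg⟩ := (goodF_iff hL).1 hF
    obtain ⟨h, hm, hh⟩ := exists_norm (K := K) hL hs.monic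
    obtain ⟨φ, hφ⟩ := exists_mulChar hL h3 hχ hs.monic hh
    exact ⟨⟨⟨h, φ⟩, isPrimCubicGenus_of_isSplit hL h3 hχ hg hs hdeg hm hh hφ⟩, hh, hφ⟩
  choose f hf hval using hex
  refine ⟨Equiv.ofBijective f ⟨fun F G hFG => ?_, ?_⟩, hval⟩
  · have hs := ((goodF_iff hL).1 F.2).1
    have hs' := ((goodF_iff hL).1 G.2).1
    have heq : ∀ a : K[X], χ F.1 (a.map (algebraMap K L)) = χ G.1 (a.map (algebraMap K L)) :=
      fun a => by rw [← hval, ← hval, hFG]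
    exact Subtype.ext (eq_of_monic_of_associated hs.monic hs'.monic (associated_of_dvd_dvd
      (dvd_of_symbol_eq hL h3 hχ hs hs' heq) (dvd_of_symbol_eq hL h3 hχ hs' hs fun a =>
        (heq a).symm)))
  · rintro ⟨⟨h, φ⟩, hφ⟩
    obtain ⟨F, hF, hdeg, hh, hFφ⟩ := exists_isSplit_of_isPrimCubicGenus hL h3 hχ hφ
    refine ⟨⟨F, (goodF_iff hL).2 ⟨hF, hdeg⟩⟩, Subtype.ext ?_⟩
    have h1 := hf ⟨F, (goodF_iff hL).2 ⟨hF, hdeg⟩⟩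
    have h2 := hval ⟨F, (goodF_iff hL).2 ⟨hF, hdeg⟩⟩
    generalize (f ⟨F, (goodF_iff hL).2 ⟨hF, hdeg⟩⟩).1 = c at h1 h2
    obtain ⟨h', φ'⟩ := c
    obtain rfl : h' = h := map_injective _ (algebraMap K L).injective (h1.trans hh.symm)
    exact congrArg (Sigma.mk h') (mulChar_ext_mk fun a ha => (h2 a).trans (hFφ a ha).symm)

theorem finsum_ite_eq_finsum_subtype {ι : Type*} (p : ι → Prop) (f : ι → ℂ) :
    ∑ᶠ i, (if p i then f i else 0) = ∑ᶠ i : Subtype p, f i := by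
  rw [finsum_subtype_eq_finsum_cond]
  simp only [finsum_eq_if]

end Characters

end CubicCharacters

/-- For q ≡ 2 (mod 3) an odd prime power and g even, the primitive cubic
characters of genus g over F_q(T) are in bijection, via F ↦ χ_F|_{F_q[T]}, with the monic
squarefree F ∈ F_{q²}[T] of degree g/2 + 1 having no irreducible divisor in F_q[T].
Consequently Σ_{χ primitive cubic, genus χ = g} L_q(1/2, χ)
 = Σ_{F ∈ H_{q²}, P|F ⇒ P ∉ F_q[T]} L_q(1/2, χ_F). -/
theorem primitive_cubic_characters_bijection {Fq Fq2 : Type*} [Field Fq] [Field Fq2]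
    [Fintype Fq] [Fintype Fq2] [Algebra Fq Fq2]
    (q g : ℕ) (hq : Fintype.card Fq = q) (hq2 : Fintype.card Fq2 = q ^ 2)
    (hodd : Odd q) (h3 : q % 3 = 2) (hg : Even g)
    (Ω : rootsOfUnity 3 ℂ ≃* rootsOfUnity 3 Fq2)
    (χsym : Polynomial Fq2 → Polynomial Fq2 → ℂ) (hχ : IsCubicSymbol (q ^ 2) Ω χsym) :
    (∃ e : {F : Polynomial Fq2 // GoodF Fq g F} ≃
        {c : Σ h : Polynomial Fq, MulChar (Polynomial Fq ⧸ Ideal.span {h}) ℂ //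
          IsPrimCubicGenus g c.1 c.2},
      ∀ (F : {F : Polynomial Fq2 // GoodF Fq g F}) (a : Polynomial Fq),
        IsCoprime (a.map (algebraMap Fq Fq2)) F.1 →
          (e F).1.2 (Ideal.Quotient.mk (Ideal.span {(e F).1.1}) a)
            = χsym F.1 (a.map (algebraMap Fq Fq2))) ∧
    (∑ᶠ c : Σ h : Polynomial Fq, MulChar (Polynomial Fq ⧸ Ideal.span {h}) ℂ,
        if IsPrimCubicGenus g c.1 c.2 then LhalfChar q c.1 c.2 else 0)
      = ∑ᶠ F : Polynomial Fq2, if GoodF Fq g F then LhalfSym Fq q χsym F else 0 := by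
  subst hq
  obtain ⟨e, he⟩ := CubicCharacters.exists_equiv hq2 h3 hχ hg
  refine ⟨⟨e, fun F a _ => he F a⟩, ?_⟩
  rw [CubicCharacters.finsum_ite_eq_finsum_subtype, CubicCharacters.finsum_ite_eq_finsum_subtype,
    ← finsum_comp_equiv e]
  refine finsum_congr fun F => ?_
  simp only [LhalfChar, LhalfSym, he]
end
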